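/- Let p, q : ℝ³ → ℝ be smooth functions supported in the closed unit ball B̄ and each vanishing on a neighborhood of the origin. Let K = {(x,t) ∈ ℝ³×ℝ : x ≠ 0, −|x| < t}, let f : K → ℝ be a bounded measurable function, and let α : K → ℝ be a continuous function such that: (i) for each t ∈ ℝ the set {x : (x,t) ∈ K, α(x,t) ≠ 0} is bounded; (ii) α is smooth on K ∩ {t ≥ |x|} and smooth on K ∩ {t ≤ |x|}; (iii) for every smooth compactly supported test function χ : ℝ³×ℝ → ℝ with support contained in K, ∫_K α(x,t)·(∂ₜ²χ(x,t) − Δₓχ(x,t) + q(x)χ(x,t)) dx dt = ∫_K p(x) f(x,t) χ(x,t) dx dt; (iv) α(x,|x|) = ∫₀¹ p(sx) ds for all x ≠ 0; and (v) α(x,t) = 0 and (x·∇ₓα)(x,t) = 0 for all x with |x| = 1 and t ∈ (−1,3), t ≠ 1 (the radial derivative taken within the region of smoothness containing (x,t)). Then p = 0. -/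

import Mathlib

open MeasureTheory

/-- Second directional derivative of `f` at `p` in direction `v`. -/
noncomputable def dir2 {E : Type*} [NormedAddCommGroup E] [NormedSpace ℝ E]
    (f : E → ℝ) (p v : E) : ℝ :=
  iteratedDeriv 2 (fun s : ℝ => f (p + s • v)) 0

/-- The wave operator `□u = ∂ₜ²u − Δₓu` on `ℝ³ × ℝ`. -/
noncomputable def waveOp3 (u : EuclideanSpace ℝ (Fin 3) × ℝ → ℝ)
    (p : EuclideanSpace ℝ (Fin 3) × ℝ) : ℝ :=
  dir2 u p (0, 1) - ∑ i : Fin 3, dir2 u p (EuclideanSpace.single i 1, 0)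

/-- The region `K = {(x,t) ∈ ℝ³ × ℝ : x ≠ 0, −|x| < t}`. -/
def regionK : Set (EuclideanSpace ℝ (Fin 3) × ℝ) :=
  {p | p.1 ≠ 0 ∧ -‖p.1‖ < p.2}

/-! ### Scalar jet expressions for the Carleman identity -/

/-- The Carleman weight `exp (2τ(4r² - s²))`. -/
noncomputable def carlemanWeight (τ r s : ℝ) : ℝ := Real.exp (2 * τ * (4 * r ^ 2 - s ^ 2))

/-- Conjugated derivative along the outgoing null direction, in terms of the jet
`(v, e) = (V, x·∇V)`. -/
noncomputable def conjOut (τ r v e : ℝ) : ℝ := e / (2 * r) + 4 * τ * r * v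

/-- Conjugated derivative along the incoming null direction, in terms of the jet
`(v, e, t) = (V, x·∇V, ∂ₛV)`. -/
noncomputable def conjIn (τ r s v e t : ℝ) : ℝ := t - e / (2 * r) - 2 * τ * (2 * r + s) * v

/-- The potential-type part of the Carleman flux; `K` is the squared angular gradient. -/
noncomputable def fluxPotential (τ r s v K : ℝ) : ℝ :=
  K / (4 * r ^ 2) - 8 * τ ^ 2 * r * (2 * r + s) * v ^ 2 + 2 * τ * v ^ 2

/-- The conjugated Carleman multiplier. -/
noncomputable def conjMultiplier (τ r s v e t : ℝ) : ℝ :=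
  4 * r * conjIn τ r s v e t - 2 * (2 * r + s) * conjOut τ r v e

/-- Radial Carleman flux. -/
noncomputable def radialFlux (τ r s v e t K : ℝ) : ℝ :=
  carlemanWeight τ r s * (2 * r * conjIn τ r s v e t ^ 2 + (2 * r + s) * conjOut τ r v e ^ 2
    - (4 * r + s) * fluxPotential τ r s v K)

/-- Carleman flux through the slices of constant `s`. -/
noncomputable def timeFlux (τ r s v e K : ℝ) : ℝ :=
  carlemanWeight τ r s * (4 * r * fluxPotential τ r s v K
    - 2 * (2 * r + s) * conjOut τ r v e ^ 2) / r ^ 2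

/-- Angular Carleman flux. -/
noncomputable def angularFlux (τ r s v e t k : ℝ) : ℝ :=
  -(carlemanWeight τ r s * (k * conjMultiplier τ r s v e t)) / (2 * r ^ 4)

section ScalarCalculus

variable {τ x r' s' v' e' t' K' k' : ℝ} {r s v e t K k : ℝ → ℝ}

theorem hasDerivAt_carlemanWeight (hr : HasDerivAt r r' x) (hs : HasDerivAt s s' x) :
    HasDerivAt (fun h => carlemanWeight τ (r h) (s h))
      (carlemanWeight τ (r x) (s x) * (2 * τ * (8 * r x * r' - 2 * s x * s'))) x := by
  have h := ((((hr.pow 2).const_mul 4).sub (hs.pow 2)).const_mul (2 * τ)).exp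
  refine h.congr_deriv ?_
  simp [carlemanWeight]
  left
  ring

theorem hasDerivAt_conjOut (hr0 : r x ≠ 0) (hr : HasDerivAt r r' x) (hv : HasDerivAt v v' x)
    (he : HasDerivAt e e' x) :
    HasDerivAt (fun h => conjOut τ (r h) (v h) (e h))
      (e' / (2 * r x) - e x * r' / (2 * r x ^ 2) + 4 * τ * (r' * v x + r x * v')) x := by
  have h := (he.div (hr.const_mul 2) (by simpa using hr0)).add ((hr.const_mul (4 * τ)).mul hv)
  refine h.congr_deriv ?_
  field_simp

theorem hasDerivAt_conjIn (hr0 : r x ≠ 0) (hr : HasDerivAt r r' x) (hs : HasDerivAt s s' x)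
    (hv : HasDerivAt v v' x) (he : HasDerivAt e e' x) (ht : HasDerivAt t t' x) :
    HasDerivAt (fun h => conjIn τ (r h) (s h) (v h) (e h) (t h))
      (t' - (e' / (2 * r x) - e x * r' / (2 * r x ^ 2))
        - 2 * τ * ((2 * r' + s') * v x + (2 * r x + s x) * v')) x := by
  have h := (ht.sub (he.div (hr.const_mul 2) (by simpa using hr0))).sub
    ((((hr.const_mul 2).add hs).const_mul (2 * τ)).mul hv)
  refine h.congr_deriv ?_
  simp
  field_simp

theorem hasDerivAt_fluxPotential (hr0 : r x ≠ 0) (hr : HasDerivAt r r' x)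
    (hs : HasDerivAt s s' x) (hv : HasDerivAt v v' x) (hK : HasDerivAt K K' x) :
    HasDerivAt (fun h => fluxPotential τ (r h) (s h) (v h) (K h))
      (K' / (4 * r x ^ 2) - K x * r' / (2 * r x ^ 3)
        - 8 * τ ^ 2 * ((r' * (2 * r x + s x) + r x * (2 * r' + s')) * v x ^ 2
          + r x * (2 * r x + s x) * (2 * v x * v')) + 4 * τ * v x * v') x := by
  have h := ((hK.div ((hr.pow 2).const_mul 4) (by simpa using hr0)).sub
    ((((hr.const_mul (8 * τ ^ 2)).mul ((hr.const_mul 2).add hs)).mul (hv.pow 2)))).add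
    ((hv.pow 2).const_mul (2 * τ))
  refine h.congr_deriv ?_
  simp
  field_simp
  ring

theorem hasDerivAt_radialFlux (hr0 : r x ≠ 0) (hr : HasDerivAt r (r x) x)
    (hs : HasDerivAt s 0 x) (hv : HasDerivAt v (e x) x) (he : HasDerivAt e e' x)
    (ht : HasDerivAt t t' x) (hK : HasDerivAt K K' x) :
    HasDerivAt (fun h => radialFlux τ (r h) (s h) (v h) (e h) (t h) (K h))
      (carlemanWeight τ (r x) (s x) * (16 * τ * r x ^ 2 *
        (2 * r x * conjIn τ (r x) (s x) (v x) (e x) (t x) ^ 2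
          + (2 * r x + s x) * conjOut τ (r x) (v x) (e x) ^ 2
          - (4 * r x + s x) * fluxPotential τ (r x) (s x) (v x) (K x))
        + (2 * r x * conjIn τ (r x) (s x) (v x) (e x) (t x) ^ 2
          + 4 * r x * conjIn τ (r x) (s x) (v x) (e x) (t x) *
            (t' - (e' / (2 * r x) - e x / (2 * r x))
              - 2 * τ * (2 * r x * v x + (2 * r x + s x) * e x))
          + 2 * r x * conjOut τ (r x) (v x) (e x) ^ 2
          + 2 * (2 * r x + s x) * conjOut τ (r x) (v x) (e x) *
            (e' / (2 * r x) - e x / (2 * r x) + 4 * τ * (r x * v x + r x * e x))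
          - 4 * r x * fluxPotential τ (r x) (s x) (v x) (K x)
          - (4 * r x + s x) * (K' / (4 * r x ^ 2) - K x / (2 * r x ^ 2)
            - 8 * τ ^ 2 * ((r x * (2 * r x + s x) + r x * (2 * r x)) * v x ^ 2
              + r x * (2 * r x + s x) * (2 * v x * e x)) + 4 * τ * v x * e x)))) x := by
  have hW := hasDerivAt_carlemanWeight (τ := τ) hr hs
  have hA := hasDerivAt_conjOut (τ := τ) hr0 hr hv he
  have hB := hasDerivAt_conjIn (τ := τ) hr0 hr hs hv he ht
  have hG := hasDerivAt_fluxPotential (τ := τ) hr0 hr hs hv hK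
  have h := hW.mul ((((hr.const_mul 2).mul (hB.pow 2)).add
    (((hr.const_mul 2).add hs).mul (hA.pow 2))).sub (((hr.const_mul 4).add hs).mul hG))
  refine h.congr_deriv ?_
  simp
  generalize conjOut τ (r x) (v x) (e x) = a
  generalize conjIn τ (r x) (s x) (v x) (e x) (t x) = b
  generalize fluxPotential τ (r x) (s x) (v x) (K x) = g
  generalize carlemanWeight τ (r x) (s x) = W
  field_simp
  ring

theorem hasDerivAt_timeFlux (hr0 : r x ≠ 0) (hr : HasDerivAt r 0 x)
    (hs : HasDerivAt s 1 x) (hv : HasDerivAt v v' x) (he : HasDerivAt e e' x)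
    (hK : HasDerivAt K K' x) :
    HasDerivAt (fun h => timeFlux τ (r h) (s h) (v h) (e h) (K h))
      (carlemanWeight τ (r x) (s x) * (-4 * τ * s x *
        (4 * r x * fluxPotential τ (r x) (s x) (v x) (K x)
          - 2 * (2 * r x + s x) * conjOut τ (r x) (v x) (e x) ^ 2)
        + (4 * r x * (K' / (4 * r x ^ 2) - 8 * τ ^ 2 * (r x * v x ^ 2
              + r x * (2 * r x + s x) * (2 * v x * v')) + 4 * τ * v x * v')
          - 2 * conjOut τ (r x) (v x) (e x) ^ 2
          - 4 * (2 * r x + s x) * conjOut τ (r x) (v x) (e x) *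
            (e' / (2 * r x) + 4 * τ * (r x * v')))) / r x ^ 2) x := by
  have hW := hasDerivAt_carlemanWeight (τ := τ) hr hs
  have hA := hasDerivAt_conjOut (τ := τ) hr0 hr hv he
  have hG := hasDerivAt_fluxPotential (τ := τ) hr0 hr hs hv hK
  have h := (hW.mul (((hr.const_mul 4).mul hG).sub
    ((((hr.const_mul 2).add hs).const_mul 2).mul (hA.pow 2)))).div (hr.pow 2)
    (by simpa using hr0)
  refine h.congr_deriv ?_
  simp
  generalize conjOut τ (r x) (v x) (e x) = a
  generalize fluxPotential τ (r x) (s x) (v x) (K x) = g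
  generalize carlemanWeight τ (r x) (s x) = W
  field_simp
  ring

theorem hasDerivAt_angularFlux (hr0 : r x ≠ 0) (hr : HasDerivAt r 0 x)
    (hs : HasDerivAt s 0 x) (hv : HasDerivAt v (k x) x) (he : HasDerivAt e e' x)
    (ht : HasDerivAt t t' x) (hk : HasDerivAt k k' x) :
    HasDerivAt (fun h => angularFlux τ (r h) (s h) (v h) (e h) (t h) (k h))
      (-(carlemanWeight τ (r x) (s x) *
        (k' * conjMultiplier τ (r x) (s x) (v x) (e x) (t x)
          + k x * (4 * r x * t' - 2 * e' - 8 * τ * r x * (2 * r x + s x) * k x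
            - 2 * (2 * r x + s x) * (e' / (2 * r x) + 4 * τ * r x * k x)))) / (2 * r x ^ 4)) x := by
  have hW := hasDerivAt_carlemanWeight (τ := τ) hr hs
  have hA := hasDerivAt_conjOut (τ := τ) hr0 hr hv he
  have hB := hasDerivAt_conjIn (τ := τ) hr0 hr hs hv he ht
  have h := ((hW.mul (hk.mul (((hr.const_mul 4).mul hB).sub
    ((((hr.const_mul 2).add hs).const_mul 2).mul hA)))).neg).div ((hr.pow 4).const_mul 2)
    (by simpa using hr0)
  refine h.congr_deriv ?_
  simp [conjMultiplier]
  generalize conjOut τ (r x) (v x) (e x) = a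
  generalize conjIn τ (r x) (s x) (v x) (e x) (t x) = b
  generalize carlemanWeight τ (r x) (s x) = W
  field_simp
  ring

/-- Radial flux for the energy identity with the outgoing null derivative as multiplier. -/
noncomputable def radialTraceFlux (τ r s e K : ℝ) : ℝ :=
  carlemanWeight τ r s * (K - e ^ 2) / (8 * r ^ 2)

/-- Flux through slices of constant `s` for the energy identity with the outgoing null
derivative as multiplier. -/
noncomputable def timeTraceFlux (τ r s e : ℝ) : ℝ :=
  carlemanWeight τ r s * e ^ 2 / (4 * r ^ 4)

/-- Angular flux for the energy identity with the outgoing null derivative as multiplier. -/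
noncomputable def angularTraceFlux (τ r s e k : ℝ) : ℝ :=
  -(carlemanWeight τ r s * (k * e)) / (4 * r ^ 5)

theorem hasDerivAt_radialTraceFlux (hr0 : r x ≠ 0) (hr : HasDerivAt r (r x) x)
    (hs : HasDerivAt s 0 x) (he : HasDerivAt e e' x) (hK : HasDerivAt K K' x) :
    HasDerivAt (fun h => radialTraceFlux τ (r h) (s h) (e h) (K h))
      (carlemanWeight τ (r x) (s x) * (16 * τ * r x ^ 2 * (K x - e x ^ 2) + (K' - 2 * e x * e')
        - 2 * (K x - e x ^ 2)) / (8 * r x ^ 2)) x := by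
  have hW := hasDerivAt_carlemanWeight (τ := τ) hr hs
  have h := (hW.mul (hK.sub (he.pow 2))).div ((hr.pow 2).const_mul 8) (by simpa using hr0)
  refine h.congr_deriv ?_
  simp
  generalize carlemanWeight τ (r x) (s x) = W
  field_simp
  ring

theorem hasDerivAt_timeTraceFlux (hr0 : r x ≠ 0) (hr : HasDerivAt r 0 x)
    (hs : HasDerivAt s 1 x) (he : HasDerivAt e e' x) :
    HasDerivAt (fun h => timeTraceFlux τ (r h) (s h) (e h))
      (carlemanWeight τ (r x) (s x) * (2 * e x * e' - 4 * τ * s x * e x ^ 2)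
        / (4 * r x ^ 4)) x := by
  have hW := hasDerivAt_carlemanWeight (τ := τ) hr hs
  have h := (hW.mul (he.pow 2)).div ((hr.pow 4).const_mul 4) (by simpa using hr0)
  refine h.congr_deriv ?_
  simp
  generalize carlemanWeight τ (r x) (s x) = W
  field_simp
  ring

theorem hasDerivAt_angularTraceFlux (hr0 : r x ≠ 0) (hr : HasDerivAt r 0 x)
    (hs : HasDerivAt s 0 x) (he : HasDerivAt e e' x) (hk : HasDerivAt k k' x) :
    HasDerivAt (fun h => angularTraceFlux τ (r h) (s h) (e h) (k h))
      (-(carlemanWeight τ (r x) (s x) * (k' * e x + k x * e')) / (4 * r x ^ 5)) x := by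
  have hW := hasDerivAt_carlemanWeight (τ := τ) hr hs
  have h := ((hW.mul (hk.mul he)).neg).div ((hr.pow 5).const_mul 4) (by simpa using hr0)
  refine h.congr_deriv ?_
  simp
  generalize carlemanWeight τ (r x) (s x) = W
  field_simp

end ScalarCalculus

/-- Pointwise Carleman inequality: the divergence of the Carleman flux, written in terms of the
second-order jet, dominates the weighted lower-order terms up to the square of the operator. -/
theorem carleman_pointwise {τ r s v e t ee et K KE KT KK W : ℝ} (hr : 0 < r) (hτ : 0 < τ)
    (hW : 0 ≤ W) :
    W / r ^ 2 * ((2 * r + s) / (2 * r ^ 3) * K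
        + (8 * τ ^ 2 * (2 * r + s) * (10 * r + s) - 8 * τ) * v ^ 2) ≤
      (W * (16 * τ * r ^ 2 *
        (2 * r * conjIn τ r s v e t ^ 2
          + (2 * r + s) * conjOut τ r v e ^ 2
          - (4 * r + s) * fluxPotential τ r s v K)
        + (2 * r * conjIn τ r s v e t ^ 2
          + 4 * r * conjIn τ r s v e t *
            (et - (ee / (2 * r) - e / (2 * r))
              - 2 * τ * (2 * r * v + (2 * r + s) * e))
          + 2 * r * conjOut τ r v e ^ 2
          + 2 * (2 * r + s) * conjOut τ r v e *
            (ee / (2 * r) - e / (2 * r) + 4 * τ * (r * v + r * e))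
          - 4 * r * fluxPotential τ r s v K
          - (4 * r + s) * (2 * KE / (4 * r ^ 2) - K / (2 * r ^ 2)
            - 8 * τ ^ 2 * ((r * (2 * r + s) + r * (2 * r)) * v ^ 2
              + r * (2 * r + s) * (2 * v * e)) + 4 * τ * v * e)))) / r ^ 3
      + W * (-4 * τ * s *
        (4 * r * fluxPotential τ r s v K
          - 2 * (2 * r + s) * conjOut τ r v e ^ 2)
        + (4 * r * (2 * KT / (4 * r ^ 2) - 8 * τ ^ 2 * (r * v ^ 2
              + r * (2 * r + s) * (2 * v * t)) + 4 * τ * v * t)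
          - 2 * conjOut τ r v e ^ 2
          - 4 * (2 * r + s) * conjOut τ r v e *
            (et / (2 * r) + 4 * τ * (r * t)))) / r ^ 2
      + -(W * (KK * conjMultiplier τ r s v e t
          + (4 * r * KT - 2 * KE - 8 * τ * r * (2 * r + s) * K
            - 2 * (2 * r + s) * (KE / (2 * r) + 4 * τ * r * K)))) / (2 * r ^ 4)
      + W * (2 * r * et - ee + e - KK) ^ 2 / (32 * τ * r ^ 6) := by
  have key : ∀ Y : ℝ, 0 ≤ W / r ^ 2 * (2 * conjIn τ r s v e t ^ 2
      + (2 * τ * Y + (2 * r * et - ee + e - KK) / (4 * r ^ 2)) ^ 2 / (2 * τ)) := by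
    intro Y
    positivity
  have h := key (conjMultiplier τ r s v e t)
  rw [← sub_nonneg]
  refine h.trans_eq ?_
  unfold conjMultiplier fluxPotential conjIn conjOut
  field_simp
  ring

/-- Pointwise energy inequality with the outgoing null derivative as multiplier. -/
theorem trace_pointwise {τ r s e ee et K KE KK W : ℝ} (hr : 0 < r) (hτ : 0 < τ)
    (hW : 0 ≤ W) (ha : 0 < 2 * r + s) (hK : 0 ≤ K) :
    W * (16 * τ * r ^ 2 * (K - e ^ 2) + (2 * KE - 2 * e * ee) - 2 * (K - e ^ 2))
        / (8 * r ^ 2) / r ^ 3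
      + W * (2 * e * et - 4 * τ * s * e ^ 2) / (4 * r ^ 4)
      + -(W * (KK * e + KE)) / (4 * r ^ 5) ≤
      W * (2 * r * et - ee + e - KK) ^ 2 / (64 * τ * (2 * r + s) * r ^ 6)
        + 2 * τ * W * K / r ^ 3 := by
  obtain ⟨a, rfl⟩ : ∃ a, s = a - 2 * r := ⟨s + 2 * r, by ring⟩
  have hs : 2 * r + (a - 2 * r) = a := by ring
  rw [hs] at ha ⊢
  have h : 0 ≤ W / r ^ 2 * (K / (4 * r ^ 3) + (4 * τ * a * (e / (2 * r))
      - (2 * r * et - ee + e - KK) / (4 * r ^ 2)) ^ 2 / (4 * τ * a)) := by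
    positivity
  rw [← sub_nonneg]
  refine h.trans_eq ?_
  field_simp
  ring

/-! ### Vector fields on space-time and derivatives along them -/

/-- Three-dimensional Euclidean space. -/
abbrev Space3 := EuclideanSpace ℝ (Fin 3)

/-- The infinitesimal rotation in the coordinate plane `(k, k + 1)`. -/
noncomputable def rotGen (k : Fin 3) : Space3 →L[ℝ] Space3 :=
  (EuclideanSpace.proj k : Space3 →L[ℝ] ℝ).smulRight (EuclideanSpace.single (k + 1) (1 : ℝ))
    - (EuclideanSpace.proj (k + 1) : Space3 →L[ℝ] ℝ).smulRight (EuclideanSpace.single k (1 : ℝ))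

/-- The Euler field `x·∇ₓ`. -/
def eulerField (z : Space3 × ℝ) : Space3 × ℝ := (z.1, 0)

/-- The rotation field in the coordinate plane `(k, k + 1)`. -/
noncomputable def rotField (k : Fin 3) (z : Space3 × ℝ) : Space3 × ℝ := (rotGen k z.1, 0)

/-- The coordinate field `∂ₛ`. -/
def timeField (_ : Space3 × ℝ) : Space3 × ℝ := (0, 1)

/-- The slab `{x ≠ 0} × [a, b]`. -/
def slab (a b : ℝ) : Set (Space3 × ℝ) := {0}ᶜ ×ˢ Set.Icc a b

/-- The derivative of `V` within `S` along the vector field `X`. -/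
noncomputable def lieD (S : Set (Space3 × ℝ)) (X : Space3 × ℝ → Space3 × ℝ)
    (V : Space3 × ℝ → ℝ) (z : Space3 × ℝ) : ℝ :=
  fderivWithin ℝ V S z (X z)

theorem inner_rotGen (k : Fin 3) (x : Space3) : inner ℝ x (rotGen k x) = 0 := by
  simp [rotGen, inner_sub_right, inner_smul_right, EuclideanSpace.inner_single_right]
  ring

theorem contDiff_eulerField {n : WithTop ℕ∞} : ContDiff ℝ n eulerField := by
  unfold eulerField; fun_prop

theorem contDiff_rotField {n : WithTop ℕ∞} (k : Fin 3) : ContDiff ℝ n (rotField k) := by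
  unfold rotField; fun_prop

theorem contDiff_timeField {n : WithTop ℕ∞} : ContDiff ℝ n timeField := by
  unfold timeField; fun_prop

theorem uniqueDiffOn_slab {a b : ℝ} (hab : a < b) : UniqueDiffOn ℝ (slab a b) :=
  isOpen_compl_singleton.uniqueDiffOn.prod (uniqueDiffOn_Icc hab)

theorem slab_mem_nhds {a b : ℝ} {z : Space3 × ℝ} (hx : z.1 ≠ 0) (hs : z.2 ∈ Set.Ioo a b) :
    slab a b ∈ nhds z := by
  rw [slab]
  exact prod_mem_nhds (isOpen_compl_singleton.mem_nhds hx) (Icc_mem_nhds hs.1 hs.2)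

theorem ContDiffOn.lieD {S : Set (Space3 × ℝ)} (hS : UniqueDiffOn ℝ S)
    {X : Space3 × ℝ → Space3 × ℝ} (hX : ContDiff ℝ 1 X) {V : Space3 × ℝ → ℝ}
    (hV : ContDiffOn ℝ 2 V S) : ContDiffOn ℝ 1 (lieD S X V) S :=
  (hV.fderivWithin hS (by norm_num)).clm_apply hX.contDiffOn

theorem ContDiffOn.continuousOn_lieD {S : Set (Space3 × ℝ)} (hS : UniqueDiffOn ℝ S)
    {X : Space3 × ℝ → Space3 × ℝ} (hX : Continuous X) {V : Space3 × ℝ → ℝ}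
    (hV : ContDiffOn ℝ 1 V S) : ContinuousOn (_root_.lieD S X V) S :=
  (hV.continuousOn_fderivWithin hS (by norm_num)).clm_apply hX.continuousOn

theorem lieD_of_mem_nhds {S : Set (Space3 × ℝ)} {z : Space3 × ℝ} (hS : S ∈ nhds z)
    (X : Space3 × ℝ → Space3 × ℝ) (V : Space3 × ℝ → ℝ) :
    lieD S X V z = fderiv ℝ V z (X z) := by
  rw [lieD, fderivWithin_of_mem_nhds hS]

theorem lieD_eventuallyEq {S : Set (Space3 × ℝ)} {z : Space3 × ℝ} (hS : S ∈ nhds z)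
    (X : Space3 × ℝ → Space3 × ℝ) (V : Space3 × ℝ → ℝ) :
    lieD S X V =ᶠ[nhds z] fun y => fderiv ℝ V y (X y) := by
  filter_upwards [eventually_mem_nhds_iff.2 hS] with y hy using lieD_of_mem_nhds hy X V

/-- Derivatives along a curve with velocity `X` are derivatives along the line `z + h X(z)`. -/
theorem hasDerivAt_lieD {S : Set (Space3 × ℝ)} {z : Space3 × ℝ} (hS : S ∈ nhds z)
    {F : Space3 × ℝ → ℝ} (hF : ContDiffOn ℝ 1 F S) (X : Space3 × ℝ → Space3 × ℝ) :
    HasDerivAt (fun h : ℝ => F (z + h • X z)) (lieD S X F z) 0 := by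
  rw [lieD_of_mem_nhds hS]
  have hd : HasFDerivAt F (fderiv ℝ F z) (z + (0 : ℝ) • X z) := by
    simpa using ((hF.contDiffAt hS).differentiableAt (by norm_num)).hasFDerivAt
  have hl : HasDerivAt (fun h : ℝ => z + h • X z) (X z) 0 := by
    simpa using ((hasDerivAt_id (0 : ℝ)).smul_const (X z)).const_add z
  exact hd.comp_hasDerivAt 0 hl

theorem lieD_comm {S : Set (Space3 × ℝ)} {z : Space3 × ℝ} (hS : S ∈ nhds z)
    {V : Space3 × ℝ → ℝ} (hV : ContDiffOn ℝ 2 V S) {X Y : Space3 × ℝ → Space3 × ℝ}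
    {X' Y' : Space3 × ℝ →L[ℝ] Space3 × ℝ} (hX : HasFDerivAt X X' z) (hY : HasFDerivAt Y Y' z)
    (hXY : X' (Y z) = Y' (X z)) :
    lieD S X (lieD S Y V) z = lieD S Y (lieD S X V) z := by
  have hc : ContDiffAt ℝ 2 V z := hV.contDiffAt hS
  have hd : DifferentiableAt ℝ (fderiv ℝ V) z :=
    (hc.fderiv_right (m := 1) (by norm_num)).differentiableAt (by norm_num)
  have hsymm : IsSymmSndFDerivAt ℝ V z := hc.isSymmSndFDerivAt (by simp)
  rw [lieD_of_mem_nhds hS, lieD_of_mem_nhds hS, (lieD_eventuallyEq hS Y V).fderiv_eq,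
    (lieD_eventuallyEq hS X V).fderiv_eq, (hd.hasFDerivAt.clm_apply hY).fderiv,
    (hd.hasFDerivAt.clm_apply hX).fderiv]
  simp [hXY, hsymm.eq (X z) (Y z)]

theorem hasFDerivAt_eulerField (z : Space3 × ℝ) :
    HasFDerivAt eulerField
      ((ContinuousLinearMap.fst ℝ Space3 ℝ).prod (0 : Space3 × ℝ →L[ℝ] ℝ)) z :=
  ((ContinuousLinearMap.fst ℝ Space3 ℝ).prod (0 : Space3 × ℝ →L[ℝ] ℝ)).hasFDerivAt

theorem hasFDerivAt_rotField (k : Fin 3) (z : Space3 × ℝ) :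
    HasFDerivAt (rotField k) (((rotGen k).comp (ContinuousLinearMap.fst ℝ Space3 ℝ)).prod
      (0 : Space3 × ℝ →L[ℝ] ℝ)) z :=
  (((rotGen k).comp (ContinuousLinearMap.fst ℝ Space3 ℝ)).prod
      (0 : Space3 × ℝ →L[ℝ] ℝ)).hasFDerivAt

theorem hasFDerivAt_timeField (z : Space3 × ℝ) :
    HasFDerivAt timeField (0 : Space3 × ℝ →L[ℝ] Space3 × ℝ) z :=
  hasFDerivAt_const _ _

section Commutation

variable {S : Set (Space3 × ℝ)} {z : Space3 × ℝ} {V : Space3 × ℝ → ℝ}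

theorem lieD_euler_time (hS : S ∈ nhds z) (hV : ContDiffOn ℝ 2 V S) :
    lieD S timeField (lieD S eulerField V) z = lieD S eulerField (lieD S timeField V) z :=
  lieD_comm hS hV (hasFDerivAt_timeField z) (hasFDerivAt_eulerField z) (by simp [timeField]; rfl)

theorem lieD_rot_euler (k : Fin 3) (hS : S ∈ nhds z) (hV : ContDiffOn ℝ 2 V S) :
    lieD S (rotField k) (lieD S eulerField V) z = lieD S eulerField (lieD S (rotField k) V) z :=
  lieD_comm hS hV (hasFDerivAt_rotField k z) (hasFDerivAt_eulerField z)
    (by simp [eulerField, rotField])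

theorem lieD_rot_time (k : Fin 3) (hS : S ∈ nhds z) (hV : ContDiffOn ℝ 2 V S) :
    lieD S (rotField k) (lieD S timeField V) z = lieD S timeField (lieD S (rotField k) V) z :=
  lieD_comm hS hV (hasFDerivAt_rotField k z) (hasFDerivAt_timeField z)
    (by simp [timeField])

end Commutation

theorem hasDerivAt_norm_euler {z : Space3 × ℝ} :
    HasDerivAt (fun h : ℝ => ‖(z + h • eulerField z).1‖) ‖z.1‖ 0 := by
  have h1 : HasDerivAt (fun h : ℝ => (1 + h) * ‖z.1‖) ‖z.1‖ 0 := by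
    simpa using ((hasDerivAt_id (0 : ℝ)).const_add 1).mul_const ‖z.1‖
  refine h1.congr_of_eventuallyEq ?_
  filter_upwards [lt_mem_nhds (show (-1 : ℝ) < 0 by norm_num)] with h hh
  have : z.1 + h • z.1 = (1 + h) • z.1 := by rw [add_smul, one_smul]
  simp only [eulerField, Prod.fst_add, Prod.smul_fst, this, norm_smul, Real.norm_eq_abs]
  rw [abs_of_pos (by linarith)]

theorem hasDerivAt_norm_rot (k : Fin 3) {z : Space3 × ℝ} (hx : z.1 ≠ 0) :
    HasDerivAt (fun h : ℝ => ‖(z + h • rotField k z).1‖) 0 0 := by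
  have hl : HasDerivAt (fun h : ℝ => (z + h • rotField k z).1) (rotGen k z.1) 0 := by
    simpa [rotField] using ((hasDerivAt_id (0 : ℝ)).smul_const (rotGen k z.1)).const_add z.1
  have h1 := hl.norm_sq
  have h2 := h1.sqrt (by simpa using hx)
  simp only [Real.sqrt_sq (norm_nonneg _)] at h2
  refine h2.congr_deriv ?_
  simp [inner_rotGen]

theorem hasDerivAt_norm_time {z : Space3 × ℝ} :
    HasDerivAt (fun h : ℝ => ‖(z + h • timeField z).1‖) 0 0 := by
  simpa [timeField] using hasDerivAt_const (0 : ℝ) ‖z.1‖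

theorem hasDerivAt_snd_line {z : Space3 × ℝ} (X : Space3 × ℝ → Space3 × ℝ) :
    HasDerivAt (fun h : ℝ => (z + h • X z).2) (X z).2 0 := by
  simpa using ((hasDerivAt_id (0 : ℝ)).mul_const (X z).2).const_add z.2

/-! ### Carleman fluxes of a function and their divergence -/

/-- The squared angular gradient. -/
noncomputable def rotSq (S : Set (Space3 × ℝ)) (V : Space3 × ℝ → ℝ) (z : Space3 × ℝ) : ℝ :=
  ∑ k, lieD S (rotField k) V z ^ 2

/-- The wave operator acting on `r α`, in the coordinates `(x, s) = (x, t - |x|)` and multiplied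
by `r²`. -/
noncomputable def reducedWave (S : Set (Space3 × ℝ)) (V : Space3 × ℝ → ℝ) (z : Space3 × ℝ) : ℝ :=
  2 * ‖z.1‖ * lieD S eulerField (lieD S timeField V) z
    - lieD S eulerField (lieD S eulerField V) z + lieD S eulerField V z
    - ∑ k, lieD S (rotField k) (lieD S (rotField k) V) z

/-- The radial Carleman flux of `V`. -/
noncomputable def radialFluxOf (τ : ℝ) (S : Set (Space3 × ℝ)) (V : Space3 × ℝ → ℝ)
    (z : Space3 × ℝ) : ℝ :=
  radialFlux τ ‖z.1‖ z.2 (V z) (lieD S eulerField V z) (lieD S timeField V z) (rotSq S V z)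

/-- The Carleman flux of `V` through slices of constant `s`. -/
noncomputable def timeFluxOf (τ : ℝ) (S : Set (Space3 × ℝ)) (V : Space3 × ℝ → ℝ)
    (z : Space3 × ℝ) : ℝ :=
  timeFlux τ ‖z.1‖ z.2 (V z) (lieD S eulerField V z) (rotSq S V z)

/-- The angular Carleman flux of `V`. -/
noncomputable def angularFluxOf (τ : ℝ) (S : Set (Space3 × ℝ)) (V : Space3 × ℝ → ℝ) (k : Fin 3)
    (z : Space3 × ℝ) : ℝ :=
  angularFlux τ ‖z.1‖ z.2 (V z) (lieD S eulerField V z) (lieD S timeField V z)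
    (lieD S (rotField k) V z)

/-- The radial energy flux of `V`. -/
noncomputable def radialTraceFluxOf (τ : ℝ) (S : Set (Space3 × ℝ)) (V : Space3 × ℝ → ℝ)
    (z : Space3 × ℝ) : ℝ :=
  radialTraceFlux τ ‖z.1‖ z.2 (lieD S eulerField V z) (rotSq S V z)

/-- The energy flux of `V` through slices of constant `s`. -/
noncomputable def timeTraceFluxOf (τ : ℝ) (S : Set (Space3 × ℝ)) (V : Space3 × ℝ → ℝ)
    (z : Space3 × ℝ) : ℝ :=
  timeTraceFlux τ ‖z.1‖ z.2 (lieD S eulerField V z)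

/-- The angular energy flux of `V`. -/
noncomputable def angularTraceFluxOf (τ : ℝ) (S : Set (Space3 × ℝ)) (V : Space3 × ℝ → ℝ)
    (k : Fin 3) (z : Space3 × ℝ) : ℝ :=
  angularTraceFlux τ ‖z.1‖ z.2 (lieD S eulerField V z) (lieD S (rotField k) V z)

section Regularity

variable {a b τ : ℝ} {V : Space3 × ℝ → ℝ}

theorem contDiffOn_norm_slab {n : WithTop ℕ∞} :
    ContDiffOn ℝ n (fun z : Space3 × ℝ => ‖z.1‖) (slab a b) :=
  contDiff_fst.contDiffOn.norm ℝ fun _ hz => hz.1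

theorem contDiffOn_carlemanWeight :
    ContDiffOn ℝ 1 (fun z : Space3 × ℝ => carlemanWeight τ ‖z.1‖ z.2) (slab a b) := by
  have hr := contDiffOn_norm_slab (a := a) (b := b) (n := 1)
  unfold carlemanWeight
  fun_prop

theorem contDiffOn_rotSq (hab : a < b) (hV : ContDiffOn ℝ 2 V (slab a b)) :
    ContDiffOn ℝ 1 (rotSq (slab a b) V) (slab a b) :=
  ContDiffOn.sum fun k _ =>
    (ContDiffOn.lieD (uniqueDiffOn_slab hab) (contDiff_rotField k) hV).pow 2

theorem contDiffOn_fluxPotential (hab : a < b) (hV : ContDiffOn ℝ 2 V (slab a b)) :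
    ContDiffOn ℝ 1 (fun z => fluxPotential τ ‖z.1‖ z.2 (V z) (rotSq (slab a b) V z))
      (slab a b) := by
  have hr := contDiffOn_norm_slab (a := a) (b := b) (n := 1)
  have hK := contDiffOn_rotSq hab hV
  have hV1 : ContDiffOn ℝ 1 V (slab a b) := hV.of_le (by norm_num)
  have hq : ContDiffOn ℝ 1 (fun z : Space3 × ℝ => rotSq (slab a b) V z / (4 * ‖z.1‖ ^ 2))
      (slab a b) :=
    hK.div (by fun_prop) fun z hz => by simpa using hz.1
  unfold fluxPotential
  fun_prop

theorem contDiffOn_conjOut (hab : a < b) (hV : ContDiffOn ℝ 2 V (slab a b)) :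
    ContDiffOn ℝ 1 (fun z => conjOut τ ‖z.1‖ (V z) (lieD (slab a b) eulerField V z))
      (slab a b) := by
  have hr := contDiffOn_norm_slab (a := a) (b := b) (n := 1)
  have hV1 : ContDiffOn ℝ 1 V (slab a b) := hV.of_le (by norm_num)
  have hq : ContDiffOn ℝ 1 (fun z => lieD (slab a b) eulerField V z / (2 * ‖z.1‖))
      (slab a b) :=
    (ContDiffOn.lieD (uniqueDiffOn_slab hab) contDiff_eulerField hV).div (by fun_prop)
      fun z hz => by simpa using hz.1
  unfold conjOut
  fun_prop

theorem contDiffOn_conjIn (hab : a < b) (hV : ContDiffOn ℝ 2 V (slab a b)) :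
    ContDiffOn ℝ 1 (fun z => conjIn τ ‖z.1‖ z.2 (V z) (lieD (slab a b) eulerField V z)
      (lieD (slab a b) timeField V z)) (slab a b) := by
  have hr := contDiffOn_norm_slab (a := a) (b := b) (n := 1)
  have hV1 : ContDiffOn ℝ 1 V (slab a b) := hV.of_le (by norm_num)
  have hT := ContDiffOn.lieD (uniqueDiffOn_slab hab) contDiff_timeField hV
  have hq : ContDiffOn ℝ 1 (fun z => lieD (slab a b) eulerField V z / (2 * ‖z.1‖))
      (slab a b) :=
    (ContDiffOn.lieD (uniqueDiffOn_slab hab) contDiff_eulerField hV).div (by fun_prop)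
      fun z hz => by simpa using hz.1
  unfold conjIn
  fun_prop

theorem contDiffOn_conjMultiplier (hab : a < b) (hV : ContDiffOn ℝ 2 V (slab a b)) :
    ContDiffOn ℝ 1 (fun z => conjMultiplier τ ‖z.1‖ z.2 (V z) (lieD (slab a b) eulerField V z)
      (lieD (slab a b) timeField V z)) (slab a b) := by
  have hr := contDiffOn_norm_slab (a := a) (b := b) (n := 1)
  have hA := contDiffOn_conjOut (τ := τ) hab hV
  have hB := contDiffOn_conjIn (τ := τ) hab hV
  unfold conjMultiplier
  fun_prop

theorem contDiffOn_radialFluxOf (hab : a < b) (hV : ContDiffOn ℝ 2 V (slab a b)) :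
    ContDiffOn ℝ 1 (radialFluxOf τ (slab a b) V) (slab a b) := by
  have hr := contDiffOn_norm_slab (a := a) (b := b) (n := 1)
  have hW := contDiffOn_carlemanWeight (τ := τ) (a := a) (b := b)
  have hG := contDiffOn_fluxPotential (τ := τ) hab hV
  have hA := contDiffOn_conjOut (τ := τ) hab hV
  have hB := contDiffOn_conjIn (τ := τ) hab hV
  unfold radialFluxOf radialFlux
  fun_prop

theorem contDiffOn_timeFluxOf (hab : a < b) (hV : ContDiffOn ℝ 2 V (slab a b)) :
    ContDiffOn ℝ 1 (timeFluxOf τ (slab a b) V) (slab a b) := by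
  have hr := contDiffOn_norm_slab (a := a) (b := b) (n := 1)
  have hW := contDiffOn_carlemanWeight (τ := τ) (a := a) (b := b)
  have hG := contDiffOn_fluxPotential (τ := τ) hab hV
  have hA := contDiffOn_conjOut (τ := τ) hab hV
  unfold timeFluxOf timeFlux
  exact ContDiffOn.div (by fun_prop) (by fun_prop) fun z hz => by simpa using hz.1

theorem contDiffOn_angularFluxOf (hab : a < b) (hV : ContDiffOn ℝ 2 V (slab a b)) (k : Fin 3) :
    ContDiffOn ℝ 1 (angularFluxOf τ (slab a b) V k) (slab a b) := by
  have hr := contDiffOn_norm_slab (a := a) (b := b) (n := 1)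
  have hW := contDiffOn_carlemanWeight (τ := τ) (a := a) (b := b)
  have hM := contDiffOn_conjMultiplier (τ := τ) hab hV
  have hk := ContDiffOn.lieD (uniqueDiffOn_slab hab) (contDiff_rotField k) hV
  unfold angularFluxOf angularFlux
  exact ContDiffOn.div (by fun_prop) (by fun_prop) fun z hz => by simpa using hz.1

theorem contDiffOn_radialTraceFluxOf (hab : a < b) (hV : ContDiffOn ℝ 2 V (slab a b)) :
    ContDiffOn ℝ 1 (radialTraceFluxOf τ (slab a b) V) (slab a b) := by
  have hr := contDiffOn_norm_slab (a := a) (b := b) (n := 1)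
  have hW := contDiffOn_carlemanWeight (τ := τ) (a := a) (b := b)
  have hK := contDiffOn_rotSq hab hV
  have hE := ContDiffOn.lieD (uniqueDiffOn_slab hab) contDiff_eulerField hV
  unfold radialTraceFluxOf radialTraceFlux
  exact ContDiffOn.div (by fun_prop) (by fun_prop) fun z hz => by simpa using hz.1

theorem contDiffOn_timeTraceFluxOf (hab : a < b) (hV : ContDiffOn ℝ 2 V (slab a b)) :
    ContDiffOn ℝ 1 (timeTraceFluxOf τ (slab a b) V) (slab a b) := by
  have hr := contDiffOn_norm_slab (a := a) (b := b) (n := 1)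
  have hW := contDiffOn_carlemanWeight (τ := τ) (a := a) (b := b)
  have hE := ContDiffOn.lieD (uniqueDiffOn_slab hab) contDiff_eulerField hV
  unfold timeTraceFluxOf timeTraceFlux
  exact ContDiffOn.div (by fun_prop) (by fun_prop) fun z hz => by simpa using hz.1

theorem contDiffOn_angularTraceFluxOf (hab : a < b) (hV : ContDiffOn ℝ 2 V (slab a b))
    (k : Fin 3) : ContDiffOn ℝ 1 (angularTraceFluxOf τ (slab a b) V k) (slab a b) := by
  have hr := contDiffOn_norm_slab (a := a) (b := b) (n := 1)
  have hW := contDiffOn_carlemanWeight (τ := τ) (a := a) (b := b)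
  have hE := ContDiffOn.lieD (uniqueDiffOn_slab hab) contDiff_eulerField hV
  have hk := ContDiffOn.lieD (uniqueDiffOn_slab hab) (contDiff_rotField k) hV
  unfold angularTraceFluxOf angularTraceFlux
  exact ContDiffOn.div (by fun_prop) (by fun_prop) fun z hz => by simpa using hz.1

theorem continuousOn_reducedWave (hab : a < b) (hV : ContDiffOn ℝ 2 V (slab a b)) :
    ContinuousOn (reducedWave (slab a b) V) (slab a b) := by
  have hS := uniqueDiffOn_slab hab
  have hET := (ContDiffOn.lieD hS contDiff_timeField hV).continuousOn_lieD hS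
    (contDiff_eulerField (n := 0)).continuous
  have hE := ContDiffOn.lieD hS contDiff_eulerField hV
  have hEE := hE.continuousOn_lieD hS (contDiff_eulerField (n := 0)).continuous
  have hE' := hE.continuousOn
  have hkk : ContinuousOn (fun z => ∑ k, lieD (slab a b) (rotField k)
      (lieD (slab a b) (rotField k) V) z) (slab a b) :=
    continuousOn_finsetSum _ fun k _ =>
      (ContDiffOn.lieD hS (contDiff_rotField k) hV).continuousOn_lieD hS
        (contDiff_rotField (n := 0) k).continuous
  unfold reducedWave
  fun_prop

end Regularity

section Divergence

variable {a b τ : ℝ} {V : Space3 × ℝ → ℝ} {z : Space3 × ℝ}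

theorem hasDerivAt_rotSq (hab : a < b) (hV : ContDiffOn ℝ 2 V (slab a b))
    (hS : slab a b ∈ nhds z) (X : Space3 × ℝ → Space3 × ℝ) :
    HasDerivAt (fun h : ℝ => rotSq (slab a b) V (z + h • X z))
      (2 * ∑ k, lieD (slab a b) (rotField k) V z *
        lieD (slab a b) X (lieD (slab a b) (rotField k) V) z) 0 := by
  have h := HasDerivAt.fun_sum (u := Finset.univ) fun (k : Fin 3) _ => (hasDerivAt_lieD hS
    (ContDiffOn.lieD (uniqueDiffOn_slab hab) (contDiff_rotField k) hV) X).pow 2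
  refine h.congr_deriv ?_
  simp [Finset.mul_sum, mul_assoc]

/-- Pointwise Carleman inequality in divergence form. -/
theorem carleman_divergence (hab : a < b) (hV : ContDiffOn ℝ 2 V (slab a b)) (hτ : 0 < τ)
    (hx : z.1 ≠ 0) (hs : z.2 ∈ Set.Ioo a b) :
    carlemanWeight τ ‖z.1‖ z.2 / ‖z.1‖ ^ 2 *
      ((2 * ‖z.1‖ + z.2) / (2 * ‖z.1‖ ^ 3) * rotSq (slab a b) V z
        + (8 * τ ^ 2 * (2 * ‖z.1‖ + z.2) * (10 * ‖z.1‖ + z.2) - 8 * τ) * V z ^ 2) ≤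
      lieD (slab a b) eulerField (radialFluxOf τ (slab a b) V) z / ‖z.1‖ ^ 3
        + lieD (slab a b) timeField (timeFluxOf τ (slab a b) V) z
        + ∑ k, lieD (slab a b) (rotField k) (angularFluxOf τ (slab a b) V k) z
        + carlemanWeight τ ‖z.1‖ z.2 * reducedWave (slab a b) V z ^ 2
          / (32 * τ * ‖z.1‖ ^ 6) := by
  have hS := slab_mem_nhds hx hs
  have hU := uniqueDiffOn_slab hab
  have hV1 : ContDiffOn ℝ 1 V (slab a b) := hV.of_le (by norm_num)
  have hE := ContDiffOn.lieD hU contDiff_eulerField hV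
  have hT := ContDiffOn.lieD hU contDiff_timeField hV
  have hR := fun k => ContDiffOn.lieD hU (contDiff_rotField k) hV
  have hr0 : ‖z.1‖ ≠ 0 := norm_ne_zero_iff.2 hx
  have h1 := hasDerivAt_radialFlux (τ := τ) (r := fun h : ℝ => ‖(z + h • eulerField z).1‖)
    (e := fun h : ℝ => lieD (slab a b) eulerField V (z + h • eulerField z))
    (by simpa using hr0)
    (by simpa using hasDerivAt_norm_euler (z := z)) (hasDerivAt_snd_line (z := z) eulerField)
    (by simpa using hasDerivAt_lieD hS hV1 eulerField) (hasDerivAt_lieD hS hE eulerField)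
    (hasDerivAt_lieD hS hT eulerField) (hasDerivAt_rotSq hab hV hS eulerField)
  have h2 := hasDerivAt_timeFlux (τ := τ) (r := fun h : ℝ => ‖(z + h • timeField z).1‖)
    (by simpa using hr0)
    (hasDerivAt_norm_time (z := z)) (hasDerivAt_snd_line (z := z) timeField)
    (hasDerivAt_lieD hS hV1 timeField) (hasDerivAt_lieD hS hE timeField)
    (hasDerivAt_rotSq hab hV hS timeField)
  have h3 := fun k => hasDerivAt_angularFlux (τ := τ) (r := fun h : ℝ => ‖(z + h • rotField k z).1‖)
    (k := fun h : ℝ => lieD (slab a b) (rotField k) V (z + h • rotField k z))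
    (by simpa using hr0)
    (hasDerivAt_norm_rot k hx) (hasDerivAt_snd_line (z := z) (rotField k))
    (by simpa using hasDerivAt_lieD hS hV1 (rotField k)) (hasDerivAt_lieD hS hE (rotField k))
    (hasDerivAt_lieD hS hT (rotField k)) (hasDerivAt_lieD hS (hR k) (rotField k))
  simp only [zero_smul, add_zero] at h1 h2 h3
  rw [(hasDerivAt_lieD hS (contDiffOn_radialFluxOf (τ := τ) hab hV) eulerField).unique h1,
    (hasDerivAt_lieD hS (contDiffOn_timeFluxOf (τ := τ) hab hV) timeField).unique h2,
    Finset.sum_congr rfl fun k _ => (hasDerivAt_lieD hS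
      (contDiffOn_angularFluxOf (τ := τ) hab hV k) (rotField k)).unique (h3 k)]
  have hW : 0 ≤ carlemanWeight τ ‖z.1‖ z.2 := (Real.exp_pos _).le
  refine (carleman_pointwise
    (e := lieD (slab a b) eulerField V z) (t := lieD (slab a b) timeField V z)
    (ee := lieD (slab a b) eulerField (lieD (slab a b) eulerField V) z)
    (et := lieD (slab a b) eulerField (lieD (slab a b) timeField V) z)
    (KE := ∑ k, lieD (slab a b) (rotField k) V z *
        lieD (slab a b) eulerField (lieD (slab a b) (rotField k) V) z)
    (KT := ∑ k, lieD (slab a b) (rotField k) V z *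
        lieD (slab a b) timeField (lieD (slab a b) (rotField k) V) z)
    (KK := ∑ k, lieD (slab a b) (rotField k) (lieD (slab a b) (rotField k) V) z)
    (norm_pos_iff.2 hx) hτ hW).trans_eq ?_
  congr 2
  · simp only [lieD_euler_time hS hV]
  · simp only [lieD_rot_euler _ hS hV, lieD_rot_time _ hS hV, rotSq, Fin.sum_univ_three]
    ring

/-- Pointwise energy inequality in divergence form. -/
theorem trace_divergence (hab : a < b) (hV : ContDiffOn ℝ 2 V (slab a b)) (hτ : 0 < τ)
    (hx : z.1 ≠ 0) (hs : z.2 ∈ Set.Ioo a b) (hz : 0 < 2 * ‖z.1‖ + z.2) :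
    lieD (slab a b) eulerField (radialTraceFluxOf τ (slab a b) V) z / ‖z.1‖ ^ 3
        + lieD (slab a b) timeField (timeTraceFluxOf τ (slab a b) V) z
        + ∑ k, lieD (slab a b) (rotField k) (angularTraceFluxOf τ (slab a b) V k) z ≤
      carlemanWeight τ ‖z.1‖ z.2 * reducedWave (slab a b) V z ^ 2
          / (64 * τ * (2 * ‖z.1‖ + z.2) * ‖z.1‖ ^ 6)
        + 2 * τ * carlemanWeight τ ‖z.1‖ z.2 * rotSq (slab a b) V z / ‖z.1‖ ^ 3 := by
  have hS := slab_mem_nhds hx hs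
  have hU := uniqueDiffOn_slab hab
  have hE := ContDiffOn.lieD hU contDiff_eulerField hV
  have hR := fun k => ContDiffOn.lieD hU (contDiff_rotField k) hV
  have hr0 : ‖z.1‖ ≠ 0 := norm_ne_zero_iff.2 hx
  have h1 := hasDerivAt_radialTraceFlux (τ := τ) (r := fun h : ℝ => ‖(z + h • eulerField z).1‖)
    (by simpa using hr0)
    (by simpa using hasDerivAt_norm_euler (z := z)) (hasDerivAt_snd_line (z := z) eulerField)
    (hasDerivAt_lieD hS hE eulerField) (hasDerivAt_rotSq hab hV hS eulerField)
  have h2 := hasDerivAt_timeTraceFlux (τ := τ) (r := fun h : ℝ => ‖(z + h • timeField z).1‖)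
    (by simpa using hr0)
    (hasDerivAt_norm_time (z := z)) (hasDerivAt_snd_line (z := z) timeField)
    (hasDerivAt_lieD hS hE timeField)
  have h3 := fun k => hasDerivAt_angularTraceFlux (τ := τ) (r := fun h : ℝ => ‖(z + h • rotField k z).1‖)
    (by simpa using hr0)
    (hasDerivAt_norm_rot k hx) (hasDerivAt_snd_line (z := z) (rotField k))
    (hasDerivAt_lieD hS hE (rotField k)) (hasDerivAt_lieD hS (hR k) (rotField k))
  simp only [zero_smul, add_zero] at h1 h2 h3
  rw [(hasDerivAt_lieD hS (contDiffOn_radialTraceFluxOf (τ := τ) hab hV) eulerField).unique h1,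
    (hasDerivAt_lieD hS (contDiffOn_timeTraceFluxOf (τ := τ) hab hV) timeField).unique h2,
    Finset.sum_congr rfl fun k _ => (hasDerivAt_lieD hS
      (contDiffOn_angularTraceFluxOf (τ := τ) hab hV k) (rotField k)).unique (h3 k)]
  have hW : 0 ≤ carlemanWeight τ ‖z.1‖ z.2 := (Real.exp_pos _).le
  have hK : 0 ≤ rotSq (slab a b) V z := Finset.sum_nonneg fun k _ => sq_nonneg _
  refine le_trans (le_of_eq ?_) (trace_pointwise
    (e := lieD (slab a b) eulerField V z)
    (ee := lieD (slab a b) eulerField (lieD (slab a b) eulerField V) z)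
    (et := lieD (slab a b) eulerField (lieD (slab a b) timeField V) z)
    (KE := ∑ k, lieD (slab a b) (rotField k) V z *
        lieD (slab a b) eulerField (lieD (slab a b) (rotField k) V) z)
    (KK := ∑ k, lieD (slab a b) (rotField k) (lieD (slab a b) (rotField k) V) z)
    (norm_pos_iff.2 hx) hτ hW hz hK)
  congr 1
  · simp only [lieD_euler_time hS hV]
  · simp only [lieD_rot_euler _ hS hV, Fin.sum_univ_three]
    ring

end Divergence

/-! ### Integration over annular slabs -/

/-- The closed annulus `δ ≤ |x| ≤ 1`. -/
def annulus (δ : ℝ) : Set Space3 := {x | δ ≤ ‖x‖ ∧ ‖x‖ ≤ 1}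

/-- The function `G` vanishes to first order at `z`. -/
def FlatAt {E : Type*} [NormedAddCommGroup E] [NormedSpace ℝ E] (G : E → ℝ) (z : E) : Prop :=
  G z = 0 ∧ HasFDerivAt G (0 : E →L[ℝ] ℝ) z

namespace FlatAt

variable {E : Type*} [NormedAddCommGroup E] [NormedSpace ℝ E] {f g : E → ℝ} {z : E}

theorem mul_of_eq_zero (hf : DifferentiableAt ℝ f z) (hg : DifferentiableAt ℝ g z)
    (hf0 : f z = 0) (hg0 : g z = 0) : FlatAt (fun y => f y * g y) z := by
  refine ⟨by simp [hf0], ?_⟩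
  simpa [hf0, hg0] using hf.hasFDerivAt.fun_mul hg.hasFDerivAt

theorem sq_of_eq_zero (hf : DifferentiableAt ℝ f z) (hf0 : f z = 0) :
    FlatAt (fun y => f y ^ 2) z := by
  simpa only [sq] using mul_of_eq_zero hf hf hf0 hf0

theorem mul_left (hf : DifferentiableAt ℝ f z) (hg : FlatAt g z) :
    FlatAt (fun y => f y * g y) z := by
  refine ⟨by simp [hg.1], ?_⟩
  simpa [hg.1] using hf.hasFDerivAt.fun_mul hg.2

theorem mul_right (hf : DifferentiableAt ℝ f z) (hg : FlatAt g z) :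
    FlatAt (fun y => g y * f y) z := by
  simpa only [mul_comm] using hg.mul_left hf

theorem div_right (hf : DifferentiableAt ℝ f z) (hf0 : f z ≠ 0) (hg : FlatAt g z) :
    FlatAt (fun y => g y / f y) z := by
  simpa only [div_eq_mul_inv] using hg.mul_right (hf.fun_inv hf0)

theorem add (hf : FlatAt f z) (hg : FlatAt g z) : FlatAt (fun y => f y + g y) z :=
  ⟨by simp [hf.1, hg.1], by simpa using hf.2.fun_add hg.2⟩

theorem neg (hf : FlatAt f z) : FlatAt (fun y => -f y) z :=
  ⟨by simp [hf.1], by simpa using hf.2.fun_neg⟩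

theorem sub (hf : FlatAt f z) (hg : FlatAt g z) : FlatAt (fun y => f y - g y) z := by
  simpa only [sub_eq_add_neg] using hf.add hg.neg

theorem sum {ι : Type*} {s : Finset ι} {F : ι → E → ℝ} (hF : ∀ i ∈ s, FlatAt (F i) z) :
    FlatAt (fun y => ∑ i ∈ s, F i y) z :=
  ⟨Finset.sum_eq_zero fun i hi => (hF i hi).1, by
    simpa using HasFDerivAt.fun_sum fun i hi => (hF i hi).2⟩

/-- Extending by zero preserves first order vanishing. -/
theorem indicator (s : Set E) (hg : FlatAt g z) : FlatAt (s.indicator g) z := by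
  have h0 : s.indicator g z = 0 := by
    by_cases h : z ∈ s <;> simp [h, hg.1]
  refine ⟨h0, ?_⟩
  have h := hg.2
  rw [hasFDerivAt_iff_isLittleO] at h ⊢
  refine Asymptotics.IsBigO.trans_isLittleO (Asymptotics.IsBigO.of_bound 1 ?_) h
  refine Filter.Eventually.of_forall fun y => ?_
  by_cases hy : y ∈ s <;> simp [h0, hg.1, hy]

end FlatAt

theorem isClosed_annulus (δ : ℝ) : IsClosed (annulus δ) :=
  (isClosed_le continuous_const continuous_norm).inter (isClosed_le continuous_norm continuous_const)

theorem isCompact_annulus (δ : ℝ) : IsCompact (annulus δ) :=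
  (isCompact_closedBall (0 : Space3) 1).of_isClosed_subset (isClosed_annulus δ)
    fun x hx => by simpa using hx.2

theorem annulus_mem_nhds {δ : ℝ} {x : Space3} (h1 : δ < ‖x‖) (h2 : ‖x‖ < 1) :
    annulus δ ∈ nhds x :=
  Filter.inter_mem ((continuous_norm.continuousAt.eventually (lt_mem_nhds h1)).mono fun _ h => h.le)
    ((continuous_norm.continuousAt.eventually (gt_mem_nhds h2)).mono fun _ h => h.le)

theorem annulus_prod_subset_slab {δ a b : ℝ} (hδ : 0 < δ) :
    annulus δ ×ˢ Set.Icc a b ⊆ slab a b := fun _ hz =>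
  ⟨norm_pos_iff.1 (hδ.trans_le hz.1.1), hz.2⟩

theorem isCompact_annulus_prod (δ a b : ℝ) : IsCompact (annulus δ ×ˢ Set.Icc a b) :=
  (isCompact_annulus δ).prod isCompact_Icc

theorem integrableOn_annulus_prod {δ a b : ℝ} (hδ : 0 < δ) {F : Space3 × ℝ → ℝ}
    (hF : ContinuousOn F (slab a b)) : IntegrableOn F (annulus δ ×ˢ Set.Icc a b) :=
  (hF.mono (annulus_prod_subset_slab hδ)).integrableOn_compact (isCompact_annulus_prod δ a b)

/-- The divergence theorem on the annulus for the product of a linear vector field with a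
function which vanishes to first order on the boundary. -/
theorem integral_annulus_linear {δ : ℝ} (hδ : 0 < δ) {g : Space3 → ℝ}
    (hg : ContDiffOn ℝ 1 g {0}ᶜ) (h0 : ∀ x, ‖x‖ = δ → FlatAt g x) (h1 : ∀ x, ‖x‖ = 1 → FlatAt g x)
    (A : Space3 →L[ℝ] Space3) :
    ∫ x in annulus δ, (fderiv ℝ g x (A x)
      + (∑ i, A (EuclideanSpace.single i 1) i) * g x) = 0 := by
  set H := (annulus δ).indicator g with hH
  have hne : ∀ x ∈ annulus δ, x ∈ ({0}ᶜ : Set Space3) := fun x hx =>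
    norm_pos_iff.1 (hδ.trans_le hx.1)
  have hd : ∀ x, HasFDerivAt H ((annulus δ).indicator (fderiv ℝ g) x) x := by
    intro x
    by_cases hx : x ∈ annulus δ
    · rw [Set.indicator_of_mem hx]
      have hgd : HasFDerivAt g (fderiv ℝ g x) x :=
        ((hg.contDiffAt (isOpen_compl_singleton.mem_nhds (hne x hx))).differentiableAt
          (by norm_num)).hasFDerivAt
      have key : FlatAt g x → HasFDerivAt H (fderiv ℝ g x) x := fun hf => by
        rw [hf.2.fderiv]; exact (hf.indicator _).2
      rcases hx.1.eq_or_lt with h | h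
      · exact key (h0 x h.symm)
      rcases hx.2.eq_or_lt with h' | h'
      · exact key (h1 x h')
      · refine hgd.congr_of_eventuallyEq ?_
        filter_upwards [annulus_mem_nhds h h'] with y hy
        rw [hH, Set.indicator_of_mem hy]
    · rw [Set.indicator_of_notMem hx]
      refine (hasFDerivAt_const (0 : ℝ) x).congr_of_eventuallyEq ?_
      filter_upwards [(isClosed_annulus δ).isOpen_compl.mem_nhds hx] with y hy
      rw [hH, Set.indicator_of_notMem hy]
  have hfc : ContinuousOn (fderiv ℝ g) (annulus δ) :=
    (hg.continuousOn_fderiv_of_isOpen isOpen_compl_singleton (by norm_num)).mono hne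
  have hgc : ContinuousOn g (annulus δ) := hg.continuousOn.mono hne
  have hm := (isClosed_annulus δ).measurableSet
  have hintegr : ∀ F : Space3 → ℝ, ContinuousOn F (annulus δ) →
      Integrable ((annulus δ).indicator F) := fun F hF =>
    (integrable_indicator_iff hm).2 (hF.integrableOn_compact (isCompact_annulus δ))
  have hi : ∀ i : Fin 3, ∫ x in annulus δ, fderiv ℝ g x (EuclideanSpace.single i 1) * A x i
      = -∫ x in annulus δ, A (EuclideanSpace.single i 1) i * g x := by
    intro i
    have hl : ∀ x, HasLineDerivAt ℝ (fun x => A x i) (A (EuclideanSpace.single i 1) i) x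
        (EuclideanSpace.single i 1) := fun x => by
      have := ((EuclideanSpace.proj i : Space3 →L[ℝ] ℝ).comp A).hasFDerivAt (x := x)
      exact this.hasLineDerivAt _
    have e1 : (fun x => A x i *
        ((annulus δ).indicator (fderiv ℝ g) x) (EuclideanSpace.single i 1))
        = (annulus δ).indicator fun x => fderiv ℝ g x (EuclideanSpace.single i 1) * A x i := by
      ext x
      by_cases hx : x ∈ annulus δ <;> simp [hx, mul_comm]
    have e2 : (fun x => A (EuclideanSpace.single i 1) i * H x)
        = (annulus δ).indicator fun x => A (EuclideanSpace.single i 1) i * g x := by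
      ext x
      by_cases hx : x ∈ annulus δ <;> simp [hx, hH]
    have e3 : (fun x => A x i * H x) = (annulus δ).indicator fun x => A x i * g x := by
      ext x
      by_cases hx : x ∈ annulus δ <;> simp [hx, hH]
    have := integral_bilinear_hasLineDerivAt_right_eq_neg_left_of_integrable (μ := volume)
      (f := fun x => A x i) (g := H) (f' := fun _ => A (EuclideanSpace.single i 1) i)
      (g' := fun x => ((annulus δ).indicator (fderiv ℝ g) x) (EuclideanSpace.single i 1))
      (v := EuclideanSpace.single i 1) (B := ContinuousLinearMap.mul ℝ ℝ)
      (by simp only [ContinuousLinearMap.mul_apply', e2]; exact hintegr _ (by fun_prop))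
      (by
        simp only [ContinuousLinearMap.mul_apply', e1]
        exact hintegr _ ((hfc.clm_apply continuousOn_const).mul (by fun_prop)))
      (by simp only [ContinuousLinearMap.mul_apply', e3]; exact hintegr _ (by fun_prop))
      (fun x _ => hl x) (fun x _ => (hd x).hasLineDerivAt _)
    simp only [ContinuousLinearMap.mul_apply', e1, e2] at this
    rwa [integral_indicator hm, integral_indicator hm] at this
  have hA : ∀ x, fderiv ℝ g x (A x)
      = ∑ i, fderiv ℝ g x (EuclideanSpace.single i 1) * A x i := by
    intro x
    conv_lhs => rw [show A x = ∑ i, A x i • EuclideanSpace.single i (1 : ℝ) by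
      ext j; fin_cases j <;> simp [Fin.sum_univ_three]]
    simp [map_sum, mul_comm]
  have I1 : ∀ i : Fin 3, IntegrableOn
      (fun x => fderiv ℝ g x (EuclideanSpace.single i 1) * A x i) (annulus δ) := fun i =>
    ((hfc.clm_apply continuousOn_const).mul (by fun_prop)).integrableOn_compact
      (isCompact_annulus δ)
  have I2 : ∀ i : Fin 3, IntegrableOn (fun x => A (EuclideanSpace.single i 1) i * g x)
      (annulus δ) := fun i =>
    (continuousOn_const.mul hgc).integrableOn_compact (isCompact_annulus δ)
  simp only [hA, Finset.sum_mul, ← Finset.sum_add_distrib]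
  rw [integral_finsetSum _ fun i _ => (I1 i).fun_add (I2 i)]
  refine Finset.sum_eq_zero fun i _ => ?_
  rw [integral_add (I1 i) (I2 i), hi i]
  ring

section Slab

variable {δ a b : ℝ} {G : Space3 × ℝ → ℝ}

theorem setIntegral_prod_right {A : Set Space3} {J : Set ℝ} {F : Space3 × ℝ → ℝ}
    (hF : IntegrableOn F (A ×ˢ J)) :
    ∫ z in A ×ˢ J, F z = ∫ s in J, ∫ x in A, F (x, s) := by
  rw [Measure.volume_eq_prod] at hF ⊢
  rw [setIntegral_prod _ hF]
  refine integral_integral_swap ?_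
  rw [Measure.prod_restrict]
  exact hF

theorem integral_slab_time (hδ : 0 < δ) (hab : a < b) (hG : ContDiffOn ℝ 1 G (slab a b)) :
    ∫ z in annulus δ ×ˢ Set.Icc a b, lieD (slab a b) timeField G z
      = ∫ x in annulus δ, (G (x, b) - G (x, a)) := by
  have hc := hG.continuousOn_lieD (uniqueDiffOn_slab hab) (contDiff_timeField (n := 0)).continuous
  have hi := integrableOn_annulus_prod hδ hc
  rw [Measure.volume_eq_prod] at hi ⊢
  rw [setIntegral_prod _ hi]
  refine setIntegral_congr_fun (isClosed_annulus δ).measurableSet fun x hx => ?_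
  have hx0 : x ≠ 0 := norm_pos_iff.1 (hδ.trans_le hx.1)
  have hmaps : Set.MapsTo (fun s : ℝ => (x, s)) (Set.Icc a b) (slab a b) := fun s hs => ⟨hx0, hs⟩
  rw [integral_Icc_eq_integral_Ioc, ← intervalIntegral.integral_of_le hab.le]
  refine intervalIntegral.integral_eq_sub_of_hasDerivAt_of_le hab.le
    (hG.continuousOn.comp (by fun_prop) hmaps) (fun s hs => ?_) ?_
  · have hd := hasDerivAt_lieD (z := (x, s)) (slab_mem_nhds hx0 hs) hG timeField
    rw [← sub_self s] at hd
    refine (hd.comp_sub_const s s).congr_of_eventuallyEq (Filter.Eventually.of_forall fun y => ?_)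
    simp [timeField]
  · exact ContinuousOn.intervalIntegrable_of_Icc hab.le (hc.comp (by fun_prop) hmaps)

theorem contDiffOn_slice (hG : ContDiffOn ℝ 1 G (slab a b)) {s : ℝ} (hs : s ∈ Set.Icc a b) :
    ContDiffOn ℝ 1 (fun x => G (x, s)) {0}ᶜ :=
  hG.comp (by fun_prop) fun _ hx => ⟨hx, hs⟩

theorem fderiv_slice {z : Space3 × ℝ} (hG : DifferentiableAt ℝ G z) (y : Space3) :
    fderiv ℝ (fun x => G (x, z.2)) z.1 y = fderiv ℝ G z (y, 0) := by
  have h : HasFDerivAt G (fderiv ℝ G z) ((fun x : Space3 => (x, z.2)) z.1) := hG.hasFDerivAt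
  have hc := HasFDerivAt.comp (f := fun x : Space3 => (x, z.2)) z.1 h
    (hasFDerivAt_prodMk_left z.1 z.2)
  exact DFunLike.congr_fun hc.fderiv y

theorem FlatAt.slice {z : Space3 × ℝ} (hG : FlatAt G z) : FlatAt (fun x => G (x, z.2)) z.1 := by
  refine ⟨hG.1, ?_⟩
  have h : HasFDerivAt G 0 ((fun x : Space3 => (x, z.2)) z.1) := hG.2
  have hc := HasFDerivAt.comp (f := fun x : Space3 => (x, z.2)) z.1 h
    (hasFDerivAt_prodMk_left z.1 z.2)
  rw [ContinuousLinearMap.zero_comp] at hc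
  exact hc

theorem integral_slab_linear (hδ : 0 < δ) (hab : a < b) (hG : ContDiffOn ℝ 1 G (slab a b))
    (h0 : ∀ z : Space3 × ℝ, ‖z.1‖ = δ → z.2 ∈ Set.Ioo a b → FlatAt G z)
    (h1 : ∀ z : Space3 × ℝ, ‖z.1‖ = 1 → z.2 ∈ Set.Ioo a b → FlatAt G z)
    (A : Space3 →L[ℝ] Space3) :
    ∫ z in annulus δ ×ˢ Set.Icc a b, (lieD (slab a b) (fun z => (A z.1, 0)) G z
      + (∑ i, A (EuclideanSpace.single i 1) i) * G z) = 0 := by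
  have hc : ContinuousOn (lieD (slab a b) (fun z => (A z.1, 0)) G) (slab a b) :=
    hG.continuousOn_lieD (uniqueDiffOn_slab hab) (by fun_prop)
  have hGc := hG.continuousOn
  rw [setIntegral_prod_right (integrableOn_annulus_prod hδ (by fun_prop)),
    integral_Icc_eq_integral_Ioo]
  rw [setIntegral_congr_fun (g := fun _ => (0 : ℝ)) measurableSet_Ioo, integral_zero]
  intro s hs
  have hslice := integral_annulus_linear hδ (contDiffOn_slice hG (Set.Ioo_subset_Icc_self hs))
    (fun x hx => (h0 (x, s) hx hs).slice) (fun x hx => (h1 (x, s) hx hs).slice) A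
  refine Eq.trans (setIntegral_congr_fun (isClosed_annulus δ).measurableSet fun x hx => ?_) hslice
  have hx0 : x ≠ 0 := norm_pos_iff.1 (hδ.trans_le hx.1)
  have hS := slab_mem_nhds (z := (x, s)) hx0 hs
  have := fderiv_slice ((hG.contDiffAt hS).differentiableAt (by norm_num)) (A x)
  simp only at this ⊢
  rw [this, lieD_of_mem_nhds hS]

theorem integral_slab_rot (hδ : 0 < δ) (hab : a < b) (hG : ContDiffOn ℝ 1 G (slab a b))
    (h0 : ∀ z : Space3 × ℝ, ‖z.1‖ = δ → z.2 ∈ Set.Ioo a b → FlatAt G z)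
    (h1 : ∀ z : Space3 × ℝ, ‖z.1‖ = 1 → z.2 ∈ Set.Ioo a b → FlatAt G z) (k : Fin 3) :
    ∫ z in annulus δ ×ˢ Set.Icc a b, lieD (slab a b) (rotField k) G z = 0 := by
  have h := integral_slab_linear hδ hab hG h0 h1 (rotGen k)
  have ht : ∑ i, rotGen k (EuclideanSpace.single i 1) i = 0 := by
    fin_cases k <;> simp [rotGen, Fin.sum_univ_three]
  simp only [ht, zero_mul, add_zero] at h
  exact h

theorem integral_slab_euler (hδ : 0 < δ) (hab : a < b) (hG : ContDiffOn ℝ 1 G (slab a b))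
    (h0 : ∀ z : Space3 × ℝ, ‖z.1‖ = δ → z.2 ∈ Set.Ioo a b → FlatAt G z)
    (h1 : ∀ z : Space3 × ℝ, ‖z.1‖ = 1 → z.2 ∈ Set.Ioo a b → FlatAt G z) :
    ∫ z in annulus δ ×ˢ Set.Icc a b, lieD (slab a b) eulerField G z / ‖z.1‖ ^ 3 = 0 := by
  have hr := contDiffOn_norm_slab (a := a) (b := b) (n := 1)
  have hG' : ContDiffOn ℝ 1 (fun z => G z / ‖z.1‖ ^ 3) (slab a b) :=
    hG.div (hr.pow 3) fun z hz => by simpa using hz.1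
  have hdiff : ∀ z : Space3 × ℝ, z.1 ≠ 0 → DifferentiableAt ℝ (fun z : Space3 × ℝ => ‖z.1‖ ^ 3) z :=
    fun z hz => ((differentiableAt_fst).norm ℝ hz).pow 3
  have hne : ∀ {z : Space3 × ℝ} {c : ℝ}, 0 < c → ‖z.1‖ = c → z.1 ≠ 0 := fun hc h =>
    norm_pos_iff.1 (h ▸ hc)
  have h := integral_slab_linear hδ hab hG'
    (fun z hz hs => (h0 z hz hs).div_right (hdiff z (hne hδ hz)) (by simpa using hne hδ hz))
    (fun z hz hs => (h1 z hz hs).div_right (hdiff z (hne one_pos hz))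
      (by simpa using hne one_pos hz)) (ContinuousLinearMap.id ℝ Space3)
  have ht : ∑ i : Fin 3, (ContinuousLinearMap.id ℝ Space3) (EuclideanSpace.single i 1) i = 3 := by
    simp
  rw [ht] at h
  rw [← h]
  have hm : MeasurableSet (annulus δ ×ˢ Set.Icc a b) :=
    (isClosed_annulus δ).measurableSet.prod measurableSet_Icc
  refine setIntegral_congr_ae hm ?_
  have hae : ∀ᵐ z : Space3 × ℝ, z.2 ≠ a ∧ z.2 ≠ b := by
    have hq := Measure.quasiMeasurePreserving_snd (μ := (volume : Measure Space3))
      (ν := (volume : Measure ℝ))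
    exact (hq.ae (Measure.ae_ne volume a)).and (hq.ae (Measure.ae_ne volume b))
  filter_upwards [hae] with z hz hzD
  have hS := slab_mem_nhds (z := z) (annulus_prod_subset_slab hδ hzD).1
    ⟨lt_of_le_of_ne hzD.2.1 hz.1.symm, lt_of_le_of_ne hzD.2.2 hz.2⟩
  have hz0 : ‖z.1‖ ≠ 0 := norm_ne_zero_iff.2 (annulus_prod_subset_slab hδ hzD).1
  have e1 := hasDerivAt_lieD hS hG' eulerField
  have e2 := (hasDerivAt_lieD hS hG eulerField).fun_div ((hasDerivAt_norm_euler (z := z)).fun_pow 3)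
    (by simpa using hz0)
  have := e1.unique e2
  simp only [zero_smul, add_zero] at this
  have e3 : lieD (slab a b) (fun z => (ContinuousLinearMap.id ℝ Space3 z.1, 0))
      (fun z => G z / ‖z.1‖ ^ 3) z = lieD (slab a b) eulerField (fun z => G z / ‖z.1‖ ^ 3) z := rfl
  rw [e3, this]
  field_simp
  push_cast
  ring

/-- The divergence theorem on annular slabs. -/
theorem integral_slab_divergence (hδ : 0 < δ) (hab : a < b) {P T : Space3 × ℝ → ℝ}
    {R : Fin 3 → Space3 × ℝ → ℝ} (hP : ContDiffOn ℝ 1 P (slab a b))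
    (hT : ContDiffOn ℝ 1 T (slab a b)) (hR : ∀ k, ContDiffOn ℝ 1 (R k) (slab a b))
    (hP0 : ∀ z : Space3 × ℝ, (‖z.1‖ = δ ∨ ‖z.1‖ = 1) → z.2 ∈ Set.Ioo a b → FlatAt P z)
    (hR0 : ∀ k, ∀ z : Space3 × ℝ, (‖z.1‖ = δ ∨ ‖z.1‖ = 1) → z.2 ∈ Set.Ioo a b → FlatAt (R k) z) :
    IntegrableOn (fun z => lieD (slab a b) eulerField P z / ‖z.1‖ ^ 3
      + lieD (slab a b) timeField T z + ∑ k, lieD (slab a b) (rotField k) (R k) z)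
      (annulus δ ×ˢ Set.Icc a b) ∧
    ∫ z in annulus δ ×ˢ Set.Icc a b, (lieD (slab a b) eulerField P z / ‖z.1‖ ^ 3
      + lieD (slab a b) timeField T z + ∑ k, lieD (slab a b) (rotField k) (R k) z)
      = ∫ x in annulus δ, (T (x, b) - T (x, a)) := by
  have hU := uniqueDiffOn_slab hab
  have hr := (contDiffOn_norm_slab (a := a) (b := b) (n := 0)).continuousOn
  have c1 : ContinuousOn (fun z => lieD (slab a b) eulerField P z / ‖z.1‖ ^ 3) (slab a b) :=
    (hP.continuousOn_lieD hU (contDiff_eulerField (n := 0)).continuous).div (hr.pow 3)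
      fun z hz => by simpa using hz.1
  have c2 := hT.continuousOn_lieD hU (contDiff_timeField (n := 0)).continuous
  have c3 := fun k => (hR k).continuousOn_lieD hU (contDiff_rotField (n := 0) k).continuous
  have i1 := integrableOn_annulus_prod hδ c1
  have i2 := integrableOn_annulus_prod hδ c2
  have i3 := fun k => integrableOn_annulus_prod hδ (c3 k)
  have i3' : IntegrableOn (fun z => ∑ k, lieD (slab a b) (rotField k) (R k) z)
      (annulus δ ×ˢ Set.Icc a b) := integrable_finsetSum _ fun k _ => i3 k
  refine ⟨(i1.fun_add i2).fun_add i3', ?_⟩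
  rw [integral_add (i1.fun_add i2) i3', integral_add i1 i2, integral_finsetSum _ fun k _ => i3 k,
    integral_slab_euler hδ hab hP (fun z h => hP0 z (.inl h)) (fun z h => hP0 z (.inr h)),
    integral_slab_time hδ hab hT,
    Finset.sum_eq_zero fun k _ => integral_slab_rot hδ hab (hR k) (fun z h => hR0 k z (.inl h))
      (fun z h => hR0 k z (.inr h)) k]
  ring

end Slab

/-! ### Integrated Carleman and energy inequalities -/

section Flat

variable {a b τ : ℝ} {V : Space3 × ℝ → ℝ} {z : Space3 × ℝ}

theorem FlatAt.lieD_eq_zero {S : Set (Space3 × ℝ)} (hS : S ∈ nhds z) (hf : FlatAt V z)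
    (X : Space3 × ℝ → Space3 × ℝ) : lieD S X V z = 0 := by
  rw [lieD_of_mem_nhds hS, hf.2.fderiv]; rfl

theorem flatAt_of_eventuallyEq_zero {E : Type*} [NormedAddCommGroup E] [NormedSpace ℝ E]
    {G : E → ℝ} {z : E} (h : G =ᶠ[nhds z] 0) : FlatAt G z :=
  ⟨h.eq_of_nhds, (hasFDerivAt_const (0 : ℝ) z).congr_of_eventuallyEq h⟩

theorem lieD_eq_zero_of_eventuallyEq (S : Set (Space3 × ℝ)) (h : V =ᶠ[nhds z] 0)
    (X : Space3 × ℝ → Space3 × ℝ) : lieD S X V z = 0 := by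
  rw [lieD, (h.filter_mono nhdsWithin_le_nhds).fderivWithin_eq h.eq_of_nhds]
  simp

theorem flatAt_rotSq (hab : a < b) (hV : ContDiffOn ℝ 2 V (slab a b)) (hx : z.1 ≠ 0)
    (hs : z.2 ∈ Set.Ioo a b) (hf : FlatAt V z) :
    FlatAt (rotSq (slab a b) V) z := by
  have hS := slab_mem_nhds hx hs
  refine FlatAt.sum fun k _ => FlatAt.sq_of_eq_zero ?_ (hf.lieD_eq_zero hS _)
  exact ((ContDiffOn.lieD (uniqueDiffOn_slab hab) (contDiff_rotField k) hV).contDiffAt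
    hS).differentiableAt (by norm_num)

theorem flatAt_radialFluxOf (hab : a < b) (hV : ContDiffOn ℝ 2 V (slab a b)) (hx : z.1 ≠ 0)
    (hs : z.2 ∈ Set.Ioo a b) (hf : FlatAt V z) :
    FlatAt (radialFluxOf τ (slab a b) V) z := by
  have hS := slab_mem_nhds hx hs
  have d : ∀ {F : Space3 × ℝ → ℝ}, ContDiffOn ℝ 1 F (slab a b) → DifferentiableAt ℝ F z :=
    fun hF => (hF.contDiffAt hS).differentiableAt (by norm_num)
  have hr := d contDiffOn_norm_slab
  have hV1 := d (hV.of_le (by norm_num))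
  have hE0 := hf.lieD_eq_zero hS eulerField
  have hT0 := hf.lieD_eq_zero hS timeField
  have hV0 := hf.1
  refine FlatAt.mul_left (d contDiffOn_carlemanWeight) (FlatAt.sub (FlatAt.add ?_ ?_) ?_)
  · exact FlatAt.mul_left (by fun_prop) (FlatAt.sq_of_eq_zero (d (contDiffOn_conjIn hab hV))
      (by simp [conjIn, hE0, hT0, hV0]))
  · exact FlatAt.mul_left (by fun_prop) (FlatAt.sq_of_eq_zero (d (contDiffOn_conjOut hab hV))
      (by simp [conjOut, hE0, hV0]))
  · refine FlatAt.mul_left (by fun_prop) (FlatAt.add (FlatAt.sub ?_ ?_) ?_)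
    · exact FlatAt.div_right (by fun_prop) (by simpa using hx) (flatAt_rotSq hab hV hx hs hf)
    · exact FlatAt.mul_left (by fun_prop) (FlatAt.sq_of_eq_zero hV1 hV0)
    · exact FlatAt.mul_left (by fun_prop) (FlatAt.sq_of_eq_zero hV1 hV0)

theorem flatAt_angularFluxOf (hab : a < b) (hV : ContDiffOn ℝ 2 V (slab a b)) (hx : z.1 ≠ 0)
    (hs : z.2 ∈ Set.Ioo a b) (hf : FlatAt V z) (k : Fin 3) :
    FlatAt (angularFluxOf τ (slab a b) V k) z := by
  have hS := slab_mem_nhds hx hs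
  have d : ∀ {F : Space3 × ℝ → ℝ}, ContDiffOn ℝ 1 F (slab a b) → DifferentiableAt ℝ F z :=
    fun hF => (hF.contDiffAt hS).differentiableAt (by norm_num)
  have hr := d contDiffOn_norm_slab
  have hE0 := hf.lieD_eq_zero hS eulerField
  have hT0 := hf.lieD_eq_zero hS timeField
  refine FlatAt.div_right (by fun_prop) (by simpa using hx) (FlatAt.neg (FlatAt.mul_left
    (d contDiffOn_carlemanWeight) (FlatAt.mul_of_eq_zero
      (d (ContDiffOn.lieD (uniqueDiffOn_slab hab) (contDiff_rotField k) hV))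
      (d (contDiffOn_conjMultiplier hab hV)) (hf.lieD_eq_zero hS _) ?_)))
  simp [conjMultiplier, conjIn, conjOut, hE0, hT0, hf.1]

theorem flatAt_radialTraceFluxOf (hab : a < b) (hV : ContDiffOn ℝ 2 V (slab a b)) (hx : z.1 ≠ 0)
    (hs : z.2 ∈ Set.Ioo a b) (hf : FlatAt V z) :
    FlatAt (radialTraceFluxOf τ (slab a b) V) z := by
  have hS := slab_mem_nhds hx hs
  have d : ∀ {F : Space3 × ℝ → ℝ}, ContDiffOn ℝ 1 F (slab a b) → DifferentiableAt ℝ F z :=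
    fun hF => (hF.contDiffAt hS).differentiableAt (by norm_num)
  have hr := d contDiffOn_norm_slab
  exact FlatAt.div_right (by fun_prop) (by simpa using hx) (FlatAt.mul_left
    (d contDiffOn_carlemanWeight) (FlatAt.sub (flatAt_rotSq hab hV hx hs hf)
      (FlatAt.sq_of_eq_zero (d (ContDiffOn.lieD (uniqueDiffOn_slab hab) contDiff_eulerField hV))
        (hf.lieD_eq_zero hS _))))

theorem flatAt_angularTraceFluxOf (hab : a < b) (hV : ContDiffOn ℝ 2 V (slab a b)) (hx : z.1 ≠ 0)
    (hs : z.2 ∈ Set.Ioo a b) (hf : FlatAt V z) (k : Fin 3) :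
    FlatAt (angularTraceFluxOf τ (slab a b) V k) z := by
  have hS := slab_mem_nhds hx hs
  have d : ∀ {F : Space3 × ℝ → ℝ}, ContDiffOn ℝ 1 F (slab a b) → DifferentiableAt ℝ F z :=
    fun hF => (hF.contDiffAt hS).differentiableAt (by norm_num)
  have hr := d contDiffOn_norm_slab
  exact FlatAt.div_right (by fun_prop) (by simpa using hx) (FlatAt.neg (FlatAt.mul_left
    (d contDiffOn_carlemanWeight) (FlatAt.mul_of_eq_zero
      (d (ContDiffOn.lieD (uniqueDiffOn_slab hab) (contDiff_rotField k) hV))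
      (d (ContDiffOn.lieD (uniqueDiffOn_slab hab) contDiff_eulerField hV))
      (hf.lieD_eq_zero hS _) (hf.lieD_eq_zero hS _))))

end Flat

section Integrated

variable {δ a b c τ : ℝ} {V : Space3 × ℝ → ℝ}

theorem carlemanWeight_pos (τ r s : ℝ) : 0 < carlemanWeight τ r s := Real.exp_pos _

theorem continuous_carlemanWeight (τ : ℝ) :
    Continuous fun z : Space3 × ℝ => carlemanWeight τ ‖z.1‖ z.2 := by
  unfold carlemanWeight; fun_prop

theorem rotSq_nonneg (S : Set (Space3 × ℝ)) (V : Space3 × ℝ → ℝ) (z : Space3 × ℝ) :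
    0 ≤ rotSq S V z := Finset.sum_nonneg fun _ _ => sq_nonneg _

theorem ae_snd_mem_Ioo (A : Set Space3) (hA : MeasurableSet A) (a b : ℝ) :
    ∀ᵐ z : Space3 × ℝ ∂volume.restrict (A ×ˢ Set.Icc a b), z.1 ∈ A ∧ z.2 ∈ Set.Ioo a b := by
  rw [ae_restrict_iff' (hA.prod measurableSet_Icc)]
  have hq := Measure.quasiMeasurePreserving_snd (μ := (volume : Measure Space3))
      (ν := (volume : Measure ℝ))
  have ha : ∀ᵐ z : Space3 × ℝ, z.2 ≠ a := hq.ae (Measure.ae_ne volume a)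
  have hb : ∀ᵐ z : Space3 × ℝ, z.2 ≠ b := hq.ae (Measure.ae_ne volume b)
  filter_upwards [ha, hb] with z h1 h2 hz
  exact ⟨hz.1, lt_of_le_of_ne hz.2.1 h1.symm, lt_of_le_of_ne hz.2.2 h2⟩

theorem eventuallyEq_zero_of_lt (hsupp : ∀ z : Space3 × ℝ, 4 * ‖z.1‖ ^ 2 - z.2 ^ 2 < c → V z = 0)
    {z : Space3 × ℝ} (hz : 4 * ‖z.1‖ ^ 2 - z.2 ^ 2 < c) : V =ᶠ[nhds z] 0 := by
  have hc : Continuous fun z : Space3 × ℝ => 4 * ‖z.1‖ ^ 2 - z.2 ^ 2 := by fun_prop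
  filter_upwards [hc.continuousAt.eventually (gt_mem_nhds hz)] with y hy using hsupp y hy

theorem rotSq_eq_zero_of_eventuallyEq (S : Set (Space3 × ℝ)) {z : Space3 × ℝ}
    (h : V =ᶠ[nhds z] 0) : rotSq S V z = 0 := by
  simp [rotSq, lieD_eq_zero_of_eventuallyEq S h]

theorem timeFluxOf_eq_zero_of_eventuallyEq (S : Set (Space3 × ℝ)) {z : Space3 × ℝ}
    (h : V =ᶠ[nhds z] 0) : timeFluxOf τ S V z = 0 := by
  simp [timeFluxOf, timeFlux, fluxPotential, conjOut, rotSq_eq_zero_of_eventuallyEq S h,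
    lieD_eq_zero_of_eventuallyEq S h, h.eq_of_nhds]

theorem timeTraceFluxOf_eq_zero_of_eventuallyEq (S : Set (Space3 × ℝ)) {z : Space3 × ℝ}
    (h : V =ᶠ[nhds z] 0) : timeTraceFluxOf τ S V z = 0 := by
  simp [timeTraceFluxOf, timeTraceFlux, lieD_eq_zero_of_eventuallyEq S h]

theorem radialTraceFluxOf_eq_zero_of_eventuallyEq (S : Set (Space3 × ℝ)) {z : Space3 × ℝ}
    (h : V =ᶠ[nhds z] 0) : radialTraceFluxOf τ S V z = 0 := by
  simp [radialTraceFluxOf, radialTraceFlux, rotSq_eq_zero_of_eventuallyEq S h,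
    lieD_eq_zero_of_eventuallyEq S h]

theorem angularTraceFluxOf_eq_zero_of_eventuallyEq (S : Set (Space3 × ℝ)) {z : Space3 × ℝ}
    (k : Fin 3) (h : V =ᶠ[nhds z] 0) : angularTraceFluxOf τ S V k z = 0 := by
  simp [angularTraceFluxOf, angularTraceFlux, lieD_eq_zero_of_eventuallyEq S h]

theorem flatAt_of_norm_eq (hδ : 4 * δ ^ 2 < c)
    (hsupp : ∀ z : Space3 × ℝ, 4 * ‖z.1‖ ^ 2 - z.2 ^ 2 < c → V z = 0)
    (hbd : ∀ z : Space3 × ℝ, ‖z.1‖ = 1 → z.2 ∈ Set.Ioo a b → FlatAt V z) {z : Space3 × ℝ}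
    (hz : ‖z.1‖ = δ ∨ ‖z.1‖ = 1) (hs : z.2 ∈ Set.Ioo a b) : FlatAt V z := by
  rcases hz with hz | hz
  · refine flatAt_of_eventuallyEq_zero (eventuallyEq_zero_of_lt hsupp ?_)
    rw [hz]; nlinarith [sq_nonneg z.2]
  · exact hbd z hz hs

theorem two_mul_norm_add_ge {r s : ℝ} (hr1 : r ≤ 1) (hr : 0 < r) (hs : s ∈ Set.Ioo (-2 : ℝ) 2)
    (hc : 0 < c) (h : c ≤ 4 * r ^ 2 - s ^ 2) : c / 4 ≤ 2 * r + s := by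
  have h1 : c ≤ (2 * r + s) * (2 * r - s) := by nlinarith
  have h2 : 2 * r - s ≤ 4 := by linarith [hs.1]
  by_contra hlt
  push Not at hlt
  rcases le_or_gt (2 * r - s) 0 with h3 | h3
  · have : 0 < 2 * r + s := by linarith
    nlinarith
  · nlinarith

/-- The Carleman inequality on a slab, with boundary terms on its two faces. -/
theorem carleman_slab (hδ : 0 < δ) (hδc : 4 * δ ^ 2 < c) (hab : a < b) (ha : -2 ≤ a) (hb : b ≤ 2)
    (hV : ContDiffOn ℝ 2 V (slab a b))
    (hsupp : ∀ z : Space3 × ℝ, 4 * ‖z.1‖ ^ 2 - z.2 ^ 2 < c → V z = 0)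
    (hbd : ∀ z : Space3 × ℝ, ‖z.1‖ = 1 → z.2 ∈ Set.Ioo a b → FlatAt V z)
    (hτ : 0 < τ) (hτc : 32 ≤ τ * c ^ 2) :
    c / 8 * (∫ z in annulus δ ×ˢ Set.Icc a b, carlemanWeight τ ‖z.1‖ z.2 * rotSq (slab a b) V z)
      + c ^ 2 * τ ^ 2 / 4 *
        (∫ z in annulus δ ×ˢ Set.Icc a b, carlemanWeight τ ‖z.1‖ z.2 * V z ^ 2) ≤
    (∫ x in annulus δ, (timeFluxOf τ (slab a b) V (x, b) - timeFluxOf τ (slab a b) V (x, a)))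
      + 1 / (32 * τ * δ ^ 6) * ∫ z in annulus δ ×ˢ Set.Icc a b,
        carlemanWeight τ ‖z.1‖ z.2 * reducedWave (slab a b) V z ^ 2 := by
  have hc : 0 < c := lt_of_le_of_lt (by positivity) hδc
  have hWc := (continuous_carlemanWeight τ).continuousOn (s := slab a b)
  have hKc := (contDiffOn_rotSq hab hV).continuousOn
  have hVc := hV.continuousOn
  have hQc := continuousOn_reducedWave hab hV
  have hne : ∀ {z : Space3 × ℝ}, ‖z.1‖ = δ ∨ ‖z.1‖ = 1 → z.1 ≠ 0 := by
    rintro z (h | h) <;> refine norm_pos_iff.1 ?_ <;> rw [h]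
    exacts [hδ, one_pos]
  obtain ⟨hi, hdiv⟩ := integral_slab_divergence hδ hab (contDiffOn_radialFluxOf (τ := τ) hab hV)
    (contDiffOn_timeFluxOf (τ := τ) hab hV) (contDiffOn_angularFluxOf (τ := τ) hab hV)
    (fun z hz hs => flatAt_radialFluxOf hab hV (hne hz) hs (flatAt_of_norm_eq hδc hsupp hbd hz hs))
    (fun k z hz hs => flatAt_angularFluxOf hab hV (hne hz) hs
      (flatAt_of_norm_eq hδc hsupp hbd hz hs) k)
  have iK := integrableOn_annulus_prod hδ (hWc.fun_mul hKc)
  have iV := integrableOn_annulus_prod hδ (hWc.fun_mul (hVc.fun_pow 2))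
  have iQ := integrableOn_annulus_prod hδ (hWc.fun_mul (hQc.fun_pow 2))
  rw [← hdiv, ← integral_const_mul, ← integral_const_mul, ← integral_const_mul,
    ← integral_add (iK.const_mul _) (iV.const_mul _), ← integral_add hi (iQ.const_mul _)]
  refine integral_mono_ae ((iK.const_mul _).add (iV.const_mul _)) (hi.add (iQ.const_mul _)) ?_
  filter_upwards [ae_snd_mem_Ioo _ (isClosed_annulus δ).measurableSet a b] with z hz
  have hz0 : 0 < ‖z.1‖ := hδ.trans_le hz.1.1
  have hW := carlemanWeight_pos τ ‖z.1‖ z.2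
  have hpt := carleman_divergence hab hV hτ (norm_pos_iff.1 hz0) hz.2
  have hQ : carlemanWeight τ ‖z.1‖ z.2 * reducedWave (slab a b) V z ^ 2 / (32 * τ * ‖z.1‖ ^ 6)
      ≤ 1 / (32 * τ * δ ^ 6) *
        (carlemanWeight τ ‖z.1‖ z.2 * reducedWave (slab a b) V z ^ 2) := by
    rw [one_div_mul_eq_div]
    have := hz.1.1
    gcongr
  refine le_trans ?_ (hpt.trans (add_le_add_right hQ _))
  rcases lt_or_ge (4 * ‖z.1‖ ^ 2 - z.2 ^ 2) c with hlt | hge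
  · have h0 := eventuallyEq_zero_of_lt hsupp hlt
    simp [rotSq_eq_zero_of_eventuallyEq _ h0, hsupp z hlt]
  · have hK := rotSq_nonneg (slab a b) V z
    have hA := two_mul_norm_add_ge hz.1.2 hz0 ⟨ha.trans_lt hz.2.1, hz.2.2.trans_le hb⟩ hc hge
    have k1 : c / 8 ≤ (2 * ‖z.1‖ + z.2) / (2 * ‖z.1‖ ^ 3) := by
      rw [le_div_iff₀ (by positivity)]
      have : ‖z.1‖ ^ 3 ≤ 1 := pow_le_one₀ hz0.le hz.1.2
      nlinarith
    have k2 : c ^ 2 * τ ^ 2 / 4 ≤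
        8 * τ ^ 2 * (2 * ‖z.1‖ + z.2) * (10 * ‖z.1‖ + z.2) - 8 * τ := by
      have e1 : c / 4 * (c / 4) ≤ (2 * ‖z.1‖ + z.2) * (10 * ‖z.1‖ + z.2) :=
        mul_le_mul hA (by linarith) (by positivity) (by linarith)
      have e2 : 8 * τ ≤ c ^ 2 * τ ^ 2 / 4 := by nlinarith
      have e3 := mul_le_mul_of_nonneg_left e1 (by positivity : 0 ≤ 8 * τ ^ 2)
      nlinarith
    have k3 : 1 ≤ 1 / ‖z.1‖ ^ 2 := by
      rw [le_div_iff₀ (by positivity), one_mul]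
      exact pow_le_one₀ hz0.le hz.1.2
    have k4 : c / 8 * rotSq (slab a b) V z + c ^ 2 * τ ^ 2 / 4 * V z ^ 2 ≤
        (2 * ‖z.1‖ + z.2) / (2 * ‖z.1‖ ^ 3) * rotSq (slab a b) V z
        + (8 * τ ^ 2 * (2 * ‖z.1‖ + z.2) * (10 * ‖z.1‖ + z.2) - 8 * τ) * V z ^ 2 := by
      gcongr
    have k5 : 0 ≤ c / 8 * rotSq (slab a b) V z + c ^ 2 * τ ^ 2 / 4 * V z ^ 2 := by positivity
    calc _ = carlemanWeight τ ‖z.1‖ z.2 * 1 *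
          (c / 8 * rotSq (slab a b) V z + c ^ 2 * τ ^ 2 / 4 * V z ^ 2) := by
          ring
      _ ≤ carlemanWeight τ ‖z.1‖ z.2 * (1 / ‖z.1‖ ^ 2) *
          ((2 * ‖z.1‖ + z.2) / (2 * ‖z.1‖ ^ 3) * rotSq (slab a b) V z
        + (8 * τ ^ 2 * (2 * ‖z.1‖ + z.2) * (10 * ‖z.1‖ + z.2) - 8 * τ) * V z ^ 2) := by gcongr
      _ = _ := by ring

/-- The energy inequality on a slab, bounding the trace on its upper face. -/
theorem trace_slab (hδ : 0 < δ) (hδc : 4 * δ ^ 2 < c) (hab : a < b) (ha : -2 ≤ a) (hb : b ≤ 2)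
    (hV : ContDiffOn ℝ 2 V (slab a b))
    (hsupp : ∀ z : Space3 × ℝ, 4 * ‖z.1‖ ^ 2 - z.2 ^ 2 < c → V z = 0)
    (hbd : ∀ z : Space3 × ℝ, ‖z.1‖ = 1 → z.2 ∈ Set.Ioo a b → FlatAt V z)
    (hτ : 0 < τ) :
    (∫ x in annulus δ,
        (timeTraceFluxOf τ (slab a b) V (x, b) - timeTraceFluxOf τ (slab a b) V (x, a))) ≤
      1 / (16 * τ * c * δ ^ 6) * (∫ z in annulus δ ×ˢ Set.Icc a b,
        carlemanWeight τ ‖z.1‖ z.2 * reducedWave (slab a b) V z ^ 2)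
      + 2 * τ / δ ^ 3 *
        ∫ z in annulus δ ×ˢ Set.Icc a b, carlemanWeight τ ‖z.1‖ z.2 * rotSq (slab a b) V z := by
  have hc : 0 < c := lt_of_le_of_lt (by positivity) hδc
  have hWc := (continuous_carlemanWeight τ).continuousOn (s := slab a b)
  have hKc := (contDiffOn_rotSq hab hV).continuousOn
  have hQc := continuousOn_reducedWave hab hV
  have hne : ∀ {z : Space3 × ℝ}, ‖z.1‖ = δ ∨ ‖z.1‖ = 1 → z.1 ≠ 0 := by
    rintro z (h | h) <;> refine norm_pos_iff.1 ?_ <;> rw [h]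
    exacts [hδ, one_pos]
  obtain ⟨hi, hdiv⟩ := integral_slab_divergence hδ hab
    (contDiffOn_radialTraceFluxOf (τ := τ) hab hV)
    (contDiffOn_timeTraceFluxOf (τ := τ) hab hV) (contDiffOn_angularTraceFluxOf (τ := τ) hab hV)
    (fun z hz hs => flatAt_radialTraceFluxOf hab hV (hne hz) hs
      (flatAt_of_norm_eq hδc hsupp hbd hz hs))
    (fun k z hz hs => flatAt_angularTraceFluxOf hab hV (hne hz) hs
      (flatAt_of_norm_eq hδc hsupp hbd hz hs) k)
  have iK := integrableOn_annulus_prod hδ (hWc.fun_mul hKc)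
  have iQ := integrableOn_annulus_prod hδ (hWc.fun_mul (hQc.fun_pow 2))
  rw [← hdiv, ← integral_const_mul, ← integral_const_mul,
    ← integral_add (iQ.const_mul _) (iK.const_mul _)]
  refine integral_mono_ae hi ((iQ.const_mul _).add (iK.const_mul _)) ?_
  filter_upwards [ae_snd_mem_Ioo _ (isClosed_annulus δ).measurableSet a b] with z hz
  have hz0 : 0 < ‖z.1‖ := hδ.trans_le hz.1.1
  have hW := carlemanWeight_pos τ ‖z.1‖ z.2
  have hK := rotSq_nonneg (slab a b) V z
  have hδz := hz.1.1
  rcases lt_or_ge (4 * ‖z.1‖ ^ 2 - z.2 ^ 2) c with hlt | hge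
  · have h0 := eventually_eventually_nhds.2 (eventuallyEq_zero_of_lt hsupp hlt)
    have e1 : radialTraceFluxOf τ (slab a b) V =ᶠ[nhds z] 0 :=
      h0.mono fun y hy => radialTraceFluxOf_eq_zero_of_eventuallyEq _ hy
    have e2 : timeTraceFluxOf τ (slab a b) V =ᶠ[nhds z] 0 :=
      h0.mono fun y hy => timeTraceFluxOf_eq_zero_of_eventuallyEq _ hy
    have e3 : ∀ k, angularTraceFluxOf τ (slab a b) V k =ᶠ[nhds z] 0 := fun k =>
      h0.mono fun y hy => angularTraceFluxOf_eq_zero_of_eventuallyEq _ k hy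
    rw [lieD_eq_zero_of_eventuallyEq _ e1, lieD_eq_zero_of_eventuallyEq _ e2,
      Finset.sum_eq_zero fun k _ => lieD_eq_zero_of_eventuallyEq _ (e3 k) _]
    simp only [zero_div, add_zero]
    positivity
  · have hA := two_mul_norm_add_ge hz.1.2 hz0 ⟨ha.trans_lt hz.2.1, hz.2.2.trans_le hb⟩ hc hge
    have hA0 : 0 < 2 * ‖z.1‖ + z.2 := by linarith
    refine (trace_divergence hab hV hτ (norm_pos_iff.1 hz0) hz.2 hA0).trans
      (add_le_add ?_ ?_)
    · rw [one_div_mul_eq_div]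
      have : 16 * τ * c * δ ^ 6 ≤ 64 * τ * (2 * ‖z.1‖ + z.2) * ‖z.1‖ ^ 6 :=
        calc 16 * τ * c * δ ^ 6 = 64 * τ * (c / 4) * δ ^ 6 := by ring
          _ ≤ _ := by gcongr
      gcongr
    · calc _ ≤ 2 * τ * carlemanWeight τ ‖z.1‖ z.2 * rotSq (slab a b) V z / δ ^ 3 := by gcongr
        _ = _ := by ring

end Integrated

section TwoSlabs

variable {δ a b c τ : ℝ} {V : Space3 × ℝ → ℝ}

theorem fderivWithin_slab_horizontal (hV : ContDiffOn ℝ 1 V (slab a b)) {x : Space3}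
    (hx : x ≠ 0) {s : ℝ} (hs : s ∈ Set.Icc a b) (y : Space3) :
    fderivWithin ℝ V (slab a b) (x, s) (y, 0) = fderiv ℝ (fun x => V (x, s)) x y := by
  have hd : HasFDerivWithinAt V (fderivWithin ℝ V (slab a b) (x, s)) (slab a b)
      ((fun x : Space3 => (x, s)) x) :=
    (hV.differentiableOn (by norm_num) (x, s) ⟨hx, hs⟩).hasFDerivWithinAt
  have hc := HasFDerivWithinAt.comp_hasFDerivAt (f := fun x : Space3 => (x, s)) x hd
    (hasFDerivAt_prodMk_left x s)
    (by
      filter_upwards [isOpen_compl_singleton.mem_nhds hx] with w hw using ⟨hw, hs⟩)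
  exact (DFunLike.congr_fun hc.fderiv y).symm

theorem timeFluxOf_slab_eq (h1 : ContDiffOn ℝ 2 V (slab (-2) 0))
    (h2 : ContDiffOn ℝ 2 V (slab 0 2)) {x : Space3} (hx : x ≠ 0) :
    timeFluxOf τ (slab (-2) 0) V (x, 0) = timeFluxOf τ (slab 0 2) V (x, 0) := by
  have e : ∀ y : Space3, fderivWithin ℝ V (slab (-2) 0) (x, 0) (y, 0)
      = fderivWithin ℝ V (slab 0 2) (x, 0) (y, 0) := fun y => by
    rw [fderivWithin_slab_horizontal (h1.of_le (by norm_num)) hx (by simp),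
      fderivWithin_slab_horizontal (h2.of_le (by norm_num)) hx (by simp)]
  simp only [timeFluxOf, rotSq, lieD, eulerField, rotField, e]

/-- Carleman and trace estimates for a function on two adjacent slabs, continuous across the
common face. -/
theorem two_slab_estimate (hδ : 0 < δ) (hδc : 4 * δ ^ 2 < c)
    (h1 : ContDiffOn ℝ 2 V (slab (-2) 0)) (h2 : ContDiffOn ℝ 2 V (slab 0 2))
    (hsupp : ∀ z : Space3 × ℝ, 4 * ‖z.1‖ ^ 2 - z.2 ^ 2 < c → V z = 0)
    (hbd1 : ∀ z : Space3 × ℝ, ‖z.1‖ = 1 → z.2 ∈ Set.Ioo (-2 : ℝ) 0 → FlatAt V z)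
    (hbd2 : ∀ z : Space3 × ℝ, ‖z.1‖ = 1 → z.2 ∈ Set.Ioo (0 : ℝ) 2 → FlatAt V z)
    (hτ : 1 ≤ τ) (hτc : 32 ≤ τ * c ^ 2) {I U : ℝ}
    (hI : I = (∫ z in annulus δ ×ˢ Set.Icc (-2) 0,
        carlemanWeight τ ‖z.1‖ z.2 * reducedWave (slab (-2) 0) V z ^ 2)
      + ∫ z in annulus δ ×ˢ Set.Icc 0 2,
        carlemanWeight τ ‖z.1‖ z.2 * reducedWave (slab 0 2) V z ^ 2)
    (hU : U = (∫ z in annulus δ ×ˢ Set.Icc (-2) 0, carlemanWeight τ ‖z.1‖ z.2 * V z ^ 2)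
      + ∫ z in annulus δ ×ˢ Set.Icc 0 2, carlemanWeight τ ‖z.1‖ z.2 * V z ^ 2) :
    U ≤ 1 / (8 * c ^ 2 * δ ^ 6) / τ * I ∧
    ∫ x in annulus δ, carlemanWeight τ ‖x‖ 0 * lieD (slab (-2) 0) eulerField V (x, 0) ^ 2 ≤
      (1 / (4 * c * δ ^ 6) + 2 / (c * δ ^ 9)) * I := by
  have hc : 0 < c := lt_of_le_of_lt (by positivity) hδc
  have hτ0 : 0 < τ := by linarith
  have C1 := carleman_slab hδ hδc (by norm_num) le_rfl (by norm_num) h1 hsupp hbd1 hτ0 hτc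
  have C2 := carleman_slab hδ hδc (by norm_num) (by norm_num) le_rfl h2 hsupp hbd2 hτ0 hτc
  have T1 := trace_slab hδ hδc (by norm_num) le_rfl (by norm_num) h1 hsupp hbd1 hτ0
  have hm := (isClosed_annulus δ).measurableSet
  have hend : ∀ x ∈ annulus δ, ∀ s : ℝ, s ^ 2 = 4 → V =ᶠ[nhds (x, s)] 0 := fun x hx s hs => by
    refine eventuallyEq_zero_of_lt hsupp ?_
    have : ‖x‖ ^ 2 ≤ 1 := pow_le_one₀ (norm_nonneg x) hx.2
    simp only [hs]
    linarith
  have hx0 : ∀ x ∈ annulus δ, x ≠ 0 := fun x hx => norm_pos_iff.1 (hδ.trans_le hx.1)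
  have B : (∫ x in annulus δ, (timeFluxOf τ (slab (-2) 0) V (x, 0)
        - timeFluxOf τ (slab (-2) 0) V (x, -2)))
      + (∫ x in annulus δ, (timeFluxOf τ (slab 0 2) V (x, 2) - timeFluxOf τ (slab 0 2) V (x, 0)))
      = 0 := by
    have e : ∫ x in annulus δ, (timeFluxOf τ (slab 0 2) V (x, 2)
        - timeFluxOf τ (slab 0 2) V (x, 0))
        = ∫ x in annulus δ, -(timeFluxOf τ (slab (-2) 0) V (x, 0)
        - timeFluxOf τ (slab (-2) 0) V (x, -2)) := by
      refine setIntegral_congr_fun hm fun x hx => ?_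
      rw [timeFluxOf_eq_zero_of_eventuallyEq _ (hend x hx 2 (by norm_num)),
        timeFluxOf_eq_zero_of_eventuallyEq _ (hend x hx (-2) (by norm_num)),
        timeFluxOf_slab_eq h1 h2 (hx0 x hx)]
      ring
    rw [e, integral_neg]
    ring
  have nn : ∀ (D : Set (Space3 × ℝ)) (f : Space3 × ℝ → ℝ), (∀ z, 0 ≤ f z) →
      0 ≤ ∫ z in D, carlemanWeight τ ‖z.1‖ z.2 * f z := fun D f hf =>
    integral_nonneg fun z => mul_nonneg (carlemanWeight_pos _ _ _).le (hf z)
  have nK1 := nn (annulus δ ×ˢ Set.Icc (-2) 0) _ (rotSq_nonneg (slab (-2) 0) V)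
  have nK2 := nn (annulus δ ×ˢ Set.Icc 0 2) _ (rotSq_nonneg (slab 0 2) V)
  have nQ1 := nn (annulus δ ×ˢ Set.Icc (-2) 0) (fun z => reducedWave (slab (-2) 0) V z ^ 2)
    fun z => sq_nonneg _
  have nQ2 := nn (annulus δ ×ˢ Set.Icc 0 2) (fun z => reducedWave (slab 0 2) V z ^ 2)
    fun z => sq_nonneg _
  have nU1 := nn (annulus δ ×ˢ Set.Icc (-2) 0) (fun z => V z ^ 2) fun z => sq_nonneg _
  have nU2 := nn (annulus δ ×ˢ Set.Icc 0 2) (fun z => V z ^ 2) fun z => sq_nonneg _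
  have T2 : ∫ x in annulus δ, carlemanWeight τ ‖x‖ 0 *
      lieD (slab (-2) 0) eulerField V (x, 0) ^ 2 ≤
      4 * ∫ x in annulus δ, (timeTraceFluxOf τ (slab (-2) 0) V (x, 0)
        - timeTraceFluxOf τ (slab (-2) 0) V (x, -2)) := by
    rw [← integral_const_mul]
    have cE := (ContDiffOn.lieD (uniqueDiffOn_slab (by norm_num)) contDiff_eulerField
      h1).continuousOn
    have cT := fun τ => (contDiffOn_timeTraceFluxOf (τ := τ) (by norm_num) h1).continuousOn
    have mt : ∀ s ∈ Set.Icc (-2 : ℝ) 0, Set.MapsTo (fun x : Space3 => (x, s)) (annulus δ)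
      (slab (-2) 0) := fun s hs x hx => ⟨hx0 x hx, hs⟩
    refine setIntegral_mono_on ?_ ?_ hm fun x hx => ?_
    · refine ContinuousOn.integrableOn_compact (isCompact_annulus δ) ?_
      refine ContinuousOn.mul ?_ ((cE.comp (by fun_prop) (mt 0 (by simp))).pow 2)
      unfold carlemanWeight
      fun_prop
    · refine ContinuousOn.integrableOn_compact (isCompact_annulus δ) ?_
      exact continuousOn_const.mul (((cT τ).comp (by fun_prop) (mt 0 (by simp))).sub
        ((cT τ).comp (by fun_prop) (mt (-2) (by simp))))
    · rw [timeTraceFluxOf_eq_zero_of_eventuallyEq _ (hend x hx (-2) (by norm_num))]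
      simp only [timeTraceFluxOf, timeTraceFlux, sub_zero]
      have hr : 0 < ‖x‖ := hδ.trans_le hx.1
      have hr4 : ‖x‖ ^ 4 ≤ 1 := pow_le_one₀ hr.le hx.2
      have hW := carlemanWeight_pos τ ‖x‖ 0
      rw [← mul_div_assoc, le_div_iff₀ (by positivity)]
      have : 0 ≤ carlemanWeight τ ‖x‖ 0 * lieD (slab (-2) 0) eulerField V (x, 0) ^ 2 := by
        positivity
      nlinarith
  generalize (∫ z in annulus δ ×ˢ Set.Icc (-2) 0,
    carlemanWeight τ ‖z.1‖ z.2 * rotSq (slab (-2) 0) V z) = K1 at *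
  generalize (∫ z in annulus δ ×ˢ Set.Icc 0 2,
    carlemanWeight τ ‖z.1‖ z.2 * rotSq (slab 0 2) V z) = K2 at *
  generalize (∫ z in annulus δ ×ˢ Set.Icc (-2) 0,
    carlemanWeight τ ‖z.1‖ z.2 * reducedWave (slab (-2) 0) V z ^ 2) = Q1 at *
  generalize (∫ z in annulus δ ×ˢ Set.Icc 0 2,
    carlemanWeight τ ‖z.1‖ z.2 * reducedWave (slab 0 2) V z ^ 2) = Q2 at *
  generalize (∫ z in annulus δ ×ˢ Set.Icc (-2) 0, carlemanWeight τ ‖z.1‖ z.2 * V z ^ 2) = U1 at *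
  generalize (∫ z in annulus δ ×ˢ Set.Icc 0 2, carlemanWeight τ ‖z.1‖ z.2 * V z ^ 2) = U2 at *
  have S : c / 8 * (K1 + K2) + c ^ 2 * τ ^ 2 / 4 * U ≤ 1 / (32 * τ * δ ^ 6) * I := by
    rw [hI, hU]; linarith
  have nI : 0 ≤ I := by linarith
  have nU : 0 ≤ U := by linarith
  have SK : c / 8 * K1 ≤ 1 / (32 * τ * δ ^ 6) * I := by
    have : 0 ≤ c ^ 2 * τ ^ 2 / 4 * U := by positivity
    have : 0 ≤ c / 8 * K2 := by positivity
    linarith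
  have SU : c ^ 2 * τ ^ 2 / 4 * U ≤ 1 / (32 * τ * δ ^ 6) * I := by
    have : 0 ≤ c / 8 * (K1 + K2) := by positivity
    linarith
  constructor
  · have h3 : c ^ 2 / 4 * U ≤ 1 / (32 * τ * δ ^ 6) * I := by
      refine le_trans ?_ SU
      have : (1 : ℝ) ≤ τ ^ 2 := one_le_pow₀ hτ
      have : 0 ≤ c ^ 2 / 4 * U := by positivity
      nlinarith
    have h4 := mul_le_mul_of_nonneg_left h3 (by positivity : 0 ≤ 4 / c ^ 2)
    calc U = 4 / c ^ 2 * (c ^ 2 / 4 * U) := by field_simp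
      _ ≤ _ := h4
      _ = _ := by field_simp; ring
  · have h3 := mul_le_mul_of_nonneg_left SK (by positivity : 0 ≤ 8 / c * (2 * τ / δ ^ 3))
    have h5 : 2 * τ / δ ^ 3 * K1 ≤ 1 / (2 * c * δ ^ 9) * I := by
      calc 2 * τ / δ ^ 3 * K1 = 8 / c * (2 * τ / δ ^ 3) * (c / 8 * K1) := by field_simp
        _ ≤ _ := h3
        _ = _ := by field_simp; ring
    have h6 : 1 / (16 * τ * c * δ ^ 6) * Q1 ≤ 1 / (16 * c * δ ^ 6) * I := by
      have : 16 * c * δ ^ 6 ≤ 16 * τ * c * δ ^ 6 := by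
        have : 0 ≤ 16 * c * δ ^ 6 := by positivity
        nlinarith
      have : Q1 ≤ I := by linarith
      gcongr
    calc _ ≤ 4 * (1 / (16 * c * δ ^ 6) * I + 1 / (2 * c * δ ^ 9) * I) := by linarith
      _ = _ := by field_simp; ring

end TwoSlabs

/-! ### The decay argument -/

section Decay

variable {δ a b c₁ c₂ τ Cq M : ℝ} {V : Space3 × ℝ → ℝ} {p : Space3 → ℝ}

/-- The weighted source on the face `s = 0`, restricted to `4‖x‖² > c`. -/
noncomputable def weightedSource (τ c : ℝ) (p : Space3 → ℝ) : Space3 → ℝ :=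
  {x | c < 4 * ‖x‖ ^ 2}.indicator fun x => Real.exp (8 * τ * ‖x‖ ^ 2) * p x ^ 2

theorem weightedSource_of_lt {c : ℝ} {x : Space3} (hx : c < 4 * ‖x‖ ^ 2) :
    weightedSource τ c p x = Real.exp (8 * τ * ‖x‖ ^ 2) * p x ^ 2 :=
  Set.indicator_of_mem (s := {x : Space3 | c < 4 * ‖x‖ ^ 2}) hx _

theorem weightedSource_nonneg (τ c : ℝ) (p : Space3 → ℝ) (x : Space3) :
    0 ≤ weightedSource τ c p x :=
  Set.indicator_nonneg (fun _ _ => by positivity) x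

theorem integrableOn_weightedSource (hp : Continuous p) :
    IntegrableOn (weightedSource τ c₂ p) (annulus δ) := by
  refine Integrable.indicator ?_ (measurableSet_lt (by fun_prop) (by fun_prop))
  exact ContinuousOn.integrableOn_compact (isCompact_annulus δ) (by fun_prop)

theorem setIntegral_gaussian_le (hτ : 0 < τ) (s : Set ℝ) :
    ∫ t in s, Real.exp (-(2 * τ) * t ^ 2) ≤ √(Real.pi / (2 * τ)) := by
  rw [← integral_gaussian]
  exact setIntegral_le_integral (integrable_exp_neg_mul_sq (by positivity))
    (Filter.Eventually.of_forall fun t => (Real.exp_pos _).le)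

theorem integral_reducedWave_le (hδ : 0 < δ) (hab : a < b) (hτ : 0 < τ)
    (hV : ContDiffOn ℝ 2 V (slab a b)) (hp : Continuous p) (hCq : 0 ≤ Cq)
    (hQ : ∀ z : Space3 × ℝ, z.1 ≠ 0 → ‖z.1‖ ≤ 1 → z.2 ∈ Set.Ioo a b →
      c₂ < 4 * ‖z.1‖ ^ 2 - z.2 ^ 2 →
      reducedWave (slab a b) V z ^ 2 ≤ Cq * (p z.1 ^ 2 + V z ^ 2))
    (hM : ∀ z ∈ annulus δ ×ˢ Set.Icc a b, reducedWave (slab a b) V z ^ 2 ≤ M) :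
    ∫ z in annulus δ ×ˢ Set.Icc a b, carlemanWeight τ ‖z.1‖ z.2 * reducedWave (slab a b) V z ^ 2
      ≤ Cq * ((∫ x in annulus δ, weightedSource τ c₂ p x) * √(Real.pi / (2 * τ))
        + ∫ z in annulus δ ×ˢ Set.Icc a b, carlemanWeight τ ‖z.1‖ z.2 * V z ^ 2)
      + M * volume.real (annulus δ ×ˢ Set.Icc a b) * Real.exp (2 * τ * c₂) := by
  have hcW := (continuous_carlemanWeight τ).continuousOn (s := slab a b)
  have i1 := integrableOn_annulus_prod hδ (hcW.fun_mul ((continuousOn_reducedWave hab hV).fun_pow 2))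
  have i2 := integrableOn_annulus_prod hδ (hcW.fun_mul (hV.continuousOn.fun_pow 2))
  have ig : IntegrableOn (fun s : ℝ => Real.exp (-(2 * τ) * s ^ 2)) (Set.Icc a b) :=
    (integrable_exp_neg_mul_sq (by positivity)).integrableOn
  have i3 : IntegrableOn (fun z : Space3 × ℝ =>
      weightedSource τ c₂ p z.1 * Real.exp (-(2 * τ) * z.2 ^ 2)) (annulus δ ×ˢ Set.Icc a b) := by
    rw [IntegrableOn, Measure.volume_eq_prod, ← Measure.prod_restrict]
    exact (integrableOn_weightedSource hp).mul_prod ig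
  have i4 : IntegrableOn (fun _ : Space3 × ℝ => M * Real.exp (2 * τ * c₂))
      (annulus δ ×ˢ Set.Icc a b) :=
    ContinuousOn.integrableOn_compact (isCompact_annulus_prod δ a b) continuousOn_const
  have e3 : ∫ z in annulus δ ×ˢ Set.Icc a b,
      weightedSource τ c₂ p z.1 * Real.exp (-(2 * τ) * z.2 ^ 2)
      = (∫ x in annulus δ, weightedSource τ c₂ p x) *
        ∫ s in Set.Icc a b, Real.exp (-(2 * τ) * s ^ 2) := by
    rw [Measure.volume_eq_prod]
    exact setIntegral_prod_mul (weightedSource τ c₂ p) (fun s : ℝ => Real.exp (-(2 * τ) * s ^ 2)) _ _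
  calc _ ≤ ∫ z in annulus δ ×ˢ Set.Icc a b,
        (Cq * (weightedSource τ c₂ p z.1 * Real.exp (-(2 * τ) * z.2 ^ 2)
          + carlemanWeight τ ‖z.1‖ z.2 * V z ^ 2) + M * Real.exp (2 * τ * c₂)) := by
        refine setIntegral_mono_ae_restrict i1 (((i3.fun_add i2).const_mul Cq).fun_add i4) ?_
        have hm : MeasurableSet (annulus δ ×ˢ Set.Icc a b) :=
          (isCompact_annulus_prod δ a b).isClosed.measurableSet
        filter_upwards [ae_restrict_mem hm,
          ae_snd_mem_Ioo (annulus δ) (isClosed_annulus δ).measurableSet a b] with z hz hzs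
        have hW := carlemanWeight_pos τ ‖z.1‖ z.2
        have hM0 : 0 ≤ M := (sq_nonneg _).trans (hM z hz)
        have hF := weightedSource_nonneg τ c₂ p z.1
        have hx0 : z.1 ≠ 0 := norm_pos_iff.1 (hδ.trans_le hz.1.1)
        by_cases hc : c₂ < 4 * ‖z.1‖ ^ 2 - z.2 ^ 2
        · have hFe : weightedSource τ c₂ p z.1 * Real.exp (-(2 * τ) * z.2 ^ 2)
              = carlemanWeight τ ‖z.1‖ z.2 * p z.1 ^ 2 := by
            have := sq_nonneg z.2
            rw [weightedSource_of_lt (by linarith), carlemanWeight,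
              show 2 * τ * (4 * ‖z.1‖ ^ 2 - z.2 ^ 2)
                = 8 * τ * ‖z.1‖ ^ 2 + -(2 * τ) * z.2 ^ 2 by ring, Real.exp_add]
            ring
          rw [hFe]
          have h1 := mul_le_mul_of_nonneg_left (hQ z hx0 hz.1.2 hzs.2 hc) hW.le
          have : 0 ≤ M * Real.exp (2 * τ * c₂) := by positivity
          linarith
        · have hWle : carlemanWeight τ ‖z.1‖ z.2 ≤ Real.exp (2 * τ * c₂) := by
            refine Real.exp_le_exp.2 (mul_le_mul_of_nonneg_left (not_lt.1 hc) (by positivity))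
          have h1 : carlemanWeight τ ‖z.1‖ z.2 * reducedWave (slab a b) V z ^ 2
              ≤ Real.exp (2 * τ * c₂) * M :=
            mul_le_mul hWle (hM z hz) (sq_nonneg _) (Real.exp_pos _).le
          have : 0 ≤ Cq * (weightedSource τ c₂ p z.1 * Real.exp (-(2 * τ) * z.2 ^ 2)
            + carlemanWeight τ ‖z.1‖ z.2 * V z ^ 2) := by positivity
          linarith
    _ = Cq * ((∫ x in annulus δ, weightedSource τ c₂ p x) *
          (∫ s in Set.Icc a b, Real.exp (-(2 * τ) * s ^ 2))
        + ∫ z in annulus δ ×ˢ Set.Icc a b, carlemanWeight τ ‖z.1‖ z.2 * V z ^ 2)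
      + M * volume.real (annulus δ ×ˢ Set.Icc a b) * Real.exp (2 * τ * c₂) := by
        rw [integral_add ((i3.fun_add i2).const_mul Cq) i4, integral_const_mul,
          integral_add i3 i2, e3, setIntegral_const, smul_eq_mul]
        ring
    _ ≤ _ := by
        have : 0 ≤ ∫ x in annulus δ, weightedSource τ c₂ p x :=
          integral_nonneg fun x => weightedSource_nonneg τ c₂ p x
        gcongr
        exact setIntegral_gaussian_le hτ _

theorem exists_le_integral_weightedSource (hδ : 4 * δ ^ 2 < c₂) (hp : Continuous p)
    {x₀ : Space3} (hx₀ : ‖x₀‖ < 1) (hc : c₂ < 4 * ‖x₀‖ ^ 2) (hpx : p x₀ ≠ 0) :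
    ∃ κ > 0, ∃ c₃ > c₂, ∀ τ : ℝ, 0 < τ →
      κ * Real.exp (2 * τ * c₃) ≤ ∫ x in annulus δ, weightedSource τ c₂ p x := by
  obtain ⟨c₃, h23, h3⟩ := exists_between hc
  have hη : 0 < p x₀ ^ 2 := by positivity
  obtain ⟨η, hη0, hη1⟩ := exists_between hη
  set N : Set Space3 := {x | ‖x‖ < 1} ∩ {x | c₃ < 4 * ‖x‖ ^ 2} ∩ {x | η < p x ^ 2} with hN
  have hNo : IsOpen N := by
    refine ((isOpen_lt ?_ ?_).inter (isOpen_lt ?_ ?_)).inter (isOpen_lt ?_ ?_) <;> fun_prop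
  have hNA : N ⊆ annulus δ := fun x hx => by
    refine ⟨?_, hx.1.1.le⟩
    have : c₃ < 4 * ‖x‖ ^ 2 := hx.1.2
    exact le_of_lt (lt_of_pow_lt_pow_left₀ 2 (norm_nonneg x) (by linarith))
  have hfin : volume N ≠ ⊤ :=
    ((measure_mono hNA).trans_lt (isCompact_annulus δ).measure_lt_top).ne
  have hpos : 0 < volume.real N :=
    ENNReal.toReal_pos (hNo.measure_pos _ ⟨x₀, ⟨hx₀, h3⟩, hη1⟩).ne' hfin
  refine ⟨η * volume.real N, by positivity, c₃, h23, fun τ hτ => ?_⟩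
  have hintegr := integrableOn_weightedSource (τ := τ) (c₂ := c₂) (δ := δ) hp
  calc η * volume.real N * Real.exp (2 * τ * c₃)
      = ∫ x in N, η * Real.exp (2 * τ * c₃) := by
        rw [setIntegral_const, smul_eq_mul]; ring
    _ ≤ ∫ x in N, weightedSource τ c₂ p x := by
        refine setIntegral_mono_on (integrableOn_const hfin) (hintegr.mono_set hNA)
          hNo.measurableSet fun x hx => ?_
        have h4 : c₃ < 4 * ‖x‖ ^ 2 := hx.1.2
        have h5 : η < p x ^ 2 := hx.2
        rw [weightedSource_of_lt (by linarith), mul_comm]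
        have : 2 * τ * c₃ ≤ 8 * τ * ‖x‖ ^ 2 := by nlinarith
        gcongr
    _ ≤ _ := setIntegral_mono_set hintegr
        (Filter.Eventually.of_forall fun x => weightedSource_nonneg τ c₂ p x)
        (Filter.Eventually.of_forall hNA)

/-- A source dominated by the characteristic trace of a function obeying the reduced wave
inequality, with vanishing lateral Cauchy data, vanishes. -/
theorem source_eq_zero (hc₁ : 0 < c₁) (hc : c₁ < c₂) (hp : Continuous p) (hCq : 0 ≤ Cq)
    (h1 : ContDiffOn ℝ 2 V (slab (-2) 0)) (h2 : ContDiffOn ℝ 2 V (slab 0 2))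
    (hsupp : ∀ z : Space3 × ℝ, 4 * ‖z.1‖ ^ 2 - z.2 ^ 2 < c₁ → V z = 0)
    (hbd1 : ∀ z : Space3 × ℝ, ‖z.1‖ = 1 → z.2 ∈ Set.Ioo (-2 : ℝ) 0 → FlatAt V z)
    (hbd2 : ∀ z : Space3 × ℝ, ‖z.1‖ = 1 → z.2 ∈ Set.Ioo (0 : ℝ) 2 → FlatAt V z)
    (hQ1 : ∀ z : Space3 × ℝ, z.1 ≠ 0 → ‖z.1‖ ≤ 1 → z.2 ∈ Set.Ioo (-2) 0 →
      c₂ < 4 * ‖z.1‖ ^ 2 - z.2 ^ 2 →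
      reducedWave (slab (-2) 0) V z ^ 2 ≤ Cq * (p z.1 ^ 2 + V z ^ 2))
    (hQ2 : ∀ z : Space3 × ℝ, z.1 ≠ 0 → ‖z.1‖ ≤ 1 → z.2 ∈ Set.Ioo 0 2 →
      c₂ < 4 * ‖z.1‖ ^ 2 - z.2 ^ 2 →
      reducedWave (slab 0 2) V z ^ 2 ≤ Cq * (p z.1 ^ 2 + V z ^ 2))
    (hchar : ∀ x : Space3, ‖x‖ ≤ 1 → c₂ < 4 * ‖x‖ ^ 2 →
      lieD (slab (-2) 0) eulerField V (x, 0) = ‖x‖ * p x)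
    {x₀ : Space3} (hx₀ : ‖x₀‖ < 1) (hcx : c₂ < 4 * ‖x₀‖ ^ 2) : p x₀ = 0 := by
  by_contra hpx
  obtain ⟨δ, hδ, hδc⟩ : ∃ δ : ℝ, 0 < δ ∧ 4 * δ ^ 2 < c₁ := by
    refine ⟨√c₁ / 4, by positivity, ?_⟩
    rw [div_pow, Real.sq_sqrt hc₁.le]
    linarith
  obtain ⟨κ, hκ, c₃, h23, hlow⟩ :=
    exists_le_integral_weightedSource (hδc.trans hc) hp hx₀ hcx hpx
  have bound : ∀ {a b : ℝ}, a < b → ContDiffOn ℝ 2 V (slab a b) →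
      ∃ M, ∀ z ∈ annulus δ ×ˢ Set.Icc a b, reducedWave (slab a b) V z ^ 2 ≤ M := by
    intro a b hab hV
    obtain ⟨M, hM⟩ := (isCompact_annulus_prod δ a b).exists_bound_of_continuousOn
      (((continuousOn_reducedWave hab hV).pow 2).mono (annulus_prod_subset_slab hδ))
    exact ⟨M, fun z hz => (le_abs_self _).trans (hM z hz)⟩
  obtain ⟨M₁, hM₁⟩ := bound (by norm_num) h1
  obtain ⟨M₂, hM₂⟩ := bound (by norm_num) h2
  set m : ℝ := M₁ * volume.real (annulus δ ×ˢ Set.Icc (-2 : ℝ) 0)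
    + M₂ * volume.real (annulus δ ×ˢ Set.Icc (0 : ℝ) 2) with hm
  set B : ℝ := 1 / (4 * c₁ * δ ^ 6) + 2 / (c₁ * δ ^ 9) with hB
  have hB0 : 0 < B := by positivity
  set B₂ : ℝ := 1 / (8 * c₁ ^ 2 * δ ^ 6) with hB₂
  have key : ∀ τ : ℝ, 1 ≤ τ → 32 ≤ τ * c₁ ^ 2 →
      Cq * (2 * (B / δ ^ 2) * √(Real.pi / (2 * τ)) + B₂ / τ) ≤ 1 / 2 →
      κ * Real.exp (2 * τ * (c₃ - c₂)) ≤ B / δ ^ 2 * (2 * m) := by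
    intro τ hτ hτc hsmall
    have hτ0 : 0 < τ := by linarith
    obtain ⟨hU, hT⟩ := two_slab_estimate hδ hδc h1 h2 hsupp hbd1 hbd2 hτ hτc rfl rfl
    have R1 := integral_reducedWave_le hδ (by norm_num) hτ0 h1 hp hCq hQ1 hM₁
    have R2 := integral_reducedWave_le hδ (by norm_num) hτ0 h2 hp hCq hQ2 hM₂
    set Y := ∫ x in annulus δ, weightedSource τ c₂ p x with hY
    have hYT : δ ^ 2 * Y ≤ ∫ x in annulus δ, carlemanWeight τ ‖x‖ 0 *
        lieD (slab (-2) 0) eulerField V (x, 0) ^ 2 := by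
      rw [hY, ← integral_const_mul]
      refine setIntegral_mono_on ((integrableOn_weightedSource hp).const_mul _) ?_
        (isClosed_annulus δ).measurableSet fun x hx => ?_
      · refine ContinuousOn.integrableOn_compact (isCompact_annulus δ) ?_
        have cE := (ContDiffOn.lieD (uniqueDiffOn_slab (by norm_num)) contDiff_eulerField
          h1).continuousOn
        refine ContinuousOn.mul ?_ ((cE.comp (f := fun x : Space3 => (x, (0 : ℝ))) (by fun_prop)
          fun x hx => ⟨norm_pos_iff.1 (hδ.trans_le hx.1), by simp⟩).pow 2)
        unfold carlemanWeight
        fun_prop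
      · by_cases hcx : c₂ < 4 * ‖x‖ ^ 2
        · rw [weightedSource_of_lt hcx, hchar x hx.2 hcx, carlemanWeight,
            show 2 * τ * (4 * ‖x‖ ^ 2 - 0 ^ 2) = 8 * τ * ‖x‖ ^ 2 by ring]
          have : δ ^ 2 ≤ ‖x‖ ^ 2 := pow_le_pow_left₀ hδ.le hx.1 2
          have h0 : 0 ≤ Real.exp (8 * τ * ‖x‖ ^ 2) * p x ^ 2 := by positivity
          nlinarith
        · rw [weightedSource, Set.indicator_of_notMem (show x ∉ {x : Space3 | c₂ < 4 * ‖x‖ ^ 2}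
            from hcx), mul_zero]
          exact mul_nonneg (carlemanWeight_pos _ _ _).le (sq_nonneg _)
    have hlow' := hlow τ hτ0
    rw [← hY] at hlow'
    set I₁ := ∫ z in annulus δ ×ˢ Set.Icc (-2) 0,
        carlemanWeight τ ‖z.1‖ z.2 * reducedWave (slab (-2) 0) V z ^ 2
    set I₂ := ∫ z in annulus δ ×ˢ Set.Icc 0 2,
        carlemanWeight τ ‖z.1‖ z.2 * reducedWave (slab 0 2) V z ^ 2
    set U₁ := ∫ z in annulus δ ×ˢ Set.Icc (-2) 0, carlemanWeight τ ‖z.1‖ z.2 * V z ^ 2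
    set U₂ := ∫ z in annulus δ ×ˢ Set.Icc 0 2, carlemanWeight τ ‖z.1‖ z.2 * V z ^ 2
    have hI0 : 0 ≤ I₁ + I₂ := add_nonneg
      (integral_nonneg fun z => mul_nonneg (carlemanWeight_pos _ _ _).le (sq_nonneg _))
      (integral_nonneg fun z => mul_nonneg (carlemanWeight_pos _ _ _).le (sq_nonneg _))
    have hYI : Y ≤ B / δ ^ 2 * (I₁ + I₂) := by
      rw [div_mul_eq_mul_div, le_div_iff₀ (by positivity), mul_comm]
      exact hYT.trans hT
    have hI : I₁ + I₂ ≤ 1 / 2 * (I₁ + I₂) + m * Real.exp (2 * τ * c₂) := by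
      calc I₁ + I₂ ≤ Cq * (2 * Y * √(Real.pi / (2 * τ)) + (U₁ + U₂))
            + m * Real.exp (2 * τ * c₂) := by linarith
        _ ≤ Cq * (2 * (B / δ ^ 2 * (I₁ + I₂)) * √(Real.pi / (2 * τ)) + B₂ / τ * (I₁ + I₂))
            + m * Real.exp (2 * τ * c₂) := by gcongr
        _ = Cq * (2 * (B / δ ^ 2) * √(Real.pi / (2 * τ)) + B₂ / τ) * (I₁ + I₂)
            + m * Real.exp (2 * τ * c₂) := by ring
        _ ≤ _ := by gcongr
    have hexp : Real.exp (2 * τ * c₃) = Real.exp (2 * τ * (c₃ - c₂)) * Real.exp (2 * τ * c₂) := by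
      rw [← Real.exp_add]; ring_nf
    refine le_of_mul_le_mul_right ?_ (Real.exp_pos (2 * τ * c₂))
    calc κ * Real.exp (2 * τ * (c₃ - c₂)) * Real.exp (2 * τ * c₂) ≤ Y := by
          rw [mul_assoc, ← hexp]; exact hlow'
      _ ≤ B / δ ^ 2 * (I₁ + I₂) := hYI
      _ ≤ B / δ ^ 2 * (2 * (m * Real.exp (2 * τ * c₂))) := by gcongr; linarith
      _ = _ := by ring
  have t1 : Filter.Tendsto (fun τ : ℝ =>
      Cq * (2 * (B / δ ^ 2) * √(Real.pi / (2 * τ)) + B₂ / τ)) Filter.atTop (nhds 0) := by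
    have t2 : Filter.Tendsto (fun τ : ℝ => √(Real.pi / (2 * τ))) Filter.atTop (nhds 0) := by
      have : Filter.Tendsto (fun τ : ℝ => Real.pi / (2 * τ)) Filter.atTop (nhds 0) :=
        tendsto_const_nhds.div_atTop (Filter.tendsto_id.const_mul_atTop (by norm_num))
      simpa using this.sqrt
    have t3 : Filter.Tendsto (fun τ : ℝ => B₂ / τ) Filter.atTop (nhds 0) :=
      tendsto_const_nhds.div_atTop Filter.tendsto_id
    simpa using ((t2.const_mul (2 * (B / δ ^ 2))).add t3).const_mul Cq
  have t4 : Filter.Tendsto (fun τ : ℝ => κ * Real.exp (2 * τ * (c₃ - c₂))) Filter.atTop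
      Filter.atTop := by
    refine (Real.tendsto_exp_atTop.comp ?_).const_mul_atTop hκ
    exact (Filter.tendsto_id.const_mul_atTop (by norm_num)).atTop_mul_const (by linarith)
  obtain ⟨τ, hτ1, hτ2, hτ3, hτ4⟩ := ((Filter.eventually_ge_atTop (1 : ℝ)).and
    (((Filter.eventually_ge_atTop (32 / c₁ ^ 2)).and
      ((t1.eventually_le_const (by norm_num : (0 : ℝ) < 1 / 2)).and
        (t4.eventually_gt_atTop (B / δ ^ 2 * (2 * m))))))).exists
  exact absurd (key τ hτ1 (by rwa [div_le_iff₀ (by positivity)] at hτ2) hτ3)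
    (not_le.2 hτ4)

end Decay

/-! ### The pointwise form of the equation -/

section WeakForm

variable {E : Type*} [NormedAddCommGroup E] [NormedSpace ℝ E]

theorem deriv_line_eventuallyEq {u : E → ℝ} {z : E} (hu : ContDiffAt ℝ 2 u z) (v : E) :
    deriv (fun s : ℝ => u (z + s • v)) =ᶠ[nhds 0] fun s => fderiv ℝ u (z + s • v) v := by
  have hev : ∀ᶠ y in nhds z, ContDiffAt ℝ 2 u y := hu.eventually (by simp)
  have hc : Filter.Tendsto (fun s : ℝ => z + s • v) (nhds 0) (nhds z) := by
    have : Continuous fun s : ℝ => z + s • v := by fun_prop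
    simpa using this.tendsto 0
  filter_upwards [hc.eventually hev] with s hs
  have hl : HasDerivAt (fun h : ℝ => z + h • v) v s := by
    simpa using ((hasDerivAt_id s).smul_const v).const_add z
  exact ((hs.differentiableAt (by norm_num)).hasFDerivAt.comp_hasDerivAt s hl).deriv

theorem differentiableAt_fderiv_apply {u : E → ℝ} {z : E} (hu : ContDiffAt ℝ 2 u z) (v : E) :
    DifferentiableAt ℝ (fun y => fderiv ℝ u y v) z :=
  ((hu.fderiv_right (m := 1) (by norm_num)).differentiableAt (by norm_num)).clm_apply
    (differentiableAt_const v)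

theorem dir2_eq {u : E → ℝ} {z : E} (hu : ContDiffAt ℝ 2 u z) (v : E) :
    dir2 u z v = fderiv ℝ (fun y => fderiv ℝ u y v) z v := by
  have hl : HasDerivAt (fun h : ℝ => z + h • v) v 0 := by
    simpa using ((hasDerivAt_id (0 : ℝ)).smul_const v).const_add z
  have hd : HasFDerivAt (fun y => fderiv ℝ u y v) (fderiv ℝ (fun y => fderiv ℝ u y v) z)
      (z + (0 : ℝ) • v) := by
    simpa using (differentiableAt_fderiv_apply hu v).hasFDerivAt
  rw [dir2, iteratedDeriv_succ, iteratedDeriv_one, (deriv_line_eventuallyEq hu v).deriv_eq]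
  exact (hd.comp_hasDerivAt (0 : ℝ) hl).deriv

theorem continuousOn_dir2 {u : E → ℝ} {U : Set E} (hU : IsOpen U) (hu : ContDiffOn ℝ 2 u U)
    (v : E) : ContinuousOn (fun z => dir2 u z v) U := by
  have h1 : ContDiffOn ℝ 1 (fun y => fderiv ℝ u y v) U :=
    (hu.fderiv_of_isOpen hU (by norm_num)).clm_apply contDiffOn_const
  have h2 : ContDiffOn ℝ 0 (fun z => fderiv ℝ (fun y => fderiv ℝ u y v) z v) U :=
    (h1.fderiv_of_isOpen hU (by norm_num)).clm_apply contDiffOn_const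
  exact h2.continuousOn.congr fun z hz => dir2_eq (hu.contDiffAt (hU.mem_nhds hz)) v

theorem continuous_mul_of_tsupport_subset {X : Type*} [TopologicalSpace X] {u χ : X → ℝ}
    {U : Set X} (hU : IsOpen U)
    (hu : ContinuousOn u U) (hχ : Continuous χ) (hs : tsupport χ ⊆ U) :
    Continuous fun z => u z * χ z := by
  refine continuous_of_tsupport fun z hz => ?_
  have hz' : z ∈ tsupport χ := tsupport_mul_subset_right hz
  exact (hu.continuousAt (hU.mem_nhds (hs hz'))).mul hχ.continuousAt

theorem integrable_mul_of_tsupport_subset {X : Type*} [TopologicalSpace X]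
    [MeasurableSpace X] [OpensMeasurableSpace X] {μ : Measure X} [IsFiniteMeasureOnCompacts μ]
    {u χ : X → ℝ} {U : Set X} (hU : IsOpen U)
    (hu : ContinuousOn u U) (hχ : Continuous χ) (hc : HasCompactSupport χ) (hs : tsupport χ ⊆ U) :
    Integrable (fun z => u z * χ z) μ :=
  (continuous_mul_of_tsupport_subset hU hu hχ hs).integrable_of_hasCompactSupport hc.mul_left

variable [MeasurableSpace E] [BorelSpace E] {μ : Measure E} [μ.IsAddHaarMeasure]

theorem integrable_mul_dir2 {u χ : E → ℝ} {U : Set E} (hU : IsOpen U)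
    (hu : ContinuousOn u U) (hχ : ContDiff ℝ 2 χ) (hc : HasCompactSupport χ)
    (hs : tsupport χ ⊆ U) (v : E) : Integrable (fun z => u z * dir2 χ z v) μ := by
  have hχ' : ContDiff ℝ 1 fun z => fderiv ℝ χ z v :=
    (hχ.fderiv_right (by norm_num)).clm_apply contDiff_const
  simp_rw [dir2_eq hχ.contDiffAt v]
  exact integrable_mul_of_tsupport_subset hU hu
    ((hχ'.continuous_fderiv (by norm_num)).clm_apply continuous_const)
    ((hc.fderiv_apply ℝ v).fderiv_apply ℝ v)
    ((tsupport_fderiv_apply_subset ℝ v).trans ((tsupport_fderiv_apply_subset ℝ v).trans hs))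

variable [FiniteDimensional ℝ E]

theorem integral_mul_fderiv_of_tsupport_subset {u χ : E → ℝ} {U : Set E} (hU : IsOpen U)
    (hu : ContDiffOn ℝ 1 u U) (hχ : ContDiff ℝ 1 χ) (hc : HasCompactSupport χ)
    (hs : tsupport χ ⊆ U) (v : E) :
    ∫ z, u z * fderiv ℝ χ z v ∂μ = -∫ z, fderiv ℝ u z v * χ z ∂μ := by
  have hχ' : Continuous fun z => fderiv ℝ χ z v :=
    (hχ.continuous_fderiv (by norm_num)).clm_apply continuous_const
  have hs' : tsupport (fun z => fderiv ℝ χ z v) ⊆ U := (tsupport_fderiv_apply_subset ℝ v).trans hs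
  exact integral_bilinear_fderiv_right_eq_neg_left_of_integrable (B := ContinuousLinearMap.mul ℝ ℝ)
    (integrable_mul_of_tsupport_subset hU
      ((hu.continuousOn_fderiv_of_isOpen hU (by norm_num)).clm_apply continuousOn_const)
      hχ.continuous hc hs)
    (integrable_mul_of_tsupport_subset hU hu.continuousOn hχ' (hc.fderiv_apply ℝ v) hs')
    (integrable_mul_of_tsupport_subset hU hu.continuousOn hχ.continuous hc hs)
    (fun z hz => (hu.contDiffAt (hU.mem_nhds (hs hz))).differentiableAt (by norm_num))
    (fun z _ => hχ.contDiffAt.differentiableAt (by norm_num))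

theorem integral_mul_dir2 {u χ : E → ℝ} {U : Set E} (hU : IsOpen U)
    (hu : ContDiffOn ℝ 2 u U) (hχ : ContDiff ℝ 2 χ) (hc : HasCompactSupport χ)
    (hs : tsupport χ ⊆ U) (v : E) :
    ∫ z, u z * dir2 χ z v ∂μ = ∫ z, dir2 u z v * χ z ∂μ := by
  have hχ' : ContDiff ℝ 1 fun z => fderiv ℝ χ z v :=
    (hχ.fderiv_right (by norm_num)).clm_apply contDiff_const
  have hu' : ContDiffOn ℝ 1 (fun y => fderiv ℝ u y v) U :=
    (hu.fderiv_of_isOpen hU (by norm_num)).clm_apply contDiffOn_const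
  have hs' : tsupport (fun z => fderiv ℝ χ z v) ⊆ U := (tsupport_fderiv_apply_subset ℝ v).trans hs
  simp_rw [dir2_eq hχ.contDiffAt v]
  rw [integral_mul_fderiv_of_tsupport_subset hU (hu.of_le (by norm_num)) hχ'
    (hc.fderiv_apply ℝ v) hs', integral_mul_fderiv_of_tsupport_subset hU hu'
    (hχ.of_le (by norm_num)) hc hs, neg_neg]
  refine integral_congr_ae (Filter.Eventually.of_forall fun z => ?_)
  by_cases hz : z ∈ tsupport χ
  · simp only [dir2_eq (hu.contDiffAt (hU.mem_nhds (hs hz))) v]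
  · simp [image_eq_zero_of_notMem_tsupport hz]

end WeakForm

theorem isOpen_regionK : IsOpen regionK := by
  have h1 : IsOpen {r : Space3 × ℝ | r.1 ≠ 0} := isOpen_ne_fun continuous_fst continuous_const
  have h2 : IsOpen {r : Space3 × ℝ | -‖r.1‖ < r.2} := isOpen_lt (by fun_prop) (by fun_prop)
  exact h1.inter h2

instance isAddHaarMeasure_space3_prod : (volume : Measure (Space3 × ℝ)).IsAddHaarMeasure :=
  Measure.prod.instIsAddHaarMeasure (volume : Measure Space3) (volume : Measure ℝ)

theorem continuousOn_waveOp3 {u : Space3 × ℝ → ℝ} {U : Set (Space3 × ℝ)} (hU : IsOpen U)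
    (hu : ContDiffOn ℝ 2 u U) : ContinuousOn (waveOp3 u) U :=
  (continuousOn_dir2 hU hu _).sub
    (continuousOn_finsetSum _ fun _ _ => continuousOn_dir2 hU hu _)

theorem integral_mul_waveOp3 {u χ : Space3 × ℝ → ℝ} {U : Set (Space3 × ℝ)} (hU : IsOpen U)
    (hu : ContDiffOn ℝ 2 u U) (hχ : ContDiff ℝ 2 χ) (hc : HasCompactSupport χ)
    (hs : tsupport χ ⊆ U) :
    ∫ z, u z * waveOp3 χ z = ∫ z, waveOp3 u z * χ z := by
  have key := fun v : Space3 × ℝ => integral_mul_dir2 (μ := volume) hU hu hχ hc hs v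
  have i1 : ∀ v : Space3 × ℝ, Integrable fun z => dir2 u z v * χ z := fun v =>
    integrable_mul_of_tsupport_subset hU (continuousOn_dir2 hU hu v) hχ.continuous hc hs
  have i2 := fun v : Space3 × ℝ => integrable_mul_dir2 (μ := volume) hU hu.continuousOn hχ hc hs v
  simp only [waveOp3, mul_sub, sub_mul, Finset.mul_sum, Finset.sum_mul]
  rw [integral_sub (i2 _) (integrable_finsetSum _ fun i _ => i2 _),
    integral_sub (i1 _) (integrable_finsetSum _ fun i _ => i1 _),
    integral_finsetSum _ fun i _ => i2 _, integral_finsetSum _ fun i _ => i1 _]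
  simp only [key]

/-- A weak solution of the equation satisfies it up to the source bound wherever it is `C²`. -/
theorem abs_waveOp3_add_le {p q : Space3 → ℝ} (hp : Continuous p) (hq : Continuous q)
    {f : Space3 × ℝ → ℝ} (hf : Measurable f) {C : ℝ} (hC : ∀ r ∈ regionK, |f r| ≤ C)
    {α : Space3 × ℝ → ℝ} {U : Set (Space3 × ℝ)} (hU : IsOpen U) (hUK : U ⊆ regionK)
    (hα : ContDiffOn ℝ 2 α U)
    (hpde : ∀ χ : Space3 × ℝ → ℝ, ContDiff ℝ (⊤ : ℕ∞) χ →
      HasCompactSupport χ → tsupport χ ⊆ regionK →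
      (∫ r in regionK, α r * (waveOp3 χ r + q r.1 * χ r)) = ∫ r in regionK, p r.1 * f r * χ r)
    {z : Space3 × ℝ} (hz : z ∈ U) :
    |waveOp3 α z + q z.1 * α z| ≤ C * |p z.1| := by
  have hC0 : 0 ≤ C := (abs_nonneg _).trans (hC z (hUK hz))
  have hKm := isOpen_regionK.measurableSet
  set g : Space3 × ℝ → ℝ := fun r => waveOp3 α r + q r.1 * α r with hg
  set F : Space3 × ℝ → ℝ := fun r => p r.1 * regionK.indicator f r with hF
  have hgc : ContinuousOn g U := (continuousOn_waveOp3 hU hα).add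
    (ContinuousOn.mul (by fun_prop) hα.continuousOn)
  have hFb : ∀ r, |F r| ≤ C * |p r.1| := fun r => by
    rw [hF, abs_mul, mul_comm]
    gcongr
    by_cases hr : r ∈ regionK
    · rw [Set.indicator_of_mem hr]; exact hC r hr
    · rw [Set.indicator_of_notMem hr, abs_zero]; exact hC0
  have hFi : LocallyIntegrable F := by
    have hb : LocallyIntegrable fun r : Space3 × ℝ => C * |p r.1| :=
      Continuous.locallyIntegrable (by fun_prop)
    refine hb.mono ?_ (Filter.Eventually.of_forall fun r => ?_)
    · exact (Measurable.mul (by fun_prop) (hf.indicator hKm)).aestronglyMeasurable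
    · rw [Real.norm_eq_abs, Real.norm_eq_abs]
      exact (hFb r).trans (le_abs_self _)
  have hae : ∀ᵐ r, r ∈ U → g r - F r = 0 := by
    refine hU.ae_eq_zero_of_integral_contDiff_smul_eq_zero
      ((hgc.locallyIntegrableOn hU.measurableSet).sub (hFi.locallyIntegrableOn U))
      fun χ hχ hc hs => ?_
    have hχ2 : ContDiff ℝ 2 χ := hχ.of_le (by norm_cast)
    have hzero : ∀ r, r ∉ regionK → χ r = 0 := fun r hr =>
      image_eq_zero_of_notMem_tsupport fun h => hr (hUK (hs h))
    have e := hpde χ hχ hc (hs.trans hUK)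
    have hwχ : ∀ r, r ∉ regionK → waveOp3 χ r = 0 := fun r hr => by
      have hd : ∀ v : Space3 × ℝ, dir2 χ r v = 0 := fun v => by
        rw [dir2_eq hχ2.contDiffAt v]
        exact image_eq_zero_of_notMem_tsupport (f := fun z => fderiv ℝ (fun y => fderiv ℝ χ y v) z v)
          fun h => hr (hUK (hs (((tsupport_fderiv_apply_subset ℝ v).trans
            (tsupport_fderiv_apply_subset ℝ v)) h)))
      simp [waveOp3, hd]
    rw [setIntegral_eq_integral_of_forall_compl_eq_zero fun r hr => by
        rw [hwχ r hr, hzero r hr]; simp,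
      setIntegral_eq_integral_of_forall_compl_eq_zero fun r hr => by
        rw [hzero r hr]; simp] at e
    have i1 : Integrable fun r => g r * χ r :=
      integrable_mul_of_tsupport_subset hU hgc hχ.continuous hc hs
    have i2 : Integrable fun r => F r * χ r := by
      have := hFi.integrable_smul_left_of_hasCompactSupport hχ.continuous hc
      simpa [mul_comm] using this
    have i3 : Integrable fun r => α r * waveOp3 χ r := by
      have i := fun v : Space3 × ℝ =>
        integrable_mul_dir2 (μ := volume) hU hα.continuousOn hχ2 hc hs v
      simp only [waveOp3, mul_sub, Finset.mul_sum]
      exact (i _).sub (integrable_finsetSum _ fun _ _ => i _)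
    have i4 : Integrable fun r => q r.1 * α r * χ r :=
      integrable_mul_of_tsupport_subset hU (ContinuousOn.mul (by fun_prop) hα.continuousOn)
        hχ.continuous hc hs
    have i5 : Integrable fun r => waveOp3 α r * χ r :=
      integrable_mul_of_tsupport_subset hU (continuousOn_waveOp3 hU hα) hχ.continuous hc hs
    have e1 : ∫ r, g r * χ r = ∫ r, F r * χ r := by
      calc ∫ r, g r * χ r = ∫ r, (waveOp3 α r * χ r + q r.1 * α r * χ r) := by
            simp only [hg, add_mul]
        _ = ∫ r, (α r * waveOp3 χ r + q r.1 * α r * χ r) := by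
            rw [integral_add i5 i4, integral_add i3 i4, integral_mul_waveOp3 hU hα hχ2 hc hs]
        _ = ∫ r, α r * (waveOp3 χ r + q r.1 * χ r) := by
            congr 1; ext r; ring
        _ = ∫ r, p r.1 * f r * χ r := e
        _ = ∫ r, F r * χ r := by
            congr 1; ext r
            by_cases hr : r ∈ regionK
            · simp only [hF, Set.indicator_of_mem hr]
            · rw [hzero r hr, mul_zero, mul_zero]
    have : ∀ r, χ r • (g r - F r) = g r * χ r - F r * χ r := fun r => by
      rw [smul_eq_mul]; ring
    simp_rw [this]
    rw [integral_sub i1 i2, e1, sub_self]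
  by_contra hcon
  have hopen : IsOpen (U ∩ (fun r => |g r| - C * |p r.1|) ⁻¹' Set.Ioi 0) :=
    (hgc.abs.sub (by fun_prop)).isOpen_inter_preimage hU isOpen_Ioi
  refine (hopen.measure_pos volume ⟨z, hz, by simpa using not_le.1 hcon⟩).ne' ?_
  refine measure_mono_null ?_ hae
  rintro r ⟨hr, hr'⟩ h
  have := hFb r
  rw [← sub_eq_zero.1 (h hr)] at this
  simp only [Set.mem_preimage, Set.mem_Ioi] at hr'
  linarith

/-! ### Characteristic coordinates -/

section CharacteristicCoordinates

/-- The passage from characteristic coordinates `(x, s)` to space-time: `(x, s + ‖x‖)`. -/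
noncomputable def charMap (z : Space3 × ℝ) : Space3 × ℝ := (z.1, z.2 + ‖z.1‖)

/-- The derivative of `g` along the vector field `X`. -/
noncomputable def along (X : Space3 × ℝ → Space3 × ℝ) (g : Space3 × ℝ → ℝ) (w : Space3 × ℝ) : ℝ :=
  fderiv ℝ g w (X w)

/-- The image of the Euler field under the characteristic coordinate change. -/
noncomputable def coneField (w : Space3 × ℝ) : Space3 × ℝ := (w.1, ‖w.1‖)

variable {z w : Space3 × ℝ} {g u : Space3 × ℝ → ℝ} {X Y : Space3 × ℝ → Space3 × ℝ}

theorem contDiffAt_norm_fst {n : WithTop ℕ∞} (hw : w.1 ≠ 0) :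
    ContDiffAt ℝ n (fun y : Space3 × ℝ => ‖y.1‖) w :=
  contDiffAt_fst.norm ℝ hw

theorem contDiffAt_charMap {n : WithTop ℕ∞} (hz : z.1 ≠ 0) : ContDiffAt ℝ n charMap z :=
  contDiffAt_fst.prodMk (contDiffAt_snd.add (contDiffAt_norm_fst hz))

theorem contDiffAt_coneField {n : WithTop ℕ∞} (hw : w.1 ≠ 0) : ContDiffAt ℝ n coneField w :=
  contDiffAt_fst.prodMk (contDiffAt_norm_fst hw)

theorem fderiv_norm_fst (hw : w.1 ≠ 0) (v : Space3 × ℝ) :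
    fderiv ℝ (fun y : Space3 × ℝ => ‖y.1‖) w v = inner ℝ w.1 v.1 / ‖w.1‖ := by
  have h1 : HasFDerivAt (fun y : Space3 × ℝ => ‖y.1‖ ^ 2) _ w :=
    (hasStrictFDerivAt_norm_sq w.1).hasFDerivAt.comp w
      (ContinuousLinearMap.fst ℝ Space3 ℝ).hasFDerivAt
  have h2 := (contDiffAt_norm_fst (n := 1) hw).differentiableAt (by norm_num) |>.hasFDerivAt.pow 2
  have h3 := DFunLike.congr_fun (h1.unique h2) v
  have hn : ‖w.1‖ ≠ 0 := norm_ne_zero_iff.2 hw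
  simp at h3
  field_simp
  linarith

theorem fderiv_charMap (hz : z.1 ≠ 0) (v : Space3 × ℝ) :
    fderiv ℝ charMap z v = (v.1, v.2 + inner ℝ z.1 v.1 / ‖z.1‖) := by
  have h := (hasFDerivAt_fst (𝕜 := ℝ) (p := z)).prodMk ((hasFDerivAt_snd (𝕜 := ℝ) (p := z)).add
    ((contDiffAt_norm_fst (n := 1) hz).differentiableAt (by norm_num)).hasFDerivAt)
  have := h.fderiv
  change fderiv ℝ charMap z = _ at this
  rw [this]
  simp [fderiv_norm_fst hz]

theorem ContDiffAt.along {n : ℕ} (hg : ContDiffAt ℝ (n + 1) g w) (hX : ContDiffAt ℝ n X w) :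
    ContDiffAt ℝ n (along X g) w :=
  (hg.fderiv_right le_rfl).clm_apply hX

theorem lieD_eventuallyEq_along {S : Set (Space3 × ℝ)} (hS : S ∈ nhds z) (hz : z.1 ≠ 0)
    {F : Space3 × ℝ → ℝ} (hF : F =ᶠ[nhds z] g ∘ charMap) (hg : ContDiffAt ℝ 1 g (charMap z))
    (hX : ∀ y : Space3 × ℝ, y.1 ≠ 0 → fderiv ℝ charMap y (X y) = Y (charMap y)) :
    lieD S X F =ᶠ[nhds z] along Y g ∘ charMap := by
  have hgev := (contDiffAt_charMap (n := 1) hz).continuousAt.eventually (hg.eventually (by simp))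
  have hne : ∀ᶠ y : Space3 × ℝ in nhds z, y.1 ≠ 0 :=
    continuousAt_fst.eventually_ne hz
  filter_upwards [lieD_eventuallyEq hS X F, hF.eventuallyEq_nhds, hgev, hne] with y h1 h2 h3 h4
  rw [h1, h2.fderiv_eq, fderiv_comp y (h3.differentiableAt (by norm_num))
    ((contDiffAt_charMap (n := 1) h4).differentiableAt (by norm_num))]
  simp [along, hX y h4]

theorem fderiv_charMap_eulerField (hz : z.1 ≠ 0) :
    fderiv ℝ charMap z (eulerField z) = coneField (charMap z) := by
  have hn : ‖z.1‖ ≠ 0 := norm_ne_zero_iff.2 hz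
  rw [fderiv_charMap hz]
  simp only [eulerField, coneField, charMap, real_inner_self_eq_norm_sq]
  congr 1
  field_simp
  ring

theorem fderiv_charMap_timeField (hz : z.1 ≠ 0) :
    fderiv ℝ charMap z (timeField z) = timeField (charMap z) := by
  rw [fderiv_charMap hz]
  simp [timeField]

theorem fderiv_charMap_rotField (k : Fin 3) (hz : z.1 ≠ 0) :
    fderiv ℝ charMap z (rotField k z) = rotField k (charMap z) := by
  rw [fderiv_charMap hz]
  simp [rotField, charMap, inner_rotGen]

theorem along_along (hg : ContDiffAt ℝ 2 g w) (hY : DifferentiableAt ℝ Y w) :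
    along X (along Y g) w
      = fderiv ℝ (fderiv ℝ g) w (X w) (Y w) + fderiv ℝ g w (fderiv ℝ Y w (X w)) := by
  have h := ((hg.fderiv_right (m := 1) (by norm_num)).differentiableAt
    (by norm_num)).hasFDerivAt.clm_apply hY.hasFDerivAt
  have := h.fderiv
  change fderiv ℝ (along Y g) w = _ at this
  rw [along, this]
  simp [add_comm]

theorem along_mul (hu : DifferentiableAt ℝ u w) (hg : DifferentiableAt ℝ g w) :
    along X (fun y => u y * g y) w = along X u w * g w + u w * along X g w := by
  rw [along, fderiv_fun_mul hu hg]
  simp [along]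
  ring

theorem along_add (hu : DifferentiableAt ℝ u w) (hg : DifferentiableAt ℝ g w) :
    along X (fun y => u y + g y) w = along X u w + along X g w := by
  rw [along, fderiv_fun_add hu hg]
  simp [along]

theorem along_congr {g' : Space3 × ℝ → ℝ} (h : g =ᶠ[nhds w] g') : along X g w = along X g' w := by
  rw [along, h.fderiv_eq, along]

theorem along_coneField_norm (hw : w.1 ≠ 0) :
    along coneField (fun y => ‖y.1‖) w = ‖w.1‖ := by
  have hn : ‖w.1‖ ≠ 0 := norm_ne_zero_iff.2 hw
  rw [along, fderiv_norm_fst hw]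
  simp only [coneField, real_inner_self_eq_norm_sq]
  field_simp

theorem along_timeField_norm (hw : w.1 ≠ 0) : along timeField (fun y => ‖y.1‖) w = 0 := by
  rw [along, fderiv_norm_fst hw]
  simp [timeField]

theorem along_rotField_norm (k : Fin 3) (hw : w.1 ≠ 0) :
    along (rotField k) (fun y => ‖y.1‖) w = 0 := by
  rw [along, fderiv_norm_fst hw]
  simp [rotField, inner_rotGen]

theorem sum_rotGen_rotGen (x : Space3) : ∑ k, rotGen k (rotGen k x) = (-2 : ℝ) • x := by
  ext i
  fin_cases i <;> simp [rotGen, Fin.sum_univ_three] <;> ring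

/-- Decomposition of a trace into its radial and rotational parts. -/
theorem sum_rotGen_bilinear (B : Space3 → Space3 → ℝ)
    (h1 : ∀ x y z, B (x + y) z = B x z + B y z) (h2 : ∀ x y z, B z (x + y) = B z x + B z y)
    (h3 : ∀ (c : ℝ) x y, B (c • x) y = c * B x y) (h4 : ∀ (c : ℝ) x y, B x (c • y) = c * B x y)
    (h5 : ∀ x y, B x y = B y x) (x : Space3) :
    B x x + ∑ k, B (rotGen k x) (rotGen k x)
      = ‖x‖ ^ 2 * ∑ i, B (EuclideanSpace.single i 1) (EuclideanSpace.single i 1) := by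
  have hx : x = x 0 • EuclideanSpace.single 0 1 + (x 1 • EuclideanSpace.single 1 1
      + x 2 • EuclideanSpace.single 2 1) := by
    ext i; fin_cases i <;> simp
  have hr : ∀ k, rotGen k x = x k • EuclideanSpace.single (k + 1) 1
      + (-x (k + 1)) • EuclideanSpace.single k 1 := fun k => by
    simp [rotGen, sub_eq_add_neg]
  have hn : ‖x‖ ^ 2 = x 0 ^ 2 + x 1 ^ 2 + x 2 ^ 2 := by
    rw [EuclideanSpace.norm_sq_eq]
    simp [Fin.sum_univ_three]
  have e1 : (1 : Fin 3) + 1 = 2 := rfl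
  have e2 : (2 : Fin 3) + 1 = 0 := rfl
  have e0 : (0 : Fin 3) + 1 = 1 := rfl
  rw [hn, Fin.sum_univ_three, Fin.sum_univ_three, hr, hr, hr, e0, e1, e2]
  rw [congrArg₂ B hx hx]
  simp only [h1, h2, h3, h4, h5 (EuclideanSpace.single 1 1) (EuclideanSpace.single 0 1),
    h5 (EuclideanSpace.single 2 1) (EuclideanSpace.single 0 1),
    h5 (EuclideanSpace.single 2 1) (EuclideanSpace.single 1 1)]
  ring

theorem fderiv_coneField_self (hw : w.1 ≠ 0) :
    fderiv ℝ coneField w (coneField w) = coneField w := by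
  have h := (hasFDerivAt_fst (𝕜 := ℝ) (p := w)).prodMk
    ((contDiffAt_norm_fst (n := 1) hw).differentiableAt (by norm_num)).hasFDerivAt
  have := h.fderiv
  change fderiv ℝ coneField w = _ at this
  rw [this]
  have hn := along_coneField_norm hw
  rw [along] at hn
  simp [hn]
  rfl

/-- The reduced wave operator of `r α` in characteristic coordinates is `r³ □α`. -/
theorem reducedWave_eq {S : Set (Space3 × ℝ)} (hS : S ∈ nhds z) (hz : z.1 ≠ 0)
    {V α : Space3 × ℝ → ℝ} (hα : ContDiffAt ℝ 2 α (charMap z))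
    (hV : V =ᶠ[nhds z] (fun y => ‖y.1‖ * α y) ∘ charMap) :
    reducedWave S V z = ‖z.1‖ ^ 3 * waveOp3 α (charMap z) := by
  obtain ⟨w, hw⟩ : ∃ w, w = charMap z := ⟨_, rfl⟩
  have hw1 : w.1 = z.1 := by rw [hw]; rfl
  have hw0 : w.1 ≠ 0 := by rwa [hw1]
  rw [← hw] at hα ⊢
  have hr2 : ContDiffAt ℝ 2 (fun y : Space3 × ℝ => ‖y.1‖) w := contDiffAt_norm_fst hw0
  have hβ : ContDiffAt ℝ 2 (fun y => ‖y.1‖ * α y) w := hr2.mul hα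
  have hβ1 : ContDiffAt ℝ 1 (fun y => ‖y.1‖ * α y) w := hβ.of_le (by norm_num)
  have cE : ContDiffAt ℝ 1 coneField w := contDiffAt_coneField hw0
  have cT : ContDiffAt ℝ 1 timeField w := contDiff_timeField.contDiffAt
  have cR : ∀ k, ContDiffAt ℝ 1 (rotField k) w := fun k => (contDiff_rotField k).contDiffAt
  have aE := ContDiffAt.along (n := 1) (by norm_num; exact hβ) cE
  have aT := ContDiffAt.along (n := 1) (by norm_num; exact hβ) cT
  have aR := fun k => ContDiffAt.along (n := 1) (by norm_num; exact hβ) (cR k)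
  have tE := lieD_eventuallyEq_along hS hz hV (hw ▸ hβ1)
    (fun y hy => fderiv_charMap_eulerField hy)
  have tT := lieD_eventuallyEq_along hS hz hV (hw ▸ hβ1)
    (fun y hy => fderiv_charMap_timeField hy)
  have tR := fun k => lieD_eventuallyEq_along hS hz hV (hw ▸ hβ1)
    (fun y hy => fderiv_charMap_rotField k hy)
  have tEE := lieD_eventuallyEq_along hS hz tE (hw ▸ aE)
    (fun y hy => fderiv_charMap_eulerField hy)
  have tET := lieD_eventuallyEq_along hS hz tT (hw ▸ aT)
    (fun y hy => fderiv_charMap_eulerField hy)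
  have tRR := fun k => lieD_eventuallyEq_along hS hz (tR k) (hw ▸ aR k)
    (fun y hy => fderiv_charMap_rotField k hy)
  have hne : ∀ᶠ y : Space3 × ℝ in nhds w, y.1 ≠ 0 := continuousAt_fst.eventually_ne hw0
  have hαev : ∀ᶠ y in nhds w, ContDiffAt ℝ 2 α y := hα.eventually (by simp)
  have dr : ∀ y : Space3 × ℝ, y.1 ≠ 0 → DifferentiableAt ℝ (fun y : Space3 × ℝ => ‖y.1‖) y :=
    fun y hy => (contDiffAt_norm_fst (n := 1) hy).differentiableAt (by norm_num)
  have dα : DifferentiableAt ℝ α w := hα.differentiableAt (by norm_num)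
  have eE : along coneField (fun y => ‖y.1‖ * α y)
      =ᶠ[nhds w] fun y => ‖y.1‖ * α y + ‖y.1‖ * along coneField α y := by
    filter_upwards [hne, hαev] with y hy hy2
    rw [along_mul (dr y hy) (hy2.differentiableAt (by norm_num)), along_coneField_norm hy]
  have eT : along timeField (fun y => ‖y.1‖ * α y)
      =ᶠ[nhds w] fun y => ‖y.1‖ * along timeField α y := by
    filter_upwards [hne, hαev] with y hy hy2
    rw [along_mul (dr y hy) (hy2.differentiableAt (by norm_num)), along_timeField_norm hy,
      zero_mul, zero_add]
  have eR : ∀ k, along (rotField k) (fun y => ‖y.1‖ * α y)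
      =ᶠ[nhds w] fun y => ‖y.1‖ * along (rotField k) α y := fun k => by
    filter_upwards [hne, hαev] with y hy hy2
    rw [along_mul (dr y hy) (hy2.differentiableAt (by norm_num)), along_rotField_norm k hy,
      zero_mul, zero_add]
  have dE := (ContDiffAt.along (n := 1) (by norm_num; exact hα) cE).differentiableAt (by norm_num)
  have dT := (ContDiffAt.along (n := 1) (by norm_num; exact hα) cT).differentiableAt (by norm_num)
  have dR := fun k =>
    (ContDiffAt.along (n := 1) (by norm_num; exact hα) (cR k)).differentiableAt (by norm_num)
  have vE := tE.self_of_nhds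
  have vEE := tEE.self_of_nhds
  have vET := tET.self_of_nhds
  have vRR := fun k => (tRR k).self_of_nhds
  simp only [Function.comp_apply, ← hw] at vE vEE vET vRR
  rw [reducedWave, vE, vEE, vET, Finset.sum_congr rfl fun k _ => vRR k, eE.self_of_nhds,
    along_congr eE, along_congr eT, Finset.sum_congr rfl fun k _ => along_congr (eR k),
    along_add ((dr w hw0).fun_mul dα) ((dr w hw0).fun_mul dE), along_mul (dr w hw0) dα,
    along_mul (dr w hw0) dE, along_mul (dr w hw0) dT,
    Finset.sum_congr rfl fun k _ => along_mul (dr w hw0) (dR k)]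
  simp only [along_coneField_norm hw0, along_rotField_norm _ hw0, zero_mul, zero_add,
    ← Finset.mul_sum]
  rw [along_along hα (cE.differentiableAt (by norm_num)),
    along_along hα (cT.differentiableAt (by norm_num)),
    Finset.sum_congr rfl fun k _ => along_along hα ((cR k).differentiableAt (by norm_num)),
    fderiv_coneField_self hw0, waveOp3, dir2_eq hα,
    Finset.sum_congr rfl fun i _ => dir2_eq hα _]
  have hsymm : IsSymmSndFDerivAt ℝ α w := hα.isSymmSndFDerivAt (by simp)
  have hsnd : ∀ v, fderiv ℝ (fun y => fderiv ℝ α y v) w v = fderiv ℝ (fderiv ℝ α) w v v :=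
    fun v => by
      have := along_along (X := fun _ => v) (Y := fun _ => v) hα (differentiableAt_const v)
      exact this.trans (by simp)
  have hrot : ∀ k, fderiv ℝ (rotField k) w (rotField k w) = (rotGen k (rotGen k w.1), 0) :=
    fun k => by rw [(hasFDerivAt_rotField k w).fderiv]; simp [rotField]
  have htime : fderiv ℝ timeField w = 0 := (hasFDerivAt_const ((0, 1) : Space3 × ℝ) w).fderiv
  have hcone : coneField w = (w.1, 0) + ‖w.1‖ • ((0, 1) : Space3 × ℝ) := by
    simp [coneField]
  simp only [hsnd, hrot, htime, along, Finset.sum_add_distrib]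
  generalize hH : fderiv ℝ (fderiv ℝ α) w = H
  generalize fderiv ℝ α w = L
  have hHs : ∀ a b, H a b = H b a := fun a b => by rw [← hH]; exact hsymm a b
  have htr := sum_rotGen_bilinear (fun a b => H (ContinuousLinearMap.inl ℝ Space3 ℝ a)
    (ContinuousLinearMap.inl ℝ Space3 ℝ b))
    (fun a b c => by simp only [map_add, add_apply])
    (fun a b c => by simp only [map_add])
    (fun a b c => by simp only [map_smul, smul_apply, smul_eq_mul])
    (fun a b c => by simp only [map_smul, smul_eq_mul]) (fun a b => hHs _ _) w.1
  have hL : ∑ k, L (rotGen k (rotGen k w.1), 0) = -2 * L (w.1, 0) := by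
    calc ∑ k, L (rotGen k (rotGen k w.1), 0)
        = L (ContinuousLinearMap.inl ℝ Space3 ℝ (∑ k, rotGen k (rotGen k w.1))) := by
          rw [map_sum, map_sum]; rfl
      _ = -2 * L (w.1, 0) := by
          rw [sum_rotGen_rotGen, map_smul, map_smul]; rfl
  simp only [ContinuousLinearMap.inl_apply] at htr
  simp only [rotField, timeField, hL, hcone, map_add, map_smul, add_apply,
    smul_apply, smul_eq_mul, zero_apply, map_zero,
    hHs (0, 1) (w.1, 0), ← hw1]
  linear_combination (-‖w.1‖) * htr

end CharacteristicCoordinates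

/-! ### The localized solution -/

section Localization

variable {α : Space3 × ℝ → ℝ} {c : ℝ} {z w : Space3 × ℝ}

/-- The function `r α` in characteristic coordinates, cut off to `4‖x‖² - s² ≥ c`. -/
noncomputable def localized (c : ℝ) (α : Space3 × ℝ → ℝ) (z : Space3 × ℝ) : ℝ :=
  Real.smoothTransition ((4 * ‖z.1‖ ^ 2 - z.2 ^ 2 - c) / c) * ‖z.1‖ * α (charMap z)

theorem localized_eq_zero (hc : 0 < c) (hz : 4 * ‖z.1‖ ^ 2 - z.2 ^ 2 < c) :
    localized c α z = 0 := by
  rw [localized, Real.smoothTransition.zero_of_nonpos, zero_mul, zero_mul]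
  exact div_nonpos_of_nonpos_of_nonneg (by linarith) hc.le

theorem localized_eq (hc : 0 < c) (hz : 2 * c < 4 * ‖z.1‖ ^ 2 - z.2 ^ 2) :
    localized c α z = ‖z.1‖ * α (charMap z) := by
  rw [localized, Real.smoothTransition.one_of_one_le, one_mul]
  rw [le_div_iff₀ hc]
  linarith

theorem localized_eventuallyEq (hc : 0 < c) (hz : 2 * c < 4 * ‖z.1‖ ^ 2 - z.2 ^ 2) :
    localized c α =ᶠ[nhds z] (fun y => ‖y.1‖ * α y) ∘ charMap := by
  have : Continuous fun z : Space3 × ℝ => 4 * ‖z.1‖ ^ 2 - z.2 ^ 2 := by fun_prop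
  filter_upwards [this.continuousAt.eventually (lt_mem_nhds hz)] with y hy
  exact localized_eq hc hy

theorem charMap_mem_regionK (hx : z.1 ≠ 0) (hz : 0 < 4 * ‖z.1‖ ^ 2 - z.2 ^ 2) :
    charMap z ∈ regionK := by
  refine ⟨hx, ?_⟩
  have : |z.2| < 2 * ‖z.1‖ := abs_lt_of_sq_lt_sq (by linarith) (by positivity)
  have := (abs_lt.1 this).1
  simp only [charMap]
  linarith

theorem contDiffAt_cutoff_mul_norm {n : ℕ∞} (hx : z.1 ≠ 0) : ContDiffAt ℝ n (fun z : Space3 × ℝ =>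
    Real.smoothTransition ((4 * ‖z.1‖ ^ 2 - z.2 ^ 2 - c) / c) * ‖z.1‖) z := by
  have h := contDiffAt_norm_fst (n := n) hx
  refine ContDiffAt.mul (Real.smoothTransition.contDiffAt.comp z ?_) h
  exact (((contDiffAt_const.mul (h.pow 2)).sub (contDiffAt_snd.pow 2)).sub
    contDiffAt_const).div_const c

/-- Smoothness of the localized solution on a slab which the characteristic coordinate change
maps to a region of smoothness. -/
theorem contDiffOn_localized (hc : 0 < c) {a b : ℝ} {R : Set (Space3 × ℝ)}
    (hα : ContDiffOn ℝ 2 α (regionK ∩ R)) (hR : ∀ z ∈ slab a b, charMap z ∈ R) :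
    ContDiffOn ℝ 2 (localized c α) (slab a b) := by
  intro z hz
  have hx : z.1 ≠ 0 := hz.1
  have hψ : Continuous fun z : Space3 × ℝ => 4 * ‖z.1‖ ^ 2 - z.2 ^ 2 := by fun_prop
  rcases le_or_gt (4 * ‖z.1‖ ^ 2 - z.2 ^ 2) 0 with h0 | h0
  · have : localized c α =ᶠ[nhds z] fun _ => 0 := by
      filter_upwards [hψ.continuousAt.eventually (gt_mem_nhds (h0.trans_lt hc))] with y hy
      exact localized_eq_zero hc hy
    exact (contDiffAt_const.congr_of_eventuallyEq this).contDiffWithinAt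
  · refine (contDiffAt_cutoff_mul_norm (n := 2) hx).contDiffWithinAt.mul ?_
    have hK : ∀ᶠ y in nhds z, charMap y ∈ regionK :=
      (contDiffAt_charMap (n := 1) hx).continuousAt.eventually
        (isOpen_regionK.mem_nhds (charMap_mem_regionK hx h0))
    have h1 : ContDiffWithinAt ℝ 2 (fun y => α (charMap y)) (slab a b ∩ charMap ⁻¹' regionK) z :=
      (hα (charMap z) ⟨charMap_mem_regionK hx h0, hR z hz⟩).comp z
        (contDiffAt_charMap hx).contDiffWithinAt fun y hy => ⟨hy.2, hR y hy.1⟩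
    exact h1.mono_of_mem_nhdsWithin
      (Filter.inter_mem self_mem_nhdsWithin (mem_nhdsWithin_of_mem_nhds hK))

/-- Vanishing Cauchy data on the unit sphere make the function flat there. -/
theorem flatAt_of_cauchyData (hd : DifferentiableAt ℝ α w) (hw : ‖w.1‖ = 1)
    (h0 : ∀ᶠ t in nhds w.2, ∀ x : Space3, ‖x‖ = 1 → α (x, t) = 0)
    (hr : derivWithin (fun s : ℝ => α (s • w.1, w.2)) (Set.Iic 1) 1 = 0) : FlatAt α w := by
  refine ⟨h0.self_of_nhds w.1 hw, ?_⟩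
  have hw0 : w.1 ≠ 0 := norm_ne_zero_iff.1 (by rw [hw]; norm_num)
  have hrad : fderiv ℝ α w (w.1, 0) = 0 := by
    have hl : HasDerivAt (fun s : ℝ => (s • w.1, w.2)) (w.1, (0 : ℝ)) 1 := by
      simpa using ((hasDerivAt_id (1 : ℝ)).smul_const w.1).prodMk (hasDerivAt_const (1 : ℝ) w.2)
    have hd' : HasFDerivAt α (fderiv ℝ α w) ((1 : ℝ) • w.1, w.2) := by
      simpa using hd.hasFDerivAt
    have h := (hd'.comp_hasDerivAt (1 : ℝ) hl).hasDerivWithinAt (s := Set.Iic 1)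
    exact (h.derivWithin (uniqueDiffOn_Iic 1 1 (by simp))).symm.trans hr
  have hg : DifferentiableAt ℝ (fun y : Space3 × ℝ => ‖y.1‖⁻¹) w :=
    ((contDiffAt_norm_fst (n := 1) hw0).differentiableAt (by norm_num)).fun_inv
      (norm_ne_zero_iff.2 hw0)
  have hn := (hg.hasFDerivAt.smul (hasFDerivAt_fst (𝕜 := ℝ) (p := w))).prodMk
    (hasFDerivAt_snd (𝕜 := ℝ) (p := w))
  have hz : (fun y : Space3 × ℝ => α (‖y.1‖⁻¹ • y.1, y.2)) =ᶠ[nhds w] fun _ => 0 := by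
    filter_upwards [continuousAt_snd.eventually h0, continuousAt_fst.eventually_ne hw0] with y hy hy0
    exact hy _ (by simp [norm_smul, norm_ne_zero_iff.2 hy0])
  have hd' : HasFDerivAt α (fderiv ℝ α w) (‖w.1‖⁻¹ • w.1, w.2) := by
    simpa [hw] using hd.hasFDerivAt
  have hc := (hd'.comp w hn).unique ((hasFDerivAt_const (0 : ℝ) w).congr_of_eventuallyEq hz)
  have : fderiv ℝ α w = 0 := by
    refine ContinuousLinearMap.ext fun v => ?_
    have hv := DFunLike.congr_fun hc v
    have hsplit : (v.1 + (fderiv ℝ (fun y : Space3 × ℝ => ‖y.1‖⁻¹) w v) • w.1, v.2) =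
        v + (fderiv ℝ (fun y : Space3 × ℝ => ‖y.1‖⁻¹) w v) • (w.1, (0 : ℝ)) := by
      ext <;> simp
    simp [hw] at hv
    rw [hsplit, map_add, map_smul, hrad] at hv
    simpa using hv
  rw [← this]
  exact hd.hasFDerivAt

end Localization

/-! ### The conditions on the localized solution -/

section Conditions

variable {α : Space3 × ℝ → ℝ} {p : Space3 → ℝ} {c : ℝ} {z : Space3 × ℝ}

/-- The part of `K` off the cone `t = |x|`. -/
def offCone : Set (Space3 × ℝ) := regionK ∩ {r | r.2 ≠ ‖r.1‖}

theorem isOpen_offCone : IsOpen offCone :=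
  isOpen_regionK.inter (isOpen_ne_fun continuous_snd continuous_fst.norm)

theorem contDiffAt_of_mem_offCone
    (hup : ContDiffOn ℝ 2 α (regionK ∩ {r | ‖r.1‖ ≤ r.2}))
    (hdown : ContDiffOn ℝ 2 α (regionK ∩ {r | r.2 ≤ ‖r.1‖})) (hz : z ∈ offCone) :
    ContDiffAt ℝ 2 α z := by
  have hK := isOpen_regionK.mem_nhds hz.1
  rcases lt_or_gt_of_ne hz.2 with h | h
  · exact hdown.contDiffAt (Filter.inter_mem hK
      ((continuousAt_snd.eventually_lt continuousAt_fst.norm h).mono fun _ => le_of_lt))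
  · exact hup.contDiffAt (Filter.inter_mem hK
      ((continuousAt_fst.norm.eventually_lt continuousAt_snd h).mono fun _ => le_of_lt))

theorem charMap_mem_offCone (hx : z.1 ≠ 0) (hz : 0 < 4 * ‖z.1‖ ^ 2 - z.2 ^ 2) (hs : z.2 ≠ 0) :
    charMap z ∈ offCone :=
  ⟨charMap_mem_regionK hx hz, by simpa [charMap] using hs⟩

/-- Vanishing Cauchy data of `α` on the unit sphere make the localized solution flat there. -/
theorem flatAt_localized
    (hα : ∀ w ∈ offCone, ContDiffAt ℝ 2 α w)
    (hbdry : ∀ (x : Space3) (t : ℝ), ‖x‖ = 1 → -1 < t → t < 3 → t ≠ 1 → α (x, t) = 0 ∧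
      derivWithin (fun s : ℝ => α (s • x, t)) (Set.Iic 1) 1 = 0)
    (hz : ‖z.1‖ = 1) (hs1 : -2 < z.2) (hs2 : z.2 < 2) (hs : z.2 ≠ 0) :
    FlatAt (localized c α) z := by
  have hx : z.1 ≠ 0 := norm_ne_zero_iff.1 (by rw [hz]; norm_num)
  have hw : charMap z ∈ offCone := charMap_mem_offCone hx (by rw [hz]; nlinarith) hs
  have ht : (charMap z).2 = z.2 + 1 := by rw [charMap, hz]
  have h1 : (charMap z).2 ∈ Set.Ioo (-1 : ℝ) 3 ∩ {1}ᶜ := by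
    rw [ht]
    exact ⟨⟨by linarith, by linarith⟩, by simpa using hs⟩
  have hflat : FlatAt α (charMap z) := by
    refine flatAt_of_cauchyData ((hα _ hw).differentiableAt (by norm_num)) hz ?_
      (hbdry z.1 _ hz h1.1.1 h1.1.2 h1.2).2
    filter_upwards [(isOpen_Ioo.inter isOpen_compl_singleton).mem_nhds h1] with t ht x hx
    exact (hbdry x t hx ht.1.1 ht.1.2 ht.2).1
  have hcomp : FlatAt (fun y => α (charMap y)) z := by
    refine ⟨hflat.1, ?_⟩
    have h := hflat.2.comp z
      ((contDiffAt_charMap (n := 1) hx).differentiableAt (by norm_num)).hasFDerivAt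
    rwa [ContinuousLinearMap.zero_comp] at h
  exact hcomp.mul_left
    ((contDiffAt_cutoff_mul_norm (n := 1) (c := c) hx).differentiableAt (by norm_num))

/-- The pointwise bound on the wave operator of the localized solution. -/
theorem reducedWave_localized_sq_le {q : Space3 → ℝ} {C M : ℝ} {S : Set (Space3 × ℝ)}
    (hc : 0 < c) (hα : ∀ w ∈ offCone, ContDiffAt ℝ 2 α w)
    (hwave : ∀ w ∈ offCone, |waveOp3 α w + q w.1 * α w| ≤ C * |p w.1|)
    (hM : ∀ x, ‖x‖ ≤ 1 → |q x| ≤ M) (hS : S ∈ nhds z) (hx : z.1 ≠ 0) (hx1 : ‖z.1‖ ≤ 1)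
    (hs : z.2 ≠ 0) (hz : 2 * c < 4 * ‖z.1‖ ^ 2 - z.2 ^ 2) :
    reducedWave S (localized c α) z ^ 2 ≤
      2 * (C ^ 2 + M ^ 2) * (p z.1 ^ 2 + localized c α z ^ 2) := by
  have hw : charMap z ∈ offCone := charMap_mem_offCone hx (by linarith) hs
  rw [reducedWave_eq hS hx (hα _ hw) (localized_eventuallyEq hc hz), localized_eq hc hz]
  have hb : |waveOp3 α (charMap z) + q z.1 * α (charMap z)| ≤ C * |p z.1| := hwave _ hw
  have hq := hM z.1 hx1
  have hr := norm_pos_iff.2 hx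
  generalize waveOp3 α (charMap z) = W at *
  generalize α (charMap z) = A at *
  generalize ‖z.1‖ = r at *
  generalize q z.1 = Q at *
  generalize p z.1 = P at *
  have hb2 : (W + Q * A) ^ 2 ≤ C ^ 2 * P ^ 2 := by
    have := pow_le_pow_left₀ (abs_nonneg _) hb 2
    rwa [sq_abs, mul_pow, sq_abs] at this
  have hq2 : Q ^ 2 ≤ M ^ 2 := by
    have := pow_le_pow_left₀ (abs_nonneg _) hq 2
    rwa [sq_abs] at this
  have hW : W ^ 2 ≤ 2 * (C ^ 2 * P ^ 2) + 2 * (M ^ 2 * A ^ 2) := by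
    nlinarith [mul_le_mul_of_nonneg_right hq2 (sq_nonneg A), sq_nonneg (W + 2 * (Q * A))]
  have hr6 : (r ^ 3) ^ 2 ≤ r ^ 2 := by
    rw [← pow_mul]
    exact pow_le_pow_of_le_one hr.le hx1 (by norm_num)
  have hr2 : r ^ 2 ≤ 1 := pow_le_one₀ hr.le hx1
  calc (r ^ 3 * W) ^ 2 = (r ^ 3) ^ 2 * W ^ 2 := by ring
    _ ≤ r ^ 2 * (2 * (C ^ 2 * P ^ 2) + 2 * (M ^ 2 * A ^ 2)) := by gcongr
    _ = r ^ 2 * (2 * (C ^ 2 * P ^ 2)) + 2 * (M ^ 2 * (r * A) ^ 2) := by ring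
    _ ≤ 1 * (2 * (C ^ 2 * P ^ 2)) + 2 * (M ^ 2 * (r * A) ^ 2) := by gcongr
    _ ≤ 2 * (C ^ 2 + M ^ 2) * (P ^ 2 + (r * A) ^ 2) := by
      nlinarith [mul_nonneg (sq_nonneg C) (sq_nonneg (r * A)),
        mul_nonneg (sq_nonneg M) (sq_nonneg P)]

/-- The ray integral of `p` is recovered by differentiating along the ray. -/
theorem hasDerivAt_ray_integral (hp : Continuous p) (x : Space3) :
    HasDerivAt (fun l : ℝ => l * ∫ s in Set.Icc (0 : ℝ) 1, p (s • l • x)) (p x) 1 := by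
  have hcont : Continuous fun s : ℝ => p (s • x) := by fun_prop
  have h := intervalIntegral.integral_hasDerivAt_right
    (hcont.intervalIntegrable 0 1) (hcont.stronglyMeasurableAtFilter _ _) hcont.continuousAt
  rw [one_smul] at h
  refine h.congr_of_eventuallyEq (Filter.Eventually.of_forall fun l => ?_)
  have := intervalIntegral.mul_integral_comp_mul_right (a := 0) (b := 1)
    (f := fun s : ℝ => p (s • x)) l
  simp only [zero_mul, one_mul] at this
  simp only [← this, integral_Icc_eq_integral_Ioc, mul_smul,
    intervalIntegral.integral_of_le zero_le_one]

/-- The radial derivative of the localized solution on the cone. -/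
theorem lieD_eulerField_localized (hc : 0 < c) (hp : Continuous p)
    (hV : ContDiffOn ℝ 1 (localized c α) (slab (-2) 0))
    (hchar : ∀ x : Space3, x ≠ 0 → α (x, ‖x‖) = ∫ s in Set.Icc (0 : ℝ) 1, p (s • x))
    {x : Space3} (hx : 2 * c < 4 * ‖x‖ ^ 2) :
    lieD (slab (-2) 0) eulerField (localized c α) (x, 0) = ‖x‖ * p x := by
  have hx0 : x ≠ 0 := by
    rintro rfl
    norm_num at hx
    linarith
  rw [lieD, eulerField, fderivWithin_slab_horizontal hV hx0 (by norm_num)]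
  have hd : DifferentiableAt ℝ (fun x => localized c α (x, 0)) x :=
    ((contDiffOn_slice hV (by norm_num)).contDiffAt
      (isOpen_compl_singleton.mem_nhds hx0)).differentiableAt (by norm_num)
  have hl : HasDerivAt (fun l : ℝ => l • x) x 1 := by
    simpa using (hasDerivAt_id (1 : ℝ)).smul_const x
  have hd' : HasFDerivAt (fun x => localized c α (x, 0))
      (fderiv ℝ (fun x => localized c α (x, 0)) x) ((1 : ℝ) • x) := by
    simpa using hd.hasFDerivAt
  refine (hd'.comp_hasDerivAt (1 : ℝ) hl).unique
    (((hasDerivAt_ray_integral hp x).const_mul ‖x‖).congr_of_eventuallyEq ?_)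
  have hcont : Continuous fun l : ℝ => 4 * ‖l • x‖ ^ 2 := by fun_prop
  filter_upwards [hcont.continuousAt.eventually (lt_mem_nhds (by simpa using hx)),
    lt_mem_nhds (zero_lt_one (α := ℝ))] with l hl hl0
  have : charMap (l • x, 0) = (l • x, ‖l • x‖) := by simp [charMap]
  simp only [Function.comp]
  rw [localized_eq hc (by simpa using hl), this, hchar _ (smul_ne_zero hl0.ne' hx0), norm_smul,
    Real.norm_of_nonneg hl0.le]
  ring

end Conditions

/-- Proposition 4.1 (main proposition for the spherical and point source problem):
if `(□ + q)α = p f` in the sense of distributions on `K`, `α` restricted to the cone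
`t = |x|` is the ray-integral of `p`, and `α` together with its radial derivative vanish
on `S × (−1,3)` (away from the cone), then `p = 0`. -/
theorem spherical_main_proposition
    (p q : EuclideanSpace ℝ (Fin 3) → ℝ)
    (hp : ContDiff ℝ (⊤ : ℕ∞) p) (hq : ContDiff ℝ (⊤ : ℕ∞) q)
    (hpsupp : ∀ x : EuclideanSpace ℝ (Fin 3), 1 < ‖x‖ → p x = 0)
    (hqsupp : ∀ x : EuclideanSpace ℝ (Fin 3), 1 < ‖x‖ → q x = 0)
    (hporig : ∃ ε > (0 : ℝ), ∀ x : EuclideanSpace ℝ (Fin 3), ‖x‖ < ε → p x = 0)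
    (hqorig : ∃ ε > (0 : ℝ), ∀ x : EuclideanSpace ℝ (Fin 3), ‖x‖ < ε → q x = 0)
    (f : EuclideanSpace ℝ (Fin 3) × ℝ → ℝ) (hf_meas : Measurable f)
    (C : ℝ) (hf_bdd : ∀ r ∈ regionK, |f r| ≤ C)
    (α : EuclideanSpace ℝ (Fin 3) × ℝ → ℝ)
    (hα_cont : ContinuousOn α regionK)
    -- (i) bounded t-sections
    (hα_sections : ∀ t : ℝ,
      Bornology.IsBounded {x : EuclideanSpace ℝ (Fin 3) | (x, t) ∈ regionK ∧ α (x, t) ≠ 0})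
    -- (ii) smooth on each side of the cone t = |x|
    (hα_smooth_up : ContDiffOn ℝ (⊤ : ℕ∞) α (regionK ∩ {r | ‖r.1‖ ≤ r.2}))
    (hα_smooth_down : ContDiffOn ℝ (⊤ : ℕ∞) α (regionK ∩ {r | r.2 ≤ ‖r.1‖}))
    -- (iii) (□ + q)α = p·f in the sense of distributions on K
    (hα_pde : ∀ χ : EuclideanSpace ℝ (Fin 3) × ℝ → ℝ, ContDiff ℝ (⊤ : ℕ∞) χ →
      HasCompactSupport χ → tsupport χ ⊆ regionK →
      (∫ r in regionK, α r * (waveOp3 χ r + q r.1 * χ r))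
        = ∫ r in regionK, p r.1 * f r * χ r)
    -- (iv) characteristic condition on the cone
    (hα_char : ∀ x : EuclideanSpace ℝ (Fin 3), x ≠ 0 →
      α (x, ‖x‖) = ∫ s in Set.Icc (0 : ℝ) 1, p (s • x))
    -- (v) vanishing Cauchy data on the lateral boundary
    (hα_bdry : ∀ (x : EuclideanSpace ℝ (Fin 3)) (t : ℝ), ‖x‖ = 1 → -1 < t → t < 3 →
      t ≠ 1 → α (x, t) = 0 ∧
        derivWithin (fun s : ℝ => α (s • x, t)) (Set.Iic 1) 1 = 0) :
    ∀ x : EuclideanSpace ℝ (Fin 3), p x = 0 := by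
  have hup : ContDiffOn ℝ 2 α (regionK ∩ {r | ‖r.1‖ ≤ r.2}) :=
    hα_smooth_up.of_le (WithTop.coe_le_coe.2 le_top)
  have hdown : ContDiffOn ℝ 2 α (regionK ∩ {r | r.2 ≤ ‖r.1‖}) :=
    hα_smooth_down.of_le (WithTop.coe_le_coe.2 le_top)
  have hα : ∀ w ∈ offCone, ContDiffAt ℝ 2 α w := fun w hw =>
    contDiffAt_of_mem_offCone hup hdown hw
  have hwave : ∀ w ∈ offCone, |waveOp3 α w + q w.1 * α w| ≤ C * |p w.1| := fun w hw =>
    abs_waveOp3_add_le hp.continuous hq.continuous hf_meas hf_bdd isOpen_offCone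
      Set.inter_subset_left (fun w hw => (hα w hw).contDiffWithinAt) hα_pde hw
  obtain ⟨M, hM⟩ := (isCompact_closedBall (0 : Space3) 1).exists_bound_of_continuousOn
    hq.continuous.continuousOn
  have hM' : ∀ x : Space3, ‖x‖ ≤ 1 → |q x| ≤ M := fun x hx => hM x (by simpa using hx)
  have hin : ∀ x : Space3, ‖x‖ < 1 → p x = 0 := by
    intro x hx
    by_cases hx0 : x = 0
    · obtain ⟨ε, hε, h⟩ := hporig
      exact h x (by simpa [hx0] using hε)
    have hc : 0 < ‖x‖ ^ 2 := by positivity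
    have h1 : ContDiffOn ℝ 2 (localized (‖x‖ ^ 2) α) (slab (-2) 0) :=
      contDiffOn_localized hc hdown fun z hz => by simpa [charMap] using hz.2.2
    have h2 : ContDiffOn ℝ 2 (localized (‖x‖ ^ 2) α) (slab 0 2) :=
      contDiffOn_localized hc hup fun z hz => by simpa [charMap] using hz.2.1
    refine source_eq_zero hc (by linarith : ‖x‖ ^ 2 < 2 * ‖x‖ ^ 2) hp.continuous
      (by positivity : 0 ≤ 2 * (C ^ 2 + M ^ 2)) h1 h2 (fun z hz => localized_eq_zero hc hz)
      (fun z hz hs => flatAt_localized hα hα_bdry hz hs.1 (by linarith [hs.2]) hs.2.ne)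
      (fun z hz hs => flatAt_localized hα hα_bdry hz (by linarith [hs.1]) hs.2 hs.1.ne')
      (fun z hz hz1 hs => reducedWave_localized_sq_le hc hα hwave hM' (slab_mem_nhds hz hs) hz hz1
        hs.2.ne)
      (fun z hz hz1 hs => reducedWave_localized_sq_le hc hα hwave hM' (slab_mem_nhds hz hs) hz hz1
        hs.1.ne')
      (fun y _ hy => lieD_eulerField_localized hc hp.continuous (h1.of_le (by norm_num)) hα_char hy)
      hx (by linarith)
  intro x
  rcases lt_or_ge 1 ‖x‖ with h | h
  · exact hpsupp x h
  · have hcl : closure (Metric.ball (0 : Space3) 1) ⊆ {y | p y = 0} :=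
      closure_minimal (fun y hy => hin y (by simpa using hy))
        (isClosed_eq hp.continuous continuous_const)
    rw [closure_ball _ one_ne_zero] at hcl
    exact hcl (by simpa using h)
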